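/- arXiv:1005.1622 — 2 statements merged into one kernel-verified Lean document; each statement's English description precedes it below -/
import Mathlib

section
/- Rogers-type first moment formula: let d > r ≥ 1 be integers and F : (ℝ^d)^r → ℝ a bounded compactly supported Borel function. Define f : SL(d,ℝ)/SL(d,ℤ) → ℝ by f(M) = ∑ F(M m¹, …, M m^r) where the sum is over linearly independent r-tuples (m¹,…,m^r) of vectors in ℤ^d. Then ∫ f dμ = ∫_{(ℝ^d)^r} F(x¹, …, x^r) dx¹ ⋯ dx^r, where μ is the Haar probability measure on SL(d,ℝ)/SL(d,ℤ). -/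
open MeasureTheory

/-- The subgroup `SL(d, ℤ)` of `SL(d, ℝ)` (images of integer matrices). -/
def SLZ (d : ℕ) : Subgroup (Matrix.SpecialLinearGroup (Fin d) ℝ) :=
  (Matrix.SpecialLinearGroup.map (n := Fin d) (Int.castRingHom ℝ)).range

instance (d : ℕ) : TopologicalSpace (Matrix.SpecialLinearGroup (Fin d) ℝ) := by
  unfold Matrix.SpecialLinearGroup; infer_instance

instance (d : ℕ) : MeasurableSpace (Matrix.SpecialLinearGroup (Fin d) ℝ) := borel _

section

open Filter Topology Set
open scoped ENNReal

/-- If, along a sequence of families of measure-preserving maps, the averages of `h` converge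
pointwise to a constant, then the constant is the integral of `h`; no integrability is assumed. -/
theorem lintegral_eq_of_tendsto_average {Ω S : Type*} [MeasurableSpace Ω] [MeasurableSpace S]
    (μ : Measure Ω) [IsProbabilityMeasure μ] (ρ : Measure S) [IsProbabilityMeasure ρ]
    (T : ℕ → S → Ω → Ω) (hT : ∀ n s, MeasurePreserving (T n s) μ μ) {h : Ω → ℝ≥0∞}
    (hh : Measurable h) (hjoint : ∀ n, Measurable fun p : S × Ω => h (T n p.1 p.2)) (c : ℝ≥0∞)
    (hlim : ∀ x, Tendsto (fun n => ∫⁻ s, h (T n s x) ∂ρ) atTop (𝓝 c)) :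
    ∫⁻ x, h x ∂μ = c := by
  have hswap : ∀ n, ∀ k : ℝ≥0∞ → ℝ≥0∞, Measurable k →
      ∫⁻ x, ∫⁻ s, k (h (T n s x)) ∂ρ ∂μ = ∫⁻ x, k (h x) ∂μ := by
    intro n k hk
    rw [lintegral_lintegral_swap]
    · have : ∀ s, ∫⁻ x, k (h (T n s x)) ∂μ = ∫⁻ x, k (h x) ∂μ := fun s =>
        (hT n s).lintegral_comp (hk.comp hh)
      simp [this]
    · exact (hk.comp ((hjoint n).comp measurable_swap)).aemeasurable
  have hmeas : ∀ n, Measurable fun x => ∫⁻ s, h (T n s x) ∂ρ := fun n =>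
    Measurable.lintegral_prod_right' ((hjoint n).comp measurable_swap)
  apply le_antisymm
  · have htrunc : ∀ N : ℕ, ∫⁻ x, min (h x) N ∂μ ≤ c := by
      intro N
      have h1 : Tendsto (fun n => ∫⁻ x, min (∫⁻ s, h (T n s x) ∂ρ) N ∂μ) atTop
          (𝓝 (∫⁻ _, min c N ∂μ)) := by
        refine tendsto_lintegral_of_dominated_convergence (fun _ => (N : ℝ≥0∞))
          (fun n => (hmeas n).min measurable_const)
          (fun n => Eventually.of_forall fun x => min_le_right _ _) (by simp)
          (Eventually.of_forall fun x => (hlim x).min tendsto_const_nhds)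
      refine le_trans (ge_of_tendsto h1 (Eventually.of_forall fun n => ?_)) (by simp)
      rw [← hswap n (fun t => min t N) (measurable_id.min measurable_const)]
      refine lintegral_mono fun x => le_min ?_ ?_
      · exact lintegral_mono fun s => min_le_left _ _
      · exact (lintegral_mono fun s => min_le_right _ _).trans (by simp)
    have hsup : ∀ x, h x = ⨆ N : ℕ, min (h x) N := by
      intro x
      refine le_antisymm ?_ (iSup_le fun N => min_le_left _ _)
      rw [← inf_iSup_eq, ENNReal.iSup_natCast, inf_top_eq]
    rw [lintegral_congr hsup, lintegral_iSup (fun N => hh.min measurable_const)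
      (fun i j hij x => min_le_min_left _ (by exact_mod_cast hij))]
    exact iSup_le htrunc
  · calc c = ∫⁻ _, c ∂μ := by simp
      _ = ∫⁻ x, liminf (fun n => ∫⁻ s, h (T n s x) ∂ρ) atTop ∂μ :=
        lintegral_congr fun x => (hlim x).liminf_eq.symm
      _ ≤ liminf (fun n => ∫⁻ x, ∫⁻ s, h (T n s x) ∂ρ ∂μ) atTop := lintegral_liminf_le hmeas
      _ = ∫⁻ x, h x ∂μ := by
        have := fun n => hswap n id measurable_id
        simp only [id] at this
        simp [this]

/-- Comparing two measures on an open set by testing against continuous functions compactly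
supported inside it. -/
theorem measure_le_of_lintegral_le {X : Type*} [MetricSpace X] [ProperSpace X]
    [MeasurableSpace X] [BorelSpace X] (ν₁ ν₂ : Measure X) {O : Set X} (hO : IsOpen O)
    (h : ∀ f : X → ℝ, Continuous f → HasCompactSupport f → tsupport f ⊆ O → (∀ x, 0 ≤ f x) →
      ∫⁻ x, ENNReal.ofReal (f x) ∂ν₁ ≤ ∫⁻ x, ENNReal.ofReal (f x) ∂ν₂) : ν₁ O ≤ ν₂ O := by
  have hcpt : ∀ K, IsCompact K → K ⊆ O → ν₁ K ≤ ν₂ O := by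
    intro K hK hKO
    obtain ⟨L, hL, hKL, hLO⟩ := exists_compact_between hK hO hKO
    obtain ⟨f, hf1, hf0, hfc, hf⟩ := exists_continuous_one_zero_of_isCompact hK
      isOpen_interior.isClosed_compl (disjoint_compl_right_iff_subset.mpr hKL)
    have hsupp : Function.support f ⊆ L := by
      intro x hx
      by_contra hxL
      exact hx (hf0 fun hxi => hxL (interior_subset hxi))
    have hts : tsupport f ⊆ O := (closure_minimal hsupp hL.isClosed).trans hLO
    calc ν₁ K = ∫⁻ x, K.indicator 1 x ∂ν₁ := (lintegral_indicator_one hK.measurableSet).symm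
      _ ≤ ∫⁻ x, ENNReal.ofReal (f x) ∂ν₁ := by
        refine lintegral_mono fun x => ?_
        by_cases hx : x ∈ K
        · simp [hx, hf1 hx]
        · simp [hx]
      _ ≤ ∫⁻ x, ENNReal.ofReal (f x) ∂ν₂ := h f f.continuous hfc hts fun x => (hf x).1
      _ ≤ ∫⁻ x, O.indicator 1 x ∂ν₂ := by
        refine lintegral_mono fun x => ?_
        by_cases hx : x ∈ O
        · simpa [hx] using (hf x).2
        · simp [hx, image_eq_zero_of_notMem_tsupport fun hx' => hx (hts hx')]
      _ = ν₂ O := lintegral_indicator_one hO.measurableSet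
  obtain ⟨C, hCc, hCO, hCU, hCm⟩ := hO.exists_iUnion_isClosed
  rcases isEmpty_or_nonempty X with hX | ⟨⟨x₀⟩⟩
  · simp [Set.eq_empty_of_isEmpty O]
  have hO_eq : O = ⋃ n, C n ∩ Metric.closedBall x₀ n := by
    rw [iUnion_inter_of_monotone hCm, hCU, Metric.iUnion_closedBall_nat, inter_univ]
    exact fun i j hij => Metric.closedBall_subset_closedBall (by exact_mod_cast hij)
  have hmono : Monotone fun n : ℕ => C n ∩ Metric.closedBall x₀ n := fun i j hij =>
    inter_subset_inter (hCm hij) (Metric.closedBall_subset_closedBall (by exact_mod_cast hij))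
  rw [hO_eq, hmono.measure_iUnion, ← hO_eq]
  exact iSup_le fun n => hcpt _ ((isCompact_closedBall x₀ n).inter_left (hCc n))
    (inter_subset_left.trans (hCO n))

theorem restrict_eq_restrict_of_lintegral_eq {X : Type*} [MetricSpace X] [ProperSpace X]
    [MeasurableSpace X] [BorelSpace X] (ν₁ ν₂ : Measure X) [IsFiniteMeasureOnCompacts ν₂]
    {U : Set X} (hU : IsOpen U)
    (h : ∀ f : X → ℝ, Continuous f → HasCompactSupport f → tsupport f ⊆ U → (∀ x, 0 ≤ f x) →
      ∫⁻ x, ENNReal.ofReal (f x) ∂ν₁ = ∫⁻ x, ENNReal.ofReal (f x) ∂ν₂) :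
    ν₁.restrict U = ν₂.restrict U := by
  rcases isEmpty_or_nonempty X with hX | ⟨⟨x₀⟩⟩
  · exact Subsingleton.elim _ _
  have hopen : ∀ O, IsOpen O → O ⊆ U → ν₁ O = ν₂ O := fun O hO hOU => le_antisymm
    (measure_le_of_lintegral_le ν₁ ν₂ hO fun f h1 h2 h3 h4 => (h f h1 h2 (h3.trans hOU) h4).le)
    (measure_le_of_lintegral_le ν₂ ν₁ hO fun f h1 h2 h3 h4 => (h f h1 h2 (h3.trans hOU) h4).ge)
  symm
  refine Measure.ext_of_generateFrom_of_iUnion {O | IsOpen O} (fun n : ℕ => Metric.ball x₀ n)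
    BorelSpace.measurable_eq isPiSystem_isOpen (Metric.iUnion_ball_nat x₀)
    (fun n => Metric.isOpen_ball) (fun n => ?_) fun O hO => ?_
  · exact ((Measure.restrict_apply_le _ _).trans_lt measure_ball_lt_top).ne
  · have hO : IsOpen O := hO
    rw [Measure.restrict_apply hO.measurableSet, Measure.restrict_apply hO.measurableSet]
    exact (hopen _ (hO.inter hU) inter_subset_right).symm

/-- Simultaneous action of a matrix on the vectors of a tuple. -/
def tupleAct {d r : ℕ} (M : Matrix (Fin d) (Fin d) ℝ) (x : Fin r → Fin d → ℝ) :
    Fin r → Fin d → ℝ :=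
  fun j => M.mulVec (x j)

/-- The real tuple underlying a tuple of integer vectors. -/
def realTuple {d r : ℕ} (m : Fin r → Fin d → ℤ) : Fin r → Fin d → ℝ :=
  fun j i => (m j i : ℝ)

/-- Linearly independent tuples of integer vectors. -/
abbrev IndepTuple (d r : ℕ) : Type :=
  {m : Fin r → Fin d → ℤ //
    LinearIndependent ℝ fun j : Fin r => fun i : Fin d => ((m j i : ℝ))}

theorem tupleAct_mul {d r : ℕ} (M N : Matrix (Fin d) (Fin d) ℝ) (x : Fin r → Fin d → ℝ) :
    tupleAct (M * N) x = tupleAct M (tupleAct N x) := by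
  funext j
  simp [tupleAct, Matrix.mulVec_mulVec]

@[simp]
theorem tupleAct_one {d r : ℕ} (x : Fin r → Fin d → ℝ) : tupleAct 1 x = x := by
  funext j
  simp [tupleAct]

theorem tupleAct_smul {d r : ℕ} (M : Matrix (Fin d) (Fin d) ℝ) (c : ℝ)
    (x : Fin r → Fin d → ℝ) : tupleAct M (c • x) = c • tupleAct M x := by
  funext j
  simp [tupleAct, Matrix.mulVec_smul]

theorem continuous_tupleAct {d r : ℕ} :
    Continuous fun p : Matrix (Fin d) (Fin d) ℝ × (Fin r → Fin d → ℝ) => tupleAct p.1 p.2 := by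
  unfold tupleAct
  exact continuous_pi fun j =>
    continuous_fst.matrix_mulVec ((continuous_apply j).comp continuous_snd)

theorem tupleAct_inv_tupleAct {d r : ℕ} (M : Matrix.SpecialLinearGroup (Fin d) ℝ)
    (x : Fin r → Fin d → ℝ) :
    tupleAct (M⁻¹ : Matrix.SpecialLinearGroup (Fin d) ℝ).val (tupleAct M.val x) = x := by
  rw [← tupleAct_mul, ← Matrix.SpecialLinearGroup.coe_mul]
  simp

theorem linearIndependent_tupleAct {d r : ℕ} (M : Matrix.SpecialLinearGroup (Fin d) ℝ)
    {x : Fin r → Fin d → ℝ} (hx : LinearIndependent ℝ x) :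
    LinearIndependent ℝ (tupleAct M.val x) := by
  have hinj : LinearMap.ker (Matrix.mulVecLin M.val) = ⊥ := by
    rw [LinearMap.ker_eq_bot]
    exact Matrix.mulVec_injective_of_isUnit (by
      rw [Matrix.isUnit_iff_isUnit_det, M.det_coe]; exact isUnit_one)
  exact hx.map' _ hinj

theorem linearIndependent_tupleAct_iff {d r : ℕ} (M : Matrix.SpecialLinearGroup (Fin d) ℝ)
    {x : Fin r → Fin d → ℝ} :
    LinearIndependent ℝ (tupleAct M.val x) ↔ LinearIndependent ℝ x :=
  ⟨fun h => tupleAct_inv_tupleAct M x ▸ linearIndependent_tupleAct M⁻¹ h,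
    linearIndependent_tupleAct M⟩

theorem measurePreserving_tupleAct {d r : ℕ} (M : Matrix.SpecialLinearGroup (Fin d) ℝ) :
    MeasurePreserving (tupleAct (r := r) M.val) volume volume := by
  have h1 : MeasurePreserving (Matrix.toLin' M.val) volume volume := by
    refine ⟨(LinearMap.continuous_of_finiteDimensional _).measurable, ?_⟩
    rw [Real.map_matrix_volume_pi_eq_smul_volume_pi (by simp [M.det_coe]), M.det_coe]
    simp
  exact volume_preserving_pi fun _ : Fin r => h1

/-- The sum of `G` over the linearly independent tuples of the lattice `M ℤ^d`. -/
noncomputable def siegelSum {d r : ℕ} (G : (Fin r → Fin d → ℝ) → ℝ≥0∞)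
    (M : Matrix.SpecialLinearGroup (Fin d) ℝ) : ℝ≥0∞ :=
  ∑' m : IndepTuple d r, G (tupleAct M.val (realTuple m.val))

/-- The action of `SL(d, ℤ)` on linearly independent integer tuples. -/
def indepTupleEquiv {d r : ℕ} (γ : Matrix.SpecialLinearGroup (Fin d) ℤ) :
    IndepTuple d r ≃ IndepTuple d r :=
  have key : ∀ (γ : Matrix.SpecialLinearGroup (Fin d) ℤ) (m : IndepTuple d r),
      LinearIndependent ℝ (realTuple fun j => γ.val.mulVec (m.val j)) := by
    intro γ m
    have : (realTuple fun j => γ.val.mulVec (m.val j)) =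
        tupleAct (Matrix.SpecialLinearGroup.map (Int.castRingHom ℝ) γ).val
          (realTuple m.val) := by
      funext j i
      simp [realTuple, tupleAct, Matrix.mulVec, dotProduct]
    rw [this]
    exact linearIndependent_tupleAct _ m.2
  { toFun := fun m => ⟨fun j => γ.val.mulVec (m.val j), key γ m⟩
    invFun := fun m => ⟨fun j => (γ⁻¹).val.mulVec (m.val j), key γ⁻¹ m⟩
    left_inv := fun m => by
      ext1; funext j
      simp only [Matrix.mulVec_mulVec, ← Matrix.SpecialLinearGroup.coe_mul]
      simp
    right_inv := fun m => by
      ext1; funext j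
      simp only [Matrix.mulVec_mulVec, ← Matrix.SpecialLinearGroup.coe_mul]
      simp }

theorem tupleAct_map_realTuple {d r : ℕ} (γ : Matrix.SpecialLinearGroup (Fin d) ℤ)
    (m : IndepTuple d r) :
    tupleAct (Matrix.SpecialLinearGroup.map (Int.castRingHom ℝ) γ).val (realTuple m.val) =
      realTuple (indepTupleEquiv γ m).val := by
  funext j i
  simp [realTuple, tupleAct, Matrix.mulVec, dotProduct, indepTupleEquiv]

theorem siegelSum_mul_mem {d r : ℕ} (G : (Fin r → Fin d → ℝ) → ℝ≥0∞)
    (M : Matrix.SpecialLinearGroup (Fin d) ℝ) {γ : Matrix.SpecialLinearGroup (Fin d) ℝ}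
    (hγ : γ ∈ SLZ d) : siegelSum G (M * γ) = siegelSum G M := by
  obtain ⟨γ, rfl⟩ := hγ
  unfold siegelSum
  rw [← (indepTupleEquiv γ).tsum_eq fun m => G (tupleAct M.val (realTuple m.val))]
  refine tsum_congr fun m => ?_
  rw [Matrix.SpecialLinearGroup.coe_mul, tupleAct_mul, tupleAct_map_realTuple]

theorem siegelSum_out {d r : ℕ} (G : (Fin r → Fin d → ℝ) → ℝ≥0∞)
    (M : Matrix.SpecialLinearGroup (Fin d) ℝ) :
    siegelSum G (QuotientGroup.mk M : Matrix.SpecialLinearGroup (Fin d) ℝ ⧸ SLZ d).out =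
      siegelSum G M := by
  obtain ⟨γ, hγ⟩ := QuotientGroup.mk_out_eq_mul (SLZ d) M
  rw [hγ, siegelSum_mul_mem G M γ.2]

theorem borelSpace_specialLinearGroup (d : ℕ) :
    BorelSpace (Matrix.SpecialLinearGroup (Fin d) ℝ) := ⟨rfl⟩

theorem continuous_val (d : ℕ) :
    Continuous fun M : Matrix.SpecialLinearGroup (Fin d) ℝ => M.val :=
  continuous_subtype_val

theorem measurable_siegelSum {d r : ℕ} {G : (Fin r → Fin d → ℝ) → ℝ≥0∞} (hG : Measurable G) :
    Measurable (siegelSum G) := by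
  have := borelSpace_specialLinearGroup d
  refine Measurable.tsum fun m => hG.comp (Continuous.measurable ?_)
  exact continuous_tupleAct.comp ((continuous_val d).prodMk continuous_const)

theorem measurable_siegelSum_out {d r : ℕ} {G : (Fin r → Fin d → ℝ) → ℝ≥0∞}
    (hG : Measurable G) :
    Measurable fun q : Matrix.SpecialLinearGroup (Fin d) ℝ ⧸ SLZ d => siegelSum G q.out := by
  refine measurable_from_quotient.2 ?_
  convert measurable_siegelSum hG using 1
  funext M
  exact siegelSum_out G M

theorem measurable_smul_quotient {d : ℕ} (g : Matrix.SpecialLinearGroup (Fin d) ℝ) :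
    Measurable fun x : Matrix.SpecialLinearGroup (Fin d) ℝ ⧸ SLZ d => g • x := by
  have := borelSpace_specialLinearGroup d
  refine measurable_from_quotient.2 ?_
  have h1 : Measurable fun M : Matrix.SpecialLinearGroup (Fin d) ℝ => g * M := by
    refine Continuous.measurable (Continuous.subtype_mk ?_ _)
    exact continuous_const.matrix_mul (continuous_val d)
  exact measurable_quotient_mk''.comp h1

/-- The square matrix formed by the coordinates `e` of the tuple `X`. -/
def tupleMinor {d r : ℕ} (e : Fin r → Fin d) (X : Fin r → Fin d → ℝ) :
    Matrix (Fin r) (Fin r) ℝ :=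
  Matrix.of fun k j => X j (e k)

/-- Replace the `i₀`-th coordinates of the vectors of a tuple. -/
def replaceRow {d r : ℕ} (i₀ : Fin d) (X : Fin r → Fin d → ℝ) (w : Fin r → ℝ) :
    Fin r → Fin d → ℝ :=
  fun j => Function.update (X j) i₀ (w j)

/-- The shear adding the combination of the coordinates `e` with weights `s` to the coordinate
`i₀`. -/
noncomputable def shearMatrix {d r : ℕ} (e : Fin r → Fin d) (i₀ : Fin d) (s : Fin r → ℝ) :
    Matrix (Fin d) (Fin d) ℝ :=
  1 + Matrix.replicateCol Unit (Pi.single i₀ 1 : Fin d → ℝ) *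
    Matrix.replicateRow Unit (∑ k, s k • (Pi.single (e k) 1 : Fin d → ℝ))

theorem det_shearMatrix {d r : ℕ} {e : Fin r → Fin d} {i₀ : Fin d} (hi₀ : ∀ k, e k ≠ i₀)
    (s : Fin r → ℝ) : (shearMatrix e i₀ s).det = 1 := by
  rw [shearMatrix, Matrix.det_one_add_replicateCol_mul_replicateRow]
  simp [Finset.sum_apply, fun k => (hi₀ k).symm]

theorem shearMatrix_mulVec {d r : ℕ} (e : Fin r → Fin d) (i₀ : Fin d) (s : Fin r → ℝ)
    (x : Fin d → ℝ) :
    (shearMatrix e i₀ s).mulVec x = x + Pi.single i₀ (∑ k, s k * x (e k)) := by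
  rw [shearMatrix, Matrix.add_mulVec, Matrix.one_mulVec, ← Matrix.mulVec_mulVec]
  congr 1
  funext i
  simp [Matrix.mulVec, dotProduct, Pi.single_apply, Finset.sum_apply, Finset.sum_mul,
    Finset.sum_comm (γ := Fin d), Matrix.replicateCol, Matrix.replicateRow]

/-- The diagonal matrix contracting by `N` in all directions but `i₀`. -/
noncomputable def contractMatrix {d : ℕ} (i₀ : Fin d) (N : ℝ) : Matrix (Fin d) (Fin d) ℝ :=
  Matrix.diagonal fun i => if i = i₀ then N ^ (d - 1) else N⁻¹

theorem det_contractMatrix {d : ℕ} (i₀ : Fin d) {N : ℝ} (hN : N ≠ 0) :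
    (contractMatrix i₀ N).det = 1 := by
  rw [contractMatrix, Matrix.det_diagonal, ← Finset.mul_prod_erase _ _ (Finset.mem_univ i₀),
    Finset.prod_congr rfl fun i hi => if_neg (Finset.ne_of_mem_erase hi)]
  simp [hN]

/-- Contraction composed with a shear, an element of `SL(d, ℝ)`. -/
noncomputable def contractShear {d r : ℕ} (e : Fin r → Fin d) (i₀ : Fin d)
    (hi₀ : ∀ k, e k ≠ i₀) {N : ℝ} (hN : N ≠ 0) (s : Fin r → ℝ) :
    Matrix.SpecialLinearGroup (Fin d) ℝ :=
  ⟨contractMatrix i₀ N * shearMatrix e i₀ s, by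
    rw [Matrix.det_mul, det_contractMatrix i₀ hN, det_shearMatrix hi₀, one_mul]⟩

theorem tupleAct_contractShear_smul {d r : ℕ} (e : Fin r → Fin d) (i₀ : Fin d)
    (hi₀ : ∀ k, e k ≠ i₀) {N : ℝ} (hN : N ≠ 0) (s : Fin r → ℝ) (Y : Fin r → Fin d → ℝ) :
    tupleAct (contractShear e i₀ hi₀ hN s).val (N • Y) =
      replaceRow i₀ Y (N ^ d • ((fun j => Y j i₀) + Matrix.vecMul s (tupleMinor e Y))) := by
  have hd : d ≠ 0 := fun h => by subst h; exact i₀.elim0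
  funext j i
  simp only [tupleAct, contractShear, ← Matrix.mulVec_mulVec, shearMatrix_mulVec, contractMatrix,
    Matrix.mulVec_diagonal, replaceRow]
  by_cases hi : i = i₀
  · subst hi
    simp only [if_true, Pi.add_apply, Pi.smul_apply, smul_eq_mul, Pi.single_eq_same,
      Function.update_self, Matrix.vecMul, dotProduct, tupleMinor, Matrix.of_apply]
    rw [← pow_sub_one_mul hd, mul_assoc, mul_add N, Finset.mul_sum]
    congr 2
    exact Finset.sum_congr rfl fun k _ => by ring
  · simp [hi, hN]

theorem continuous_contractShear {d r : ℕ} (e : Fin r → Fin d) (i₀ : Fin d)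
    (hi₀ : ∀ k, e k ≠ i₀) {N : ℝ} (hN : N ≠ 0) :
    Continuous fun s => (contractShear e i₀ hi₀ hN s : Matrix.SpecialLinearGroup (Fin d) ℝ) := by
  have h : Continuous fun s : Fin r → ℝ => shearMatrix e i₀ s := by
    refine continuous_const.add (Continuous.matrix_mul continuous_const ?_)
    refine continuous_matrix fun _ i => ?_
    simp only [Matrix.replicateRow_apply, Finset.sum_apply, Pi.smul_apply, smul_eq_mul]
    fun_prop
  exact Continuous.subtype_mk ((continuous_const (y := contractMatrix i₀ N)).matrix_mul h) _

theorem tupleMinor_replaceRow {d r : ℕ} {e : Fin r → Fin d} {i₀ : Fin d}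
    (hi₀ : ∀ k, e k ≠ i₀) (X : Fin r → Fin d → ℝ) (w : Fin r → ℝ) :
    tupleMinor e (replaceRow i₀ X w) = tupleMinor e X := by
  ext k j
  simp [tupleMinor, replaceRow, hi₀ k]

theorem continuous_tupleMinor {d r : ℕ} (e : Fin r → Fin d) : Continuous (tupleMinor e) :=
  continuous_matrix fun k j => by simp only [tupleMinor, Matrix.of_apply]; fun_prop

theorem continuous_replaceRow {d r : ℕ} (i₀ : Fin d) :
    Continuous fun p : (Fin r → Fin d → ℝ) × (Fin r → ℝ) => replaceRow i₀ p.1 p.2 :=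
  continuous_pi fun j => ((continuous_apply j).comp continuous_fst).update i₀
    ((continuous_apply j).comp continuous_snd)

theorem lintegral_smul_add_vecMul {r : ℕ} {A : Matrix (Fin r) (Fin r) ℝ} (hA : A.det ≠ 0)
    {c : ℝ} (hc : 0 < c) (z : Fin r → ℝ) {Q : (Fin r → ℝ) → ℝ≥0∞} (hQ : Measurable Q) :
    ∫⁻ s, Q (c • (z + Matrix.vecMul s A)) =
      ENNReal.ofReal ((c ^ r)⁻¹ * |A.det|⁻¹) * ∫⁻ w, Q w := by
  have hdet : (c • A.transpose).det = c ^ r * A.det := by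
    simp
  have hdet0 : (c • A.transpose).det ≠ 0 := by
    rw [hdet]; positivity
  have h1 : ∀ s, Q (c • (z + Matrix.vecMul s A)) =
      (fun w => Q (c • z + w)) (Matrix.toLin' (c • A.transpose) s) := by
    intro s
    simp [Matrix.mulVec_transpose]
  simp_rw [h1]
  rw [← lintegral_map (f := fun w => Q (c • z + w)) (hQ.comp (measurable_const_add _))
    (LinearMap.continuous_of_finiteDimensional _).measurable,
    Real.map_matrix_volume_pi_eq_smul_volume_pi hdet0, lintegral_smul_measure,
    lintegral_add_left_eq_self Q, hdet, smul_eq_mul, mul_inv, abs_mul, abs_inv, abs_inv,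
    abs_of_pos (pow_pos hc r)]

/-- The integrand of `shearAverage`. -/
noncomputable def shearKernel {d r : ℕ} (e : Fin r → Fin d) (i₀ : Fin d)
    (F : (Fin r → Fin d → ℝ) → ℝ) (ρ : (Fin r → ℝ) → ℝ) (p : ℝ × (Fin r → Fin d → ℝ))
    (w : Fin r → ℝ) : ℝ :=
  |(tupleMinor e p.2).det|⁻¹ * (F (replaceRow i₀ p.2 w) *
    ρ ((tupleMinor e p.2).det⁻¹ •
      Matrix.vecMul (p.1 • w - fun j => p.2 j i₀) (tupleMinor e p.2).adjugate))

/-- The rescaled average of `F` over the matrices `contractShear`, as a function of the inverse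
scale and of the rescaled tuple; it extends continuously to inverse scale zero. -/
noncomputable def shearAverage {d r : ℕ} (e : Fin r → Fin d) (i₀ : Fin d)
    (F : (Fin r → Fin d → ℝ) → ℝ) (ρ : (Fin r → ℝ) → ℝ) (p : ℝ × (Fin r → Fin d → ℝ)) : ℝ :=
  ∫ w, shearKernel e i₀ F ρ p w

section Average

variable {d r : ℕ} {e : Fin r → Fin d} {i₀ : Fin d} {F : (Fin r → Fin d → ℝ) → ℝ}
  {ρ : (Fin r → ℝ) → ℝ}

theorem continuous_shearKernel (hi₀ : ∀ k, e k ≠ i₀) (hF : Continuous F)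
    (hFs : tsupport F ⊆ {X | (tupleMinor e X).det ≠ 0}) (hρ : Continuous ρ) :
    Continuous (Function.uncurry (shearKernel e i₀ F ρ)) := by
  have hrep : Continuous fun q : (ℝ × (Fin r → Fin d → ℝ)) × (Fin r → ℝ) =>
      replaceRow i₀ q.1.2 q.2 :=
    (continuous_replaceRow i₀).comp ((continuous_snd.comp continuous_fst).prodMk continuous_snd)
  have hmin : Continuous fun q : (ℝ × (Fin r → Fin d → ℝ)) × (Fin r → ℝ) =>
      tupleMinor e q.1.2 :=
    (continuous_tupleMinor e).comp (continuous_snd.comp continuous_fst)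
  rw [continuous_iff_continuousAt]
  intro q
  by_cases hq : (tupleMinor e q.1.2).det = 0
  · have hnot : replaceRow i₀ q.1.2 q.2 ∉ tsupport F := fun h => hFs h (by
      rw [tupleMinor_replaceRow hi₀, hq])
    have hev : ∀ᶠ q' in 𝓝 q, replaceRow i₀ q'.1.2 q'.2 ∉ tsupport F :=
      hrep.continuousAt.eventually ((isClosed_tsupport F).isOpen_compl.mem_nhds hnot)
    refine (continuousAt_const (y := (0 : ℝ))).congr (hev.mono fun q' hq' => ?_)
    simp [Function.uncurry, shearKernel, image_eq_zero_of_notMem_tsupport hq']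
  · have hdet : ContinuousAt (fun q : (ℝ × (Fin r → Fin d → ℝ)) × (Fin r → ℝ) =>
        (tupleMinor e q.1.2).det) q := hmin.matrix_det.continuousAt
    refine (hdet.abs.inv₀ (abs_ne_zero.2 hq)).mul ((hF.comp hrep).continuousAt.mul
      (hρ.continuousAt.comp ((hdet.inv₀ hq).smul (Continuous.continuousAt ?_))))
    refine Continuous.matrix_vecMul ?_ hmin.matrix_adjugate
    fun_prop

theorem exists_bound_of_shearKernel_ne_zero (hi₀ : ∀ k, e k ≠ i₀) (hFc : HasCompactSupport F)
    (hρc : HasCompactSupport ρ) :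
    ∃ R : ℝ, 0 ≤ R ∧ ∀ p w, shearKernel e i₀ F ρ p w ≠ 0 →
      ‖w‖ ≤ R ∧ (|p.1| ≤ 1 → ‖p.2‖ ≤ R) := by
  obtain ⟨R₀, hR₀, hFb⟩ : ∃ R₀ : ℝ, 0 ≤ R₀ ∧ ∀ X, F X ≠ 0 → ‖X‖ ≤ R₀ := by
    obtain ⟨C, hC⟩ := hFc.isCompact.isBounded.exists_norm_le
    exact ⟨max C 0, le_max_right _ _, fun X hX => (hC X (subset_tsupport F hX)).trans
      (le_max_left _ _)⟩
  obtain ⟨R₁, hR₁, hρb⟩ : ∃ R₁ : ℝ, 0 ≤ R₁ ∧ ∀ s, ρ s ≠ 0 → ‖s‖ ≤ R₁ := by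
    obtain ⟨C, hC⟩ := hρc.isCompact.isBounded.exists_norm_le
    exact ⟨max C 0, le_max_right _ _, fun X hX => (hC X (subset_tsupport ρ hX)).trans
      (le_max_left _ _)⟩
  refine ⟨R₀ + r * (R₁ * R₀), by positivity, fun p w hpw => ?_⟩
  have hdet : (tupleMinor e p.2).det ≠ 0 := fun h => hpw (by simp [shearKernel, h])
  have hFX := hFb _ (left_ne_zero_of_mul (right_ne_zero_of_mul hpw))
  have hρs := hρb _ (right_ne_zero_of_mul (right_ne_zero_of_mul hpw))
  have hentry : ∀ j i, |replaceRow i₀ p.2 w j i| ≤ R₀ := fun j i =>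
    ((norm_le_pi_norm (replaceRow i₀ p.2 w j) i).trans
      (norm_le_pi_norm (replaceRow i₀ p.2 w) j)).trans hFX
  have hw : ∀ j, |w j| ≤ R₀ := fun j => by simpa [replaceRow] using hentry j i₀
  have hY : ∀ j i, i ≠ i₀ → |p.2 j i| ≤ R₀ := fun j i hi => by
    simpa [replaceRow, hi] using hentry j i
  have hle : R₀ ≤ R₀ + r * (R₁ * R₀) := by
    have : 0 ≤ r * (R₁ * R₀) := by positivity
    linarith
  refine ⟨(pi_norm_le_iff_of_nonneg (by positivity)).2 fun j => (hw j).trans hle, fun hε => ?_⟩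
  refine (pi_norm_le_iff_of_nonneg (by positivity)).2 fun j =>
    (pi_norm_le_iff_of_nonneg (by positivity)).2 fun i => ?_
  by_cases hi : i = i₀
  swap
  · exact (hY j i hi).trans hle
  subst hi
  set s := (tupleMinor e p.2).det⁻¹ •
      Matrix.vecMul (p.1 • w - fun j => p.2 j i) (tupleMinor e p.2).adjugate with hs
  have hsA : Matrix.vecMul s (tupleMinor e p.2) = p.1 • w - fun j => p.2 j i := by
    rw [hs, Matrix.smul_vecMul, Matrix.vecMul_vecMul, Matrix.adjugate_mul, Matrix.vecMul_smul,
      Matrix.vecMul_one, smul_smul, inv_mul_cancel₀ hdet, one_smul]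
  have hj : p.2 j i = p.1 * w j - ∑ k, s k * p.2 j (e k) := by
    have := congrFun hsA j
    simp only [Matrix.vecMul, dotProduct, tupleMinor, Matrix.of_apply, Pi.sub_apply,
      Pi.smul_apply, smul_eq_mul] at this
    linarith
  rw [Real.norm_eq_abs, hj]
  refine (abs_sub _ _).trans (add_le_add ?_ ?_)
  · rw [abs_mul]
    exact (mul_le_mul hε (hw j) (abs_nonneg _) zero_le_one).trans (one_mul _).le
  · refine (Finset.abs_sum_le_sum_abs _ _).trans
      ((Finset.sum_le_card_nsmul _ _ (R₁ * R₀) fun k _ => ?_).trans (by simp))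
    rw [abs_mul]
    exact mul_le_mul ((norm_le_pi_norm s k).trans hρs) (hY j _ (hi₀ k)) (abs_nonneg _) hR₁

theorem shearAverage_eq_zero {p : ℝ × (Fin r → Fin d → ℝ)}
    (hp : (tupleMinor e p.2).det = 0) : shearAverage e i₀ F ρ p = 0 := by
  simp [shearAverage, shearKernel, hp]

theorem continuous_shearAverage (hi₀ : ∀ k, e k ≠ i₀) (hF : Continuous F)
    (hFc : HasCompactSupport F) (hFs : tsupport F ⊆ {X | (tupleMinor e X).det ≠ 0})
    (hρ : Continuous ρ) (hρc : HasCompactSupport ρ) :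
    Continuous (shearAverage e i₀ F ρ) := by
  obtain ⟨R, -, hR⟩ := exists_bound_of_shearKernel_ne_zero hi₀ hFc hρc
  rw [← continuousOn_univ]
  refine continuousOn_integral_of_compact_support (isCompact_closedBall (0 : Fin r → ℝ) R)
    (continuous_shearKernel hi₀ hF hFs hρ).continuousOn fun p w _ hw => ?_
  by_contra hne
  exact hw (by simpa using (hR p w hne).1)

theorem exists_bound_shearAverage (hi₀ : ∀ k, e k ≠ i₀) (hF : Continuous F)
    (hFc : HasCompactSupport F) (hFs : tsupport F ⊆ {X | (tupleMinor e X).det ≠ 0})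
    (hρ : Continuous ρ) (hρc : HasCompactSupport ρ) :
    ∃ R C : ℝ, ∀ ε ∈ Icc (0 : ℝ) 1, ∀ Y, shearAverage e i₀ F ρ (ε, Y) ≤ C ∧
      (R < ‖Y‖ → shearAverage e i₀ F ρ (ε, Y) = 0) := by
  obtain ⟨R, hR0, hR⟩ := exists_bound_of_shearKernel_ne_zero hi₀ hFc hρc
  have hcont := continuous_shearAverage hi₀ hF hFc hFs hρ hρc
  obtain ⟨C, hC⟩ := (((isCompact_Icc (a := (0 : ℝ)) (b := 1)).prod
    (isCompact_closedBall (0 : Fin r → Fin d → ℝ) R)).bddAbove_image hcont.continuousOn)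
  have hzero : ∀ ε ∈ Icc (0 : ℝ) 1, ∀ Y, R < ‖Y‖ → shearAverage e i₀ F ρ (ε, Y) = 0 := by
    intro ε hε Y hY
    have : ∀ w, shearKernel e i₀ F ρ (ε, Y) w = 0 := by
      intro w
      by_contra hne
      exact hY.not_ge ((hR _ w hne).2 (by rw [abs_of_nonneg hε.1]; exact hε.2))
    simp [shearAverage, this]
  refine ⟨R, max C 0, fun ε hε Y => ⟨?_, hzero ε hε Y⟩⟩
  rcases lt_or_ge R ‖Y‖ with hY | hY
  · exact (hzero ε hε Y hY).le.trans (le_max_right _ _)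
  · exact (hC ⟨(ε, Y), ⟨hε, by simpa using hY⟩, rfl⟩).trans (le_max_left _ _)

theorem lintegral_contractShear (hi₀ : ∀ k, e k ≠ i₀) (hF : Continuous F)
    (hFc : HasCompactSupport F) (hFs : tsupport F ⊆ {X | (tupleMinor e X).det ≠ 0})
    (hF0 : ∀ X, 0 ≤ F X) (hρ : Continuous ρ) (hρc : HasCompactSupport ρ) (hρ0 : ∀ s, 0 ≤ ρ s)
    {N : ℝ} (hN : 0 < N) (Y : Fin r → Fin d → ℝ) :
    ∫⁻ s, ENNReal.ofReal (ρ s * F (tupleAct (contractShear e i₀ hi₀ hN.ne' s).val (N • Y))) =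
      ENNReal.ofReal ((N ^ (d * r))⁻¹ * shearAverage e i₀ F ρ ((N ^ d)⁻¹, Y)) := by
  simp_rw [tupleAct_contractShear_smul]
  by_cases hdet : (tupleMinor e Y).det = 0
  · have hzero : ∀ w, F (replaceRow i₀ Y w) = 0 := fun w =>
      image_eq_zero_of_notMem_tsupport fun h => hFs h (by rw [tupleMinor_replaceRow hi₀, hdet])
    simp [hzero, shearAverage_eq_zero (p := ((N ^ d)⁻¹, Y)) hdet]
  set A := tupleMinor e Y with hA
  set z : Fin r → ℝ := fun j => Y j i₀ with hz
  set c := N ^ d with hc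
  have hc0 : 0 < c := pow_pos hN d
  set Q : (Fin r → ℝ) → ℝ := fun w => F (replaceRow i₀ Y w) *
    ρ (A.det⁻¹ • Matrix.vecMul (c⁻¹ • w - z) A.adjugate) with hQ
  have hrep : Continuous fun w => replaceRow i₀ Y w :=
    (continuous_replaceRow i₀).comp (continuous_const.prodMk continuous_id)
  have hQc : Continuous Q := by
    have hv0 : Continuous fun w : Fin r → ℝ => c⁻¹ • w - z := by fun_prop
    have hv : Continuous fun w : Fin r → ℝ =>
        A.det⁻¹ • Matrix.vecMul (c⁻¹ • w - z) A.adjugate :=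
      (hv0.matrix_vecMul (continuous_const (y := A.adjugate))).const_smul A.det⁻¹
    exact (hF.comp hrep).mul (hρ.comp hv)
  have h1 : ∀ s, ρ s * F (replaceRow i₀ Y (c • (z + Matrix.vecMul s A))) =
      Q (c • (z + Matrix.vecMul s A)) := by
    intro s
    have : A.det⁻¹ • Matrix.vecMul (c⁻¹ • (c • (z + Matrix.vecMul s A)) - z) A.adjugate = s := by
      rw [smul_smul, inv_mul_cancel₀ hc0.ne', one_smul, add_sub_cancel_left,
        Matrix.vecMul_vecMul, Matrix.mul_adjugate, Matrix.vecMul_smul, Matrix.vecMul_one,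
        smul_smul, inv_mul_cancel₀ hdet, one_smul]
    rw [hQ]
    simp only [this]
    ring
  simp_rw [h1]
  rw [lintegral_smul_add_vecMul hdet hc0 z (Q := fun w => ENNReal.ofReal (Q w))
    hQc.measurable.ennreal_ofReal]
  obtain ⟨R, -, hR⟩ := exists_bound_of_shearKernel_ne_zero hi₀ hFc hρc
  have hQs : HasCompactSupport Q := by
    refine HasCompactSupport.intro (isCompact_closedBall (0 : Fin r → ℝ) R) fun w hw => ?_
    by_contra hne
    have hne' : shearKernel e i₀ F ρ (c⁻¹, Y) w ≠ 0 :=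
      mul_ne_zero (inv_ne_zero (abs_ne_zero.2 hdet)) hne
    exact hw (by simpa using (hR (c⁻¹, Y) w hne').1)
  rw [← ofReal_integral_eq_lintegral_ofReal (hQc.integrable_of_hasCompactSupport hQs)
    (ae_of_all _ fun w => mul_nonneg (hF0 _) (hρ0 _)),
    ← ENNReal.ofReal_mul (by positivity), pow_mul, mul_assoc]
  congr 2
  exact (integral_const_mul _ _).symm

end Average

theorem lintegral_comp_floor_mul {d r : ℕ} {N : ℝ} (hN : 0 < N)
    (H : (Fin r → Fin d → ℤ) → ℝ≥0∞) :
    ∫⁻ x : Fin r → Fin d → ℝ, H (fun j i => ⌊N * x j i⌋) =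
      ∑' m, ENNReal.ofReal (N ^ (d * r))⁻¹ * H m := by
  set φ : (Fin r → Fin d → ℝ) → (Fin r → Fin d → ℤ) := fun x j i => ⌊N * x j i⌋ with hφ
  have hφm : Measurable φ := by
    refine measurable_pi_lambda _ fun j => measurable_pi_lambda _ fun i => ?_
    exact Int.measurable_floor.comp (by fun_prop)
  have hvol : ∀ m, volume (φ ⁻¹' {m}) = ENNReal.ofReal (N ^ (d * r))⁻¹ := by
    intro m
    have hset : φ ⁻¹' {m} = Set.pi univ fun j => Set.pi univ fun i =>
        Ico ((m j i : ℝ) / N) (((m j i : ℝ) + 1) / N) := by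
      ext x
      simp only [mem_preimage, mem_singleton_iff, hφ, funext_iff, Int.floor_eq_iff, Set.mem_pi,
        mem_univ, true_implies, mem_Ico, div_le_iff₀ hN, lt_div_iff₀ hN, mul_comm N]
    rw [hset, volume_pi_pi]
    have : ∀ j, volume (Set.pi univ fun i => Ico ((m j i : ℝ) / N) (((m j i : ℝ) + 1) / N)) =
        ENNReal.ofReal N⁻¹ ^ d := by
      intro j
      rw [volume_pi_pi]
      simp [← sub_div]
    simp only [this, Finset.prod_const, Finset.card_univ, Fintype.card_fin]
    rw [← pow_mul, ← ENNReal.ofReal_pow (by positivity), inv_pow]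
  have h1 := lintegral_map (μ := volume) (f := H) (measurable_of_countable H) hφm
  rw [← h1, lintegral_countable']
  refine tsum_congr fun m => ?_
  rw [Measure.map_apply hφm (measurableSet_singleton m), hvol, mul_comm]

theorem linearIndependent_of_det_tupleMinor_ne_zero {d r : ℕ} (e : Fin r → Fin d)
    {X : Fin r → Fin d → ℝ}
    (h : (tupleMinor e X).det ≠ 0) : LinearIndependent ℝ X := by
  have hX : LinearIndependent ℝ fun j => LinearMap.funLeft ℝ ℝ e (X j) := by
    have := Matrix.linearIndependent_cols_of_det_ne_zero h
    exact this
  exact LinearIndependent.of_comp _ hX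

theorem lintegral_mul_tsum {S ι : Type*} [MeasurableSpace S] {μ : Measure S} [Countable ι]
    {a : S → ℝ≥0∞} (ha : Measurable a) {f : ι → S → ℝ≥0∞} (hf : ∀ i, Measurable (f i)) :
    ∫⁻ s, a s * ∑' i, f i s ∂μ = ∑' i, ∫⁻ s, a s * f i s ∂μ := by
  simp_rw [← ENNReal.tsum_mul_left]
  exact lintegral_tsum fun i => (ha.mul (hf i)).aemeasurable

section Average

variable {d r : ℕ} {e : Fin r → Fin d} {i₀ : Fin d} {F : (Fin r → Fin d → ℝ) → ℝ}
  {ρ : (Fin r → ℝ) → ℝ}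

theorem lintegral_siegelSum_contractShear (hi₀ : ∀ k, e k ≠ i₀) (hF : Continuous F)
    (hFc : HasCompactSupport F) (hFs : tsupport F ⊆ {X | (tupleMinor e X).det ≠ 0})
    (hF0 : ∀ X, 0 ≤ F X) (hρ : Continuous ρ) (hρc : HasCompactSupport ρ) (hρ0 : ∀ s, 0 ≤ ρ s)
    {N : ℝ} (hN : 0 < N) (M : Matrix.SpecialLinearGroup (Fin d) ℝ) :
    ∫⁻ s, siegelSum (fun X => ENNReal.ofReal (F X)) (contractShear e i₀ hi₀ hN.ne' s * M)
        ∂(volume.withDensity fun s => ENNReal.ofReal (ρ s)) =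
      ∫⁻ x : Fin r → Fin d → ℝ, ENNReal.ofReal (shearAverage e i₀ F ρ ((N ^ d)⁻¹,
        tupleAct M.val (N⁻¹ • realTuple fun j i => ⌊N * x j i⌋))) := by
  have := borelSpace_specialLinearGroup d
  have hFm : Measurable fun X => ENNReal.ofReal (F X) := hF.measurable.ennreal_ofReal
  have hgc : Continuous fun s => contractShear e i₀ hi₀ hN.ne' s * M :=
    Continuous.subtype_mk (((continuous_val d).comp
      (continuous_contractShear e i₀ hi₀ hN.ne')).matrix_mul
        (continuous_const (y := M.val))) _
  have hterm : ∀ m : Fin r → Fin d → ℤ, Measurable fun s =>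
      ENNReal.ofReal (F (tupleAct (contractShear e i₀ hi₀ hN.ne' s * M).val (realTuple m))) :=
    fun m => hFm.comp (continuous_tupleAct.comp
      (((continuous_val d).comp hgc).prodMk continuous_const)).measurable
  have hsum : Measurable fun s =>
      siegelSum (fun X => ENNReal.ofReal (F X)) (contractShear e i₀ hi₀ hN.ne' s * M) :=
    (measurable_siegelSum hFm).comp hgc.measurable
  rw [lintegral_withDensity_eq_lintegral_mul _ hρ.measurable.ennreal_ofReal hsum,
    lintegral_comp_floor_mul hN fun m => ENNReal.ofReal (shearAverage e i₀ F ρ ((N ^ d)⁻¹,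
        tupleAct M.val (N⁻¹ • realTuple m)))]
  have hval : ∀ m : Fin r → Fin d → ℤ, ∫⁻ s, ENNReal.ofReal (ρ s) *
      ENNReal.ofReal (F (tupleAct (contractShear e i₀ hi₀ hN.ne' s * M).val (realTuple m))) =
      ENNReal.ofReal (N ^ (d * r))⁻¹ * ENNReal.ofReal (shearAverage e i₀ F ρ ((N ^ d)⁻¹,
        tupleAct M.val (N⁻¹ • realTuple m))) := by
    intro m
    rw [← ENNReal.ofReal_mul (by positivity),
      ← lintegral_contractShear hi₀ hF hFc hFs hF0 hρ hρc hρ0 hN]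
    refine lintegral_congr fun s => ?_
    rw [← ENNReal.ofReal_mul (hρ0 s), ← tupleAct_smul, smul_inv_smul₀ hN.ne',
      Matrix.SpecialLinearGroup.coe_mul, tupleAct_mul]
  have hswap := lintegral_mul_tsum (μ := volume) hρ.measurable.ennreal_ofReal
    fun m : IndepTuple d r => hterm m.val
  refine hswap.trans ?_
  rw [tsum_congr fun m : IndepTuple d r => hval m.val]
  refine tsum_subtype_eq_of_support_subset (f := fun m => ENNReal.ofReal (N ^ (d * r))⁻¹ *
    ENNReal.ofReal (shearAverage e i₀ F ρ ((N ^ d)⁻¹, tupleAct M.val (N⁻¹ • realTuple m))))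
    (s := {m | LinearIndependent ℝ fun j : Fin r => fun i : Fin d => ((m j i : ℝ))})
    fun m hm => ?_
  have hdet : (tupleMinor e (tupleAct M.val (N⁻¹ • realTuple m))).det ≠ 0 := by
    intro h
    have hzero := shearAverage_eq_zero (i₀ := i₀) (F := F) (ρ := ρ)
      (p := ((N ^ d)⁻¹, tupleAct M.val (N⁻¹ • realTuple m))) h
    exact hm (by simp only [hzero, ENNReal.ofReal_zero, mul_zero])
  have hind := (linearIndependent_tupleAct_iff M).1
    (linearIndependent_of_det_tupleMinor_ne_zero e hdet)
  have hN' : IsUnit N⁻¹ := (inv_ne_zero hN.ne').isUnit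
  exact (LinearIndependent.units_smul_iff (realTuple m) fun _ => hN'.unit).1 hind

end Average

theorem norm_sub_inv_smul_floor_le {d r : ℕ} {N : ℝ} (hN : 0 < N) (x : Fin r → Fin d → ℝ) :
    ‖x - N⁻¹ • realTuple fun j i => ⌊N * x j i⌋‖ ≤ N⁻¹ := by
  have hN' : 0 ≤ N⁻¹ := (inv_pos.2 hN).le
  refine (pi_norm_le_iff_of_nonneg hN').2 fun j => (pi_norm_le_iff_of_nonneg hN').2 fun i => ?_
  have h : x j i - N⁻¹ * (⌊N * x j i⌋ : ℝ) = N⁻¹ * Int.fract (N * x j i) := by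
    rw [Int.fract]
    field_simp
  simp only [Pi.sub_apply, Pi.smul_apply, smul_eq_mul, realTuple, h]
  rw [Real.norm_of_nonneg (mul_nonneg hN' (Int.fract_nonneg _))]
  exact mul_le_of_le_one_right hN' (Int.fract_lt_one _).le

section Average

variable {d r : ℕ} {e : Fin r → Fin d} {i₀ : Fin d} {F : (Fin r → Fin d → ℝ) → ℝ}
  {ρ : (Fin r → ℝ) → ℝ}

theorem tendsto_lintegral_shearAverage (hi₀ : ∀ k, e k ≠ i₀) (hF : Continuous F)
    (hFc : HasCompactSupport F) (hFs : tsupport F ⊆ {X | (tupleMinor e X).det ≠ 0})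
    (hρ : Continuous ρ) (hρc : HasCompactSupport ρ)
    {ε : ℕ → ℝ} (hε : ∀ n, ε n ∈ Icc (0 : ℝ) 1) (hε0 : Tendsto ε atTop (𝓝 0))
    {Φ : ℕ → (Fin r → Fin d → ℝ) → Fin r → Fin d → ℝ} {φ : (Fin r → Fin d → ℝ) → Fin r → Fin d → ℝ}
    (hΦ : ∀ n, Measurable (Φ n)) (hlim : ∀ x, Tendsto (fun n => Φ n x) atTop (𝓝 (φ x)))
    (hΦR : ∀ R, ∃ R', ∀ n x, R' < ‖x‖ → R < ‖Φ n x‖) :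
    Tendsto (fun n => ∫⁻ x, ENNReal.ofReal (shearAverage e i₀ F ρ (ε n, Φ n x))) atTop
      (𝓝 (∫⁻ x, ENNReal.ofReal (shearAverage e i₀ F ρ (0, φ x)))) := by
  have hcont := continuous_shearAverage hi₀ hF hFc hFs hρ hρc
  obtain ⟨R, C, hRC⟩ := exists_bound_shearAverage hi₀ hF hFc hFs hρ hρc
  obtain ⟨R', hR'⟩ := hΦR R
  refine tendsto_lintegral_of_dominated_convergence
    ((Metric.closedBall 0 R').indicator fun _ => ENNReal.ofReal C) (fun n => ?_) (fun n => ?_) ?_ ?_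
  · exact (hcont.measurable.comp (measurable_const.prodMk (hΦ n))).ennreal_ofReal
  · refine ae_of_all _ fun x => ?_
    by_cases hx : x ∈ Metric.closedBall (0 : Fin r → Fin d → ℝ) R'
    · rw [indicator_of_mem hx]
      exact ENNReal.ofReal_le_ofReal (hRC _ (hε n) _).1
    · beta_reduce
      rw [indicator_of_notMem hx, (hRC _ (hε n) _).2 (hR' n x (by simpa using hx))]
      simp
  · rw [lintegral_indicator_const Metric.isClosed_closedBall.measurableSet]
    exact ENNReal.mul_ne_top ENNReal.ofReal_ne_top
      (isCompact_closedBall _ _).measure_lt_top.ne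
  · refine ae_of_all _ fun x => ENNReal.tendsto_ofReal ?_
    exact (hcont.tendsto (0, φ x)).comp (hε0.prodMk_nhds (hlim x))

theorem inv_pow_natCast_add_one_mem_Icc (n : ℕ) : (((n : ℝ) + 1) ^ d)⁻¹ ∈ Icc (0 : ℝ) 1 :=
  ⟨by positivity, inv_le_one_of_one_le₀ (one_le_pow₀ (by simp))⟩

theorem tendsto_inv_pow_natCast_add_one (hd : d ≠ 0) :
    Tendsto (fun n : ℕ => (((n : ℝ) + 1) ^ d)⁻¹) atTop (𝓝 0) :=
  tendsto_inv_atTop_zero.comp ((tendsto_pow_atTop hd).comp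
    (tendsto_atTop_add_const_right _ _ tendsto_natCast_atTop_atTop))

theorem lintegral_smul_tuple (G : (Fin r → Fin d → ℝ) → ℝ≥0∞) {N : ℝ} (hN : 0 < N) :
    ∫⁻ X, G X = ENNReal.ofReal (N ^ (d * r)) * ∫⁻ Y, G (N • Y) := by
  have h1 := Measure.map_addHaar_smul (volume : Measure (Fin r → Fin d → ℝ)) hN.ne'
  have h2 : ∫⁻ Y, G (N • Y) = ∫⁻ X, G X ∂(Measure.map (N • ·) volume) :=
    ((Homeomorph.smulOfNeZero N hN.ne').toMeasurableEquiv.measurableEmbedding.lintegral_map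
      G).symm
  have hfin : Module.finrank ℝ (Fin r → Fin d → ℝ) = d * r := by
    simp [Module.finrank_pi_fintype, mul_comm]
  rw [h2, h1, lintegral_smul_measure, hfin, abs_of_pos (by positivity), smul_eq_mul,
    ← mul_assoc, ← ENNReal.ofReal_mul (by positivity), mul_inv_cancel₀ (by positivity)]
  simp

theorem lintegral_shearAverage (hi₀ : ∀ k, e k ≠ i₀) (hF : Continuous F)
    (hFc : HasCompactSupport F) (hFs : tsupport F ⊆ {X | (tupleMinor e X).det ≠ 0})
    (hF0 : ∀ X, 0 ≤ F X) (hρ : Continuous ρ) (hρc : HasCompactSupport ρ) (hρ0 : ∀ s, 0 ≤ ρ s)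
    (hρ1 : ∫⁻ s, ENNReal.ofReal (ρ s) = 1) {N : ℝ} (hN : 0 < N) :
    ∫⁻ Y, ENNReal.ofReal (shearAverage e i₀ F ρ ((N ^ d)⁻¹, Y)) =
      ∫⁻ X, ENNReal.ofReal (F X) := by
  have hjoint : Continuous fun p : (Fin r → Fin d → ℝ) × (Fin r → ℝ) =>
      ρ p.2 * F (tupleAct (contractShear e i₀ hi₀ hN.ne' p.2).val (N • p.1)) :=
    (hρ.comp continuous_snd).mul (hF.comp (continuous_tupleAct.comp
      ((((continuous_val d).comp (continuous_contractShear e i₀ hi₀ hN.ne')).comp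
        continuous_snd).prodMk (continuous_fst.const_smul N))))
  have hstep : ∀ s, ∫⁻ Y, ENNReal.ofReal (ρ s *
      F (tupleAct (contractShear e i₀ hi₀ hN.ne' s).val (N • Y))) =
      ENNReal.ofReal (ρ s) * (ENNReal.ofReal (N ^ (d * r))⁻¹ * ∫⁻ X, ENNReal.ofReal (F X)) := by
    intro s
    simp_rw [ENNReal.ofReal_mul (hρ0 s)]
    rw [lintegral_const_mul' _ _ ENNReal.ofReal_ne_top]
    congr 1
    have h2 := (measurePreserving_tupleAct (r := r)
      (contractShear e i₀ hi₀ hN.ne' s)).lintegral_comp hF.measurable.ennreal_ofReal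
    rw [← h2, lintegral_smul_tuple (fun X => ENNReal.ofReal (F (tupleAct _ X))) hN, ← mul_assoc,
      ← ENNReal.ofReal_mul (by positivity), inv_mul_cancel₀ (by positivity)]
    simp
  have hswap := lintegral_lintegral_swap (μ := volume) (ν := volume)
    (f := fun (Y : Fin r → Fin d → ℝ) (s : Fin r → ℝ) => ENNReal.ofReal (ρ s *
      F (tupleAct (contractShear e i₀ hi₀ hN.ne' s).val (N • Y))))
    hjoint.measurable.ennreal_ofReal.aemeasurable
  simp_rw [hstep, lintegral_contractShear hi₀ hF hFc hFs hF0 hρ hρc hρ0 hN] at hswap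
  rw [lintegral_mul_const _ hρ.measurable.ennreal_ofReal, hρ1, one_mul] at hswap
  have hpos : (0 : ℝ) ≤ (N ^ (d * r))⁻¹ := by positivity
  simp_rw [ENNReal.ofReal_mul hpos] at hswap
  rw [lintegral_const_mul' _ _ ENNReal.ofReal_ne_top] at hswap
  exact (ENNReal.mul_right_inj (by simpa using by positivity) ENNReal.ofReal_ne_top).1 hswap

theorem tendsto_lintegral_siegelSum_contractShear (hi₀ : ∀ k, e k ≠ i₀) (hF : Continuous F)
    (hFc : HasCompactSupport F) (hFs : tsupport F ⊆ {X | (tupleMinor e X).det ≠ 0})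
    (hF0 : ∀ X, 0 ≤ F X) (hρ : Continuous ρ) (hρc : HasCompactSupport ρ) (hρ0 : ∀ s, 0 ≤ ρ s)
    (hρ1 : ∫⁻ s, ENNReal.ofReal (ρ s) = 1) (M : Matrix.SpecialLinearGroup (Fin d) ℝ) :
    Tendsto (fun n : ℕ => ∫⁻ s, siegelSum (fun X => ENNReal.ofReal (F X))
        (contractShear e i₀ hi₀ (n.cast_add_one_pos (α := ℝ)).ne' s * M)
        ∂(volume.withDensity fun s => ENNReal.ofReal (ρ s)))
      atTop (𝓝 (∫⁻ X, ENNReal.ofReal (F X))) := by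
  have hd : d ≠ 0 := fun h => by subst h; exact i₀.elim0
  have hMc : Continuous (tupleAct (r := r) M.val) :=
    continuous_tupleAct.comp (continuous_const.prodMk continuous_id)
  simp_rw [fun n : ℕ => lintegral_siegelSum_contractShear hi₀ hF hFc hFs hF0 hρ hρc hρ0
    (n.cast_add_one_pos (α := ℝ)) M]
  have hlimit : ∫⁻ X, ENNReal.ofReal (F X) =
      ∫⁻ X, ENNReal.ofReal (shearAverage e i₀ F ρ (0, tupleAct M.val X)) := by
    have h1 := tendsto_lintegral_shearAverage hi₀ hF hFc hFs hρ hρc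
      inv_pow_natCast_add_one_mem_Icc (tendsto_inv_pow_natCast_add_one hd)
      (Φ := fun _ x => x) (φ := fun x => x) (fun _ => measurable_id)
      (fun _ => tendsto_const_nhds) fun R => ⟨R, fun _ _ h => h⟩
    simp_rw [fun n : ℕ => lintegral_shearAverage hi₀ hF hFc hFs hF0 hρ hρc hρ0 hρ1
      (n.cast_add_one_pos (α := ℝ))] at h1
    rw [(measurePreserving_tupleAct M).lintegral_comp
      (f := fun X => ENNReal.ofReal (shearAverage e i₀ F ρ (0, X)))]
    · exact tendsto_nhds_unique tendsto_const_nhds h1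
    · exact ((continuous_shearAverage hi₀ hF hFc hFs hρ hρc).comp
        (continuous_const.prodMk continuous_id)).measurable.ennreal_ofReal
  rw [hlimit]
  refine tendsto_lintegral_shearAverage hi₀ hF hFc hFs hρ hρc inv_pow_natCast_add_one_mem_Icc
    (tendsto_inv_pow_natCast_add_one hd) (Φ := fun (n : ℕ) x => tupleAct M.val
      (((n : ℝ) + 1)⁻¹ • realTuple fun j i => ⌊((n : ℝ) + 1) * x j i⌋))
    (φ := tupleAct M.val) (fun n => hMc.measurable.comp ?_) (fun x => ?_) fun R => ?_
  · have hfloor : Measurable fun x : Fin r → Fin d → ℝ =>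
        realTuple fun j i => ⌊((n : ℝ) + 1) * x j i⌋ := by
      refine measurable_pi_lambda _ fun j => measurable_pi_lambda _ fun i => ?_
      exact (measurable_of_countable fun k : ℤ => (k : ℝ)).comp
        (Int.measurable_floor.comp (by fun_prop))
    exact hfloor.const_smul ((n : ℝ) + 1)⁻¹
  · refine (hMc.tendsto x).comp (tendsto_iff_norm_sub_tendsto_zero.2 ?_)
    refine squeeze_zero (fun _ => norm_nonneg _) (fun n => ?_)
      (by simpa using tendsto_inv_pow_natCast_add_one (d := 1) one_ne_zero)
    rw [norm_sub_rev]
    exact norm_sub_inv_smul_floor_le n.cast_add_one_pos x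
  · have hMi : Continuous (tupleAct (r := r) (M⁻¹).val) :=
      continuous_tupleAct.comp (continuous_const.prodMk continuous_id)
    obtain ⟨B, hB⟩ := ((isCompact_closedBall (0 : Fin r → Fin d → ℝ) R).image hMi).isBounded
      |>.exists_norm_le
    refine ⟨B + 1, fun n x hx => ?_⟩
    by_contra! hle
    set y := ((n : ℝ) + 1)⁻¹ • realTuple fun j i => ⌊((n : ℝ) + 1) * x j i⌋ with hy
    have h1 : ‖y‖ ≤ B := hB y ⟨tupleAct M.val y, by simpa using hle, tupleAct_inv_tupleAct M y⟩
    have h2 : ‖x - y‖ ≤ 1 := (norm_sub_inv_smul_floor_le n.cast_add_one_pos x).trans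
      (inv_le_one_of_one_le₀ (by simp))
    linarith [norm_le_norm_add_norm_sub y x, norm_sub_rev x y]

end Average

theorem continuous_siegelSum {d r : ℕ} {F : (Fin r → Fin d → ℝ) → ℝ} (hF : Continuous F)
    (hFc : HasCompactSupport F) :
    Continuous (siegelSum fun X => ENNReal.ofReal (F X)) := by
  set u : IndepTuple d r → Matrix.SpecialLinearGroup (Fin d) ℝ → ℝ≥0∞ :=
    fun m M => ENNReal.ofReal (F (tupleAct M.val (realTuple m.val))) with hu
  have hfin : LocallyFinite fun m => Function.support (u m) := by
    intro M₀
    have hact : Continuous fun p : Matrix.SpecialLinearGroup (Fin d) ℝ × (Fin r → Fin d → ℝ) =>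
        ‖tupleAct p.1.val.adjugate p.2‖ :=
      (continuous_tupleAct.comp ((((continuous_val d).comp continuous_fst).matrix_adjugate).prodMk
        continuous_snd)).norm
    obtain ⟨B, hB⟩ := (hFc.isCompact.image (hact.comp (continuous_const (y := M₀)
      |>.prodMk continuous_id))).bddAbove
    have hev : ∀ᶠ M in 𝓝 M₀, ∀ X ∈ tsupport F, ‖tupleAct M.val.adjugate X‖ < B + 1 := by
      refine hFc.isCompact.eventually_forall_of_forall_eventually fun X hX => ?_
      exact hact.continuousAt.eventually_lt continuousAt_const
        ((hB ⟨X, hX, rfl⟩).trans_lt (lt_add_one B))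
    refine ⟨_, hev, ?_⟩
    have hbox : (Icc (fun _ _ => -⌈B + 1⌉ : Fin r → Fin d → ℤ) fun _ _ => ⌈B + 1⌉).Finite :=
      finite_Icc _ _
    refine (hbox.preimage Subtype.val_injective.injOn).subset ?_
    rintro m ⟨M, hM, hMV⟩
    have hsupp : F (tupleAct M.val (realTuple m.val)) ≠ 0 := by
      intro h
      exact hM (by simp [hu, h])
    have hlt := hMV _ (subset_tsupport F hsupp)
    rw [← tupleAct_mul, Matrix.adjugate_mul, M.det_coe, one_smul, tupleAct_one] at hlt
    have hcoord : ∀ j i, |m.val j i| ≤ ⌈B + 1⌉ := by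
      intro j i
      have h1 : ‖realTuple m.val j i‖ ≤ B + 1 :=
        ((norm_le_pi_norm _ i).trans (norm_le_pi_norm _ j)).trans hlt.le
      rw [Real.norm_eq_abs, realTuple, ← Int.cast_abs] at h1
      exact_mod_cast h1.trans (Int.le_ceil _)
    exact ⟨fun j i => (abs_le.1 (hcoord j i)).1, fun j i => (abs_le.1 (hcoord j i)).2⟩
  have hcont : ∀ m, Continuous (u m) := fun m => ENNReal.continuous_ofReal.comp
    (hF.comp (continuous_tupleAct.comp ((continuous_val d).prodMk continuous_const)))
  refine (continuous_finsum hcont hfin).congr fun M => ?_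
  exact (tsum_eq_finsum (hfin.point_finite M)).symm

theorem lintegral_siegelSum_eq {d r : ℕ} {e : Fin r → Fin d} {i₀ : Fin d}
    {F : (Fin r → Fin d → ℝ) → ℝ} (hi₀ : ∀ k, e k ≠ i₀) (hF : Continuous F)
    (hFc : HasCompactSupport F) (hFs : tsupport F ⊆ {X | (tupleMinor e X).det ≠ 0})
    (hF0 : ∀ X, 0 ≤ F X)
    (μ : Measure (Matrix.SpecialLinearGroup (Fin d) ℝ ⧸ SLZ d)) [IsProbabilityMeasure μ]
    (hinv : ∀ g : Matrix.SpecialLinearGroup (Fin d) ℝ, Measure.map (fun x => g • x) μ = μ) :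
    ∫⁻ q, siegelSum (fun X => ENNReal.ofReal (F X)) q.out ∂μ = ∫⁻ X, ENNReal.ofReal (F X) := by
  have hFm : Measurable fun X => ENNReal.ofReal (F X) := hF.measurable.ennreal_ofReal
  let b : ContDiffBump (0 : Fin r → ℝ) := ⟨1, 2, one_pos, one_lt_two⟩
  set ρ := b.normed volume with hρdef
  have hρ : Continuous ρ := b.continuous_normed
  have hρc : HasCompactSupport ρ := b.hasCompactSupport_normed
  have hρ0 : ∀ s, 0 ≤ ρ s := b.nonneg_normed
  have hρ1 : ∫⁻ s, ENNReal.ofReal (ρ s) = 1 := by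
    rw [← ofReal_integral_eq_lintegral_ofReal b.integrable_normed (ae_of_all _ hρ0),
      b.integral_normed, ENNReal.ofReal_one]
  have hprob : IsProbabilityMeasure (volume.withDensity fun s => ENNReal.ofReal (ρ s)) :=
    ⟨by rw [withDensity_apply _ MeasurableSet.univ, Measure.restrict_univ, hρ1]⟩
  set g : ℕ → (Fin r → ℝ) → Matrix.SpecialLinearGroup (Fin d) ℝ :=
    fun n => contractShear e i₀ hi₀ (n.cast_add_one_pos (α := ℝ)).ne' with hg
  have hout : ∀ (γ : Matrix.SpecialLinearGroup (Fin d) ℝ)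
      (q : Matrix.SpecialLinearGroup (Fin d) ℝ ⧸ SLZ d),
      siegelSum (fun X => ENNReal.ofReal (F X)) (γ • q).out =
        siegelSum (fun X => ENNReal.ofReal (F X)) (γ * q.out) := by
    intro γ q
    rw [← siegelSum_out _ (γ * q.out)]
    conv_lhs => rw [← QuotientGroup.out_eq' q]
    rfl
  refine lintegral_eq_of_tendsto_average μ (volume.withDensity fun s => ENNReal.ofReal (ρ s))
    (fun n s q => g n s • q) (fun n s => ⟨measurable_smul_quotient _, hinv _⟩)
    (measurable_siegelSum_out hFm) (fun n => ?_) _ fun q => ?_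
  · refine measurable_uncurry_of_continuous_of_measurable
      (u := fun s (q : Matrix.SpecialLinearGroup (Fin d) ℝ ⧸ SLZ d) =>
        siegelSum (fun X => ENNReal.ofReal (F X)) (g n s • q).out) (fun q => ?_) fun s => ?_
    · simp_rw [hout]
      refine (continuous_siegelSum hF hFc).comp (Continuous.subtype_mk ?_ _)
      exact ((continuous_val d).comp (continuous_contractShear e i₀ hi₀ _)).matrix_mul
        (continuous_const (y := q.out.val))
    · exact (measurable_siegelSum_out hFm).comp (measurable_smul_quotient _)
  · simp_rw [hout]
    exact tendsto_lintegral_siegelSum_contractShear hi₀ hF hFc hFs hF0 hρ hρc hρ0 hρ1 q.out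

theorem exists_det_tupleMinor_ne_zero {d r : ℕ} {X : Fin r → Fin d → ℝ}
    (hX : LinearIndependent ℝ X) : ∃ e : Fin r → Fin d, (tupleMinor e X).det ≠ 0 := by
  have hrank : (Matrix.of X).rank = r := by
    simpa using LinearIndependent.rank_matrix (M := Matrix.of X) hX
  rw [Matrix.rank_eq_finrank_span_cols] at hrank
  obtain ⟨f, hf, -, hfi⟩ := Submodule.exists_fun_fin_finrank_span_eq ℝ (range (Matrix.of X).col)
  choose c hc using hf
  refine ⟨fun k => c (Fin.cast hrank.symm k), ?_⟩
  have hrows : LinearIndependent ℝ (tupleMinor (fun k => c (Fin.cast hrank.symm k)) X).row := by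
    have heq : (tupleMinor (fun k => c (Fin.cast hrank.symm k)) X).row =
        f ∘ Fin.cast hrank.symm := funext fun k => hc (Fin.cast hrank.symm k)
    rw [heq]
    exact hfi.comp (Fin.cast hrank.symm) (Fin.cast_injective _)
  rw [← isUnit_iff_ne_zero, ← Matrix.isUnit_iff_isUnit_det]
  exact Matrix.linearIndependent_rows_iff_isUnit.1 hrows

theorem finite_setOf_det_add_smul_one_eq_zero {r : ℕ} (A : Matrix (Fin r) (Fin r) ℝ) :
    {t : ℝ | (A + t • (1 : Matrix (Fin r) (Fin r) ℝ)).det = 0}.Finite := by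
  refine (Polynomial.finite_setOfPred_isRoot (Matrix.charpoly_monic (-A)).ne_zero).subset
    fun t ht => ?_
  rw [mem_ofPred_eq, Polynomial.IsRoot, Matrix.eval_charpoly]
  rwa [mem_ofPred_eq, add_comm, Matrix.smul_one_eq_diagonal, ← sub_neg_eq_add] at ht

theorem volume_det_tupleMinor_eq_zero {d r : ℕ} {e : Fin r → Fin d} (he : Function.Injective e) :
    volume {X : Fin r → Fin d → ℝ | (tupleMinor e X).det = 0} = 0 := by
  set Z := {X : Fin r → Fin d → ℝ | (tupleMinor e X).det = 0} with hZ
  have hZm : MeasurableSet Z :=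
    (isClosed_singleton.preimage (continuous_tupleMinor e).matrix_det).measurableSet
  set E : Fin r → Fin d → ℝ := fun j i => if i = e j then 1 else 0 with hE
  have hminor : ∀ X (t : ℝ), tupleMinor e (X + t • E) = tupleMinor e X + t • 1 := by
    intro X t
    ext k j
    simp [tupleMinor, hE, Matrix.one_apply, he.eq_iff]
  have hmap : Continuous fun p : ℝ × (Fin r → Fin d → ℝ) => p.2 + p.1 • E := by fun_prop
  have hjoint : Measurable fun p : ℝ × (Fin r → Fin d → ℝ) =>
      Z.indicator (fun _ => (1 : ℝ≥0∞)) (p.2 + p.1 • E) :=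
    (measurable_const.indicator hZm).comp hmap.measurable
  have hswap := lintegral_lintegral_swap (μ := volume.restrict (Icc (0 : ℝ) 1))
    (ν := (volume : Measure (Fin r → Fin d → ℝ)))
    (f := fun t X => Z.indicator (fun _ => (1 : ℝ≥0∞)) (X + t • E)) hjoint.aemeasurable
  have hleft : ∀ t : ℝ, ∫⁻ X, Z.indicator (fun _ => (1 : ℝ≥0∞)) (X + t • E) = volume Z := by
    intro t
    rw [lintegral_add_right_eq_self (fun X => Z.indicator (fun _ => (1 : ℝ≥0∞)) X) (t • E)]
    exact lintegral_indicator_one hZm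
  have hright : ∀ X, ∫⁻ t in Icc (0 : ℝ) 1, Z.indicator (fun _ => (1 : ℝ≥0∞)) (X + t • E) = 0 := by
    intro X
    have hfin := (finite_setOf_det_add_smul_one_eq_zero (tupleMinor e X)).measure_zero
      (volume.restrict (Icc (0 : ℝ) 1))
    rw [lintegral_eq_zero_of_ae_eq_zero]
    filter_upwards [measure_eq_zero_iff_ae_notMem.1 hfin] with t ht
    refine indicator_of_notMem (fun hmem => ht ?_) _
    rwa [← hminor]
  simp_rw [hleft, hright] at hswap
  simpa using hswap

/-- The counting measure on the linearly independent tuples of the lattice `M ℤ^d`. -/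
noncomputable def tupleCount {d : ℕ} (r : ℕ) (M : Matrix.SpecialLinearGroup (Fin d) ℝ) :
    Measure (Fin r → Fin d → ℝ) :=
  Measure.sum fun m : IndepTuple d r => Measure.dirac (tupleAct M.val (realTuple m.val))

theorem lintegral_tupleCount {d r : ℕ} (M : Matrix.SpecialLinearGroup (Fin d) ℝ)
    {G : (Fin r → Fin d → ℝ) → ℝ≥0∞} (hG : Measurable G) :
    ∫⁻ X, G X ∂tupleCount r M = siegelSum G M := by
  rw [tupleCount, lintegral_sum_measure]
  exact tsum_congr fun m => lintegral_dirac' _ hG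

theorem measurable_tupleCount_out (d r : ℕ) :
    Measurable fun q : Matrix.SpecialLinearGroup (Fin d) ℝ ⧸ SLZ d => tupleCount r q.out := by
  refine Measure.measurable_of_measurable_coe _ fun s hs => ?_
  have hind : Measurable (s.indicator (1 : (Fin r → Fin d → ℝ) → ℝ≥0∞)) :=
    measurable_one.indicator hs
  simp_rw [← lintegral_indicator_one hs, lintegral_tupleCount _ hind]
  exact measurable_siegelSum_out hind

/-- The mean of the measures `tupleCount` over the space of lattices. -/
noncomputable def meanTupleCount {d : ℕ} (r : ℕ)
    (μ : Measure (Matrix.SpecialLinearGroup (Fin d) ℝ ⧸ SLZ d)) : Measure (Fin r → Fin d → ℝ) :=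
  μ.bind fun q => tupleCount r q.out

theorem lintegral_meanTupleCount {d r : ℕ}
    (μ : Measure (Matrix.SpecialLinearGroup (Fin d) ℝ ⧸ SLZ d))
    {G : (Fin r → Fin d → ℝ) → ℝ≥0∞} (hG : Measurable G) :
    ∫⁻ X, G X ∂meanTupleCount r μ = ∫⁻ q, siegelSum G q.out ∂μ := by
  rw [meanTupleCount, Measure.lintegral_bind (measurable_tupleCount_out d r).aemeasurable
    hG.aemeasurable]
  simp_rw [lintegral_tupleCount _ hG]

theorem meanTupleCount_eq_volume {d r : ℕ} (hrd : r < d)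
    (μ : Measure (Matrix.SpecialLinearGroup (Fin d) ℝ ⧸ SLZ d)) [IsProbabilityMeasure μ]
    (hinv : ∀ g : Matrix.SpecialLinearGroup (Fin d) ℝ, Measure.map (fun x => g • x) μ = μ) :
    meanTupleCount r μ = volume := by
  set U : (Fin r → Fin d) → Set (Fin r → Fin d → ℝ) := fun e => {X | (tupleMinor e X).det ≠ 0}
  have hUo : ∀ e, IsOpen (U e) := fun e =>
    isOpen_compl_singleton.preimage (continuous_tupleMinor e).matrix_det
  have hUm : MeasurableSet (⋃ e, U e) := (isOpen_iUnion hUo).measurableSet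
  have hrestrict : (meanTupleCount r μ).restrict (⋃ e, U e) = volume.restrict (⋃ e, U e) := by
    refine Measure.restrict_iUnion_congr.2 fun e => ?_
    obtain ⟨i₀, hi₀⟩ : ∃ i₀, ∀ k, e k ≠ i₀ := by
      by_contra! hsurj
      exact hrd.not_ge (by simpa using Fintype.card_le_of_surjective e hsurj)
    refine restrict_eq_restrict_of_lintegral_eq _ _ (hUo e) fun F hF hFc hFs hF0 => ?_
    rw [lintegral_meanTupleCount μ hF.measurable.ennreal_ofReal]
    exact lintegral_siegelSum_eq hi₀ hF hFc hFs hF0 μ hinv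
  have hvol : ∀ᵐ X : Fin r → Fin d → ℝ, X ∈ ⋃ e, U e := by
    refine measure_mono_null (fun X hX => ?_)
      (volume_det_tupleMinor_eq_zero (Fin.castLE_injective hrd.le))
    by_contra hdet
    exact hX (mem_iUnion.2 ⟨_, hdet⟩)
  have hmean : ∀ᵐ X ∂meanTupleCount r μ, X ∈ ⋃ e, U e := by
    change meanTupleCount r μ (⋃ e, U e)ᶜ = 0
    rw [← lintegral_indicator_one hUm.compl,
      lintegral_meanTupleCount μ (measurable_one.indicator hUm.compl)]
    refine (lintegral_congr fun q => ?_).trans lintegral_zero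
    refine ENNReal.tsum_eq_zero.2 fun m => ?_
    have hmem : tupleAct q.out.val (realTuple m.val) ∈ ⋃ e, U e :=
      mem_iUnion.2 (exists_det_tupleMinor_ne_zero (linearIndependent_tupleAct q.out m.2))
    exact indicator_of_notMem (notMem_compl_iff.2 hmem) _
  rw [← Measure.restrict_eq_self_of_ae_mem hmean, hrestrict,
    Measure.restrict_eq_self_of_ae_mem hvol]

/-- The first moment formula for nonnegative functions. -/
theorem lintegral_siegelSum {d r : ℕ} (hrd : r < d)
    (μ : Measure (Matrix.SpecialLinearGroup (Fin d) ℝ ⧸ SLZ d)) [IsProbabilityMeasure μ]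
    (hinv : ∀ g : Matrix.SpecialLinearGroup (Fin d) ℝ, Measure.map (fun x => g • x) μ = μ)
    {G : (Fin r → Fin d → ℝ) → ℝ≥0∞} (hG : Measurable G) :
    ∫⁻ q, siegelSum G q.out ∂μ = ∫⁻ X, G X := by
  rw [← lintegral_meanTupleCount μ hG, meanTupleCount_eq_volume hrd μ hinv]

/-- The first moment formula for integrable functions. -/
theorem integral_tsum_indepTuple {d r : ℕ} (hrd : r < d)
    (μ : Measure (Matrix.SpecialLinearGroup (Fin d) ℝ ⧸ SLZ d)) [IsProbabilityMeasure μ]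
    (hinv : ∀ g : Matrix.SpecialLinearGroup (Fin d) ℝ, Measure.map (fun x => g • x) μ = μ)
    {F : (Fin r → Fin d → ℝ) → ℝ} (hFm : Measurable F) (hF : Integrable F) :
    ∫ q, ∑' m : IndepTuple d r,
      F (tupleAct (q.out : Matrix.SpecialLinearGroup (Fin d) ℝ).val (realTuple m.val)) ∂μ =
      ∫ X, F X := by
  have hpos : Measurable fun X => ENNReal.ofReal (F X) := hFm.ennreal_ofReal
  have hneg : Measurable fun X => ENNReal.ofReal (-F X) := hFm.neg.ennreal_ofReal
  have hfpos : ∫⁻ X, ENNReal.ofReal (F X) ≠ ∞ := hF.lintegral_lt_top.ne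
  have hfneg : ∫⁻ X, ENNReal.ofReal (-F X) ≠ ∞ := hF.neg.lintegral_lt_top.ne
  have hIpos := lintegral_siegelSum hrd μ hinv hpos
  have hIneg := lintegral_siegelSum hrd μ hinv hneg
  have hmpos := measurable_siegelSum_out hpos
  have hmneg := measurable_siegelSum_out hneg
  have hapos := ae_lt_top hmpos (hIpos ▸ hfpos)
  have haneg := ae_lt_top hmneg (hIneg ▸ hfneg)
  have hae : ∀ᵐ q ∂μ, ∑' m : IndepTuple d r,
      F (tupleAct (q.out : Matrix.SpecialLinearGroup (Fin d) ℝ).val (realTuple m.val)) =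
      (siegelSum (fun X => ENNReal.ofReal (F X)) q.out).toReal -
        (siegelSum (fun X => ENNReal.ofReal (-F X)) q.out).toReal := by
    filter_upwards [hapos, haneg] with q hq₁ hq₂
    rw [siegelSum, siegelSum, ENNReal.tsum_toReal_eq fun m => ENNReal.ofReal_ne_top,
      ENNReal.tsum_toReal_eq fun m => ENNReal.ofReal_ne_top,
      ← (ENNReal.summable_toReal hq₁.ne).tsum_sub (ENNReal.summable_toReal hq₂.ne)]
    refine tsum_congr fun m => ?_
    rw [ENNReal.toReal_ofReal', ENNReal.toReal_ofReal']
    exact (max_zero_sub_max_neg_zero_eq_self _).symm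
  rw [integral_congr_ae hae, integral_sub (integrable_toReal_of_lintegral_ne_top
      hmpos.aemeasurable (hIpos ▸ hfpos)) (integrable_toReal_of_lintegral_ne_top
      hmneg.aemeasurable (hIneg ▸ hfneg)), integral_toReal hmpos.aemeasurable hapos,
    integral_toReal hmneg.aemeasurable haneg, hIpos, hIneg,
    integral_eq_lintegral_pos_part_sub_lintegral_neg_part hF]

end

/-- Rogers-type first moment formula: for `d > r ≥ 1` and `F : (ℝ^d)^r → ℝ` bounded, Borel,
compactly supported, the function `f(M) = ∑ F(M m¹, …, M m^r)`, summed over linearly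
independent `r`-tuples of integer vectors, satisfies `∫ f dμ = ∫ F dx` where `μ` is the
invariant (Haar) probability measure on `SL(d,ℝ)/SL(d,ℤ)`. -/
theorem stmt_13 (d r : ℕ) (hr : 1 ≤ r) (hrd : r < d)
    (F : (Fin r → Fin d → ℝ) → ℝ) (hFm : Measurable F)
    (hFb : ∃ C : ℝ, ∀ x, |F x| ≤ C) (hFc : HasCompactSupport F)
    (μ : Measure (Matrix.SpecialLinearGroup (Fin d) ℝ ⧸ SLZ d)) [IsProbabilityMeasure μ]
    (hinv : ∀ g : Matrix.SpecialLinearGroup (Fin d) ℝ,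
      Measure.map (fun x => g • x) μ = μ)
    (f : (Matrix.SpecialLinearGroup (Fin d) ℝ ⧸ SLZ d) → ℝ)
    (hf : ∀ M : Matrix.SpecialLinearGroup (Fin d) ℝ,
      f (QuotientGroup.mk M) =
        ∑' m : {m : Fin r → Fin d → ℤ //
            LinearIndependent ℝ fun j : Fin r => fun i : Fin d => ((m j i : ℝ))},
          F fun j i => (M.val.mulVec fun i' => ((m.val j i' : ℝ))) i) :
    ∫ x, f x ∂μ = ∫ x : Fin r → Fin d → ℝ, F x := by
  obtain ⟨C, hC⟩ := hFb
  have hF : Integrable F := by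
    refine (integrableOn_iff_integrable_of_support_subset (subset_tsupport F)).1 ?_
    exact Measure.integrableOn_of_bounded hFc.isCompact.measure_lt_top.ne
      hFm.aestronglyMeasurable (M := C) (ae_of_all _ hC)
  rw [← integral_tsum_indepTuple hrd μ hinv hFm hF]
  refine integral_congr_ae (ae_of_all _ fun q => ?_)
  have h := hf q.out
  rw [QuotientGroup.out_eq'] at h
  exact h
end

section
/- Rogers-type full moment formula: let d > r ≥ 1 and F : (ℝ^d)^r → ℝ bounded, compactly supported, Borel. Define f(M) = ∑_{m¹,…,m^r ∈ ℤ^d} F(M m¹,…,M m^r). Then ∫_{SL(d,ℝ)/SL(d,ℤ)} f dμ = ∑_{l=0}^{r} ∑_{π ∈ Gr(r,l)(ℚ)} covol(π_ℤ)^{−d} ∫_{π'} F(x) dx, where the inner sum is over rational l-dimensional subspaces π of ℝ^r, π' ⊆ (ℝ^d)^r is the image of π under the diagonal embedding sending (x¹,…,x^r) ∈ π^d (coordinatewise) into (ℝ^d)^r, dx is Lebesgue measure on π' (the Dirac mass at 0 when l = 0), and μ is Haar probability measure. -/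
open MeasureTheory

/-- `IsZBasisOf B π` says that the integer vectors `B 0, …, B (l-1)` form a basis of the
lattice `π ∩ ℤ^r`: they lie in `π`, are linearly independent, span `π` over `ℝ`, and
generate every integer point of `π` over `ℤ`. -/
def IsZBasisOf {r l : ℕ} (B : Fin l → Fin r → ℤ) (π : Submodule ℝ (Fin r → ℝ)) : Prop :=
  (∀ t, (fun j => (B t j : ℝ)) ∈ π) ∧
  (LinearIndependent ℝ fun t => fun j => (B t j : ℝ)) ∧
  Submodule.span ℝ (Set.range fun t => fun j => (B t j : ℝ)) = π ∧
  ∀ v : Fin r → ℤ, (fun j => (v j : ℝ)) ∈ π →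
    ∃ c : Fin l → ℤ, ∀ j, v j = ∑ t, c t * B t j

namespace Rogers
open Matrix Set Filter Topology
open scoped ENNReal

instance (d : ℕ) : BorelSpace (SpecialLinearGroup (Fin d) ℝ) := ⟨rfl⟩

instance (d : ℕ) : IsTopologicalGroup (SpecialLinearGroup (Fin d) ℝ) :=
  Matrix.SpecialLinearGroup.topologicalGroup

theorem continuous_val (d : ℕ) :
    Continuous fun g : SpecialLinearGroup (Fin d) ℝ => g.val :=
  continuous_subtype_val

theorem isClosedEmbedding_val (d : ℕ) :
    IsClosedEmbedding fun g : SpecialLinearGroup (Fin d) ℝ => g.val :=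
  (isClosed_eq (Continuous.matrix_det continuous_id) continuous_const
    : IsClosed {A : Matrix (Fin d) (Fin d) ℝ | A.det = 1}).isClosedEmbedding_subtypeVal

instance (d : ℕ) : PolishSpace (Matrix (Fin d) (Fin d) ℝ) :=
  inferInstanceAs (PolishSpace (Fin d → Fin d → ℝ))

instance (d : ℕ) : PolishSpace (SpecialLinearGroup (Fin d) ℝ) :=
  (isClosedEmbedding_val d).polishSpace

theorem mem_SLZ {d : ℕ} {g : SpecialLinearGroup (Fin d) ℝ} :
    g ∈ SLZ d ↔ ∀ i j, ∃ m : ℤ, (m : ℝ) = g.val i j := by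
  constructor
  · rintro ⟨γ, rfl⟩ i j
    exact ⟨γ.val i j, rfl⟩
  · intro h
    choose m hm using h
    have hmap : (Matrix.of m).map (Int.castRingHom ℝ) = g.val := by
      ext i j
      exact hm i j
    refine ⟨⟨Matrix.of m, ?_⟩, ?_⟩
    · have h1 := (Int.castRingHom ℝ).map_det (Matrix.of m)
      rw [RingHom.mapMatrix_apply, hmap, g.prop] at h1
      exact_mod_cast (show (((Matrix.of m).det : ℤ) : ℝ) = 1 from h1)
    · ext i j
      exact hm i j

instance (d : ℕ) : IsClosed (SLZ d : Set (SpecialLinearGroup (Fin d) ℝ)) := by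
  have : (SLZ d : Set (SpecialLinearGroup (Fin d) ℝ)) =
      ⋂ i, ⋂ j, (fun g => g.val i j) ⁻¹' range ((↑) : ℤ → ℝ) := by
    ext g
    simp only [SetLike.mem_coe, mem_SLZ, mem_iInter, mem_preimage, mem_range]
  rw [this]
  exact isClosed_iInter fun i => isClosed_iInter fun j =>
    Int.isClosedEmbedding_coe_real.isClosed_range.preimage ((continuous_val d).matrix_elem i j)

/-- The space of unimodular lattices. -/
abbrev LatticeSpace (d : ℕ) := SpecialLinearGroup (Fin d) ℝ ⧸ SLZ d

instance (d : ℕ) : OpensMeasurableSpace (LatticeSpace d) :=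
  ⟨MeasurableSpace.generateFrom_le fun s hs => by
    have h : IsOpen s := hs
    exact (h.preimage QuotientGroup.continuous_mk).measurableSet⟩

theorem measurable_mk (d : ℕ) :
    Measurable (QuotientGroup.mk : SpecialLinearGroup (Fin d) ℝ → LatticeSpace d) :=
  measurable_quotient_mk''

theorem measurable_of_comp_mk {d : ℕ} {β : Type*} [MeasurableSpace β] {f : LatticeSpace d → β}
    (hf : Measurable fun M : SpecialLinearGroup (Fin d) ℝ => f (QuotientGroup.mk M)) :
    Measurable f :=
  measurable_from_quotient.2 hf

theorem measurable_prod_of_comp_mk {d : ℕ} {A : Type*} [TopologicalSpace A] [PolishSpace A]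
    [MeasurableSpace A] [BorelSpace A] {f : LatticeSpace d × A → ℝ≥0∞}
    (hf : Measurable fun p : SpecialLinearGroup (Fin d) ℝ × A => f (QuotientGroup.mk p.1, p.2)) :
    Measurable f := by
  have hp : Measurable (Prod.map QuotientGroup.mk id :
      SpecialLinearGroup (Fin d) ℝ × A → LatticeSpace d × A) :=
    (measurable_mk d).prodMap measurable_id
  refine (hp.measurable_comp_iff_of_surjective
    (QuotientGroup.mk_surjective.prodMap Function.surjective_id)).1 hf

theorem val_mul {d : ℕ} {R : Type*} [CommRing R] (g h : SpecialLinearGroup (Fin d) R) :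
    (g * h).val = g.val * h.val :=
  rfl

theorem val_one {d : ℕ} {R : Type*} [CommRing R] :
    (1 : SpecialLinearGroup (Fin d) R).val = 1 :=
  rfl

/-- The diagonal action of a matrix on tuples of vectors. -/
def act {d l : ℕ} (g : Matrix (Fin d) (Fin d) ℝ) (x : Fin l → Fin d → ℝ) : Fin l → Fin d → ℝ :=
  fun t => g *ᵥ x t

/-- The real tuple underlying an integral tuple. -/
def realTuple {d l : ℕ} (n : Fin l → Fin d → ℤ) : Fin l → Fin d → ℝ := fun t i => n t i

theorem act_mul {d l : ℕ} (g h : Matrix (Fin d) (Fin d) ℝ) (x : Fin l → Fin d → ℝ) :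
    act (g * h) x = act g (act h x) := by
  funext t
  simp [act]

theorem act_one {d l : ℕ} (x : Fin l → Fin d → ℝ) : act 1 x = x := by
  funext t
  simp [act]

theorem continuous_act {d l : ℕ} :
    Continuous fun p : Matrix (Fin d) (Fin d) ℝ × (Fin l → Fin d → ℝ) => act p.1 p.2 :=
  continuous_pi fun t => continuous_fst.matrix_mulVec ((continuous_apply t).comp continuous_snd)

theorem linearIndependent_act {d l : ℕ} (g : SpecialLinearGroup (Fin d) ℝ)
    {x : Fin l → Fin d → ℝ} : LinearIndependent ℝ (act g.val x) ↔ LinearIndependent ℝ x := by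
  have key : ∀ (g : SpecialLinearGroup (Fin d) ℝ) {x : Fin l → Fin d → ℝ},
      LinearIndependent ℝ x → LinearIndependent ℝ (act g.val x) := by
    intro g x hx
    refine hx.map' g.val.mulVecLin (LinearMap.ker_eq_bot.2 ?_)
    refine Matrix.mulVec_injective_iff_isUnit.2 ?_
    rw [Matrix.isUnit_iff_isUnit_det, g.prop]
    exact isUnit_one
  refine ⟨fun h => ?_, key g⟩
  have := key g⁻¹ h
  rwa [← act_mul, ← val_mul, inv_mul_cancel, val_one,
    act_one] at this

/-- The sum of `G` over all `l`-tuples of vectors of the lattice `M ℤ^d`. -/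
noncomputable def latticeSum {d l : ℕ} (G : (Fin l → Fin d → ℝ) → ℝ≥0∞)
    (M : SpecialLinearGroup (Fin d) ℝ) : ℝ≥0∞ :=
  ∑' n : Fin l → Fin d → ℤ, G (act M.val (realTuple n))

theorem latticeSum_mul_left {d l : ℕ} (G : (Fin l → Fin d → ℝ) → ℝ≥0∞)
    (g M : SpecialLinearGroup (Fin d) ℝ) :
    latticeSum G (g * M) = latticeSum (fun x => G (act g.val x)) M := by
  simp [latticeSum, act_mul]

theorem latticeSum_mul_right {d l : ℕ} (G : (Fin l → Fin d → ℝ) → ℝ≥0∞)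
    (M : SpecialLinearGroup (Fin d) ℝ) {γ : SpecialLinearGroup (Fin d) ℝ} (hγ : γ ∈ SLZ d) :
    latticeSum G (M * γ) = latticeSum G M := by
  obtain ⟨δ, rfl⟩ := hγ
  let e : (Fin l → Fin d → ℤ) ≃ (Fin l → Fin d → ℤ) :=
    { toFun := fun n t => δ.val *ᵥ n t
      invFun := fun n t => (δ⁻¹).val *ᵥ n t
      left_inv := fun n => by
        funext t
        simp only [mulVec_mulVec, ← val_mul, inv_mul_cancel, val_one, one_mulVec]
      right_inv := fun n => by
        funext t
        simp only [mulVec_mulVec, ← val_mul, mul_inv_cancel, val_one, one_mulVec] }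
  rw [latticeSum, latticeSum, ← e.tsum_eq fun n => G (act M.val (realTuple n))]
  refine tsum_congr fun n => congrArg G ?_
  rw [val_mul, act_mul]
  congr 1
  funext t i
  simp [act, realTuple, e, mulVec, dotProduct]

/-- The function on the space of lattices induced by `latticeSum`. -/
noncomputable def siegel {d l : ℕ} (G : (Fin l → Fin d → ℝ) → ℝ≥0∞) (x : LatticeSpace d) : ℝ≥0∞ :=
  latticeSum G x.out

theorem siegel_mk {d l : ℕ} (G : (Fin l → Fin d → ℝ) → ℝ≥0∞)
    (M : SpecialLinearGroup (Fin d) ℝ) : siegel G (QuotientGroup.mk M) = latticeSum G M := by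
  obtain ⟨h, hh⟩ := QuotientGroup.mk_out_eq_mul (SLZ d) M
  rw [siegel, hh, latticeSum_mul_right G M h.2]

theorem siegel_smul {d l : ℕ} (G : (Fin l → Fin d → ℝ) → ℝ≥0∞)
    (g : SpecialLinearGroup (Fin d) ℝ) (x : LatticeSpace d) :
    siegel G (g • x) = siegel (fun y => G (act g.val y)) x := by
  obtain ⟨M, rfl⟩ := QuotientGroup.mk_surjective x
  rw [siegel_mk, ← latticeSum_mul_left, ← siegel_mk]
  rfl

theorem measurable_latticeSum_act {d l : ℕ} {A : Type*} [MeasurableSpace A]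
    {G : (Fin l → Fin d → ℝ) → ℝ≥0∞} (hG : Measurable G)
    {g : A → Matrix (Fin d) (Fin d) ℝ} (hg : ∀ i j, Measurable fun a => g a i j) :
    Measurable fun p : SpecialLinearGroup (Fin d) ℝ × A =>
      latticeSum (fun y => G (act (g p.2) y)) p.1 := by
  refine Measurable.tsum fun n => hG.comp ?_
  refine measurable_pi_lambda _ fun t => measurable_pi_lambda _ fun i => ?_
  have h1 : ∀ i j, Measurable fun p : SpecialLinearGroup (Fin d) ℝ × A => p.1.val i j :=
    fun i j => (((continuous_val d).matrix_elem i j).measurable).comp measurable_fst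
  have h2 : ∀ i j, Measurable fun p : SpecialLinearGroup (Fin d) ℝ × A => g p.2 i j :=
    fun i j => (hg i j).comp measurable_snd
  simp only [act, mulVec, dotProduct]
  exact Finset.measurable_fun_sum _ fun j _ => (h2 i j).mul
    (Finset.measurable_fun_sum _ fun k _ => (h1 j k).mul measurable_const)

theorem measurable_siegel_act {d l : ℕ} {A : Type*} [TopologicalSpace A] [PolishSpace A]
    [MeasurableSpace A] [BorelSpace A]
    {G : (Fin l → Fin d → ℝ) → ℝ≥0∞} (hG : Measurable G)
    {g : A → Matrix (Fin d) (Fin d) ℝ} (hg : ∀ i j, Measurable fun a => g a i j) :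
    Measurable fun p : LatticeSpace d × A => siegel (fun y => G (act (g p.2) y)) p.1 := by
  refine measurable_prod_of_comp_mk ?_
  simp only [siegel_mk]
  exact measurable_latticeSum_act hG hg

theorem measurable_siegel {d l : ℕ} {G : (Fin l → Fin d → ℝ) → ℝ≥0∞} (hG : Measurable G) :
    Measurable (siegel G : LatticeSpace d → ℝ≥0∞) := by
  have h := (measurable_siegel_act hG (A := Unit) (g := fun _ => 1) fun _ _ => measurable_const).comp
    (measurable_id.prodMk measurable_const : Measurable fun x : LatticeSpace d => (x, ()))
  simpa [Function.comp_def, act_one] using h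

theorem measurable_smul_latticeSpace {d : ℕ} (g : SpecialLinearGroup (Fin d) ℝ) :
    Measurable fun x : LatticeSpace d => g • x :=
  measurable_of_comp_mk ((measurable_mk d).comp (measurable_const_mul g))

theorem lintegral_smul_eq {d : ℕ} {μ : Measure (LatticeSpace d)}
    (hinv : ∀ g : SpecialLinearGroup (Fin d) ℝ, Measure.map (fun x => g • x) μ = μ)
    {φ : LatticeSpace d → ℝ≥0∞} (hφ : Measurable φ) (g : SpecialLinearGroup (Fin d) ℝ) :
    ∫⁻ x, φ (g • x) ∂μ = ∫⁻ x, φ x ∂μ := by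
  conv_rhs => rw [← hinv g]
  rw [lintegral_map hφ (measurable_smul_latticeSpace g)]

/-- If the averages of a lattice sum over translates of every lattice by suitable probability
measures converge to `c`, then its mean value over the space of lattices is `c`. -/
theorem lintegral_siegel_of_tendsto {d l : ℕ} {μ : Measure (LatticeSpace d)}
    [IsProbabilityMeasure μ]
    (hinv : ∀ g : SpecialLinearGroup (Fin d) ℝ, Measure.map (fun x => g • x) μ = μ)
    {A : Type*} [TopologicalSpace A] [PolishSpace A] [MeasurableSpace A] [BorelSpace A]
    {η : Measure A} [IsProbabilityMeasure η]
    {G : (Fin l → Fin d → ℝ) → ℝ≥0∞} (hG : Measurable G)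
    {g : ℕ → A → SpecialLinearGroup (Fin d) ℝ} (hg : ∀ k i j, Measurable fun a => (g k a).val i j)
    {c : ℝ≥0∞}
    (hc : ∀ M : SpecialLinearGroup (Fin d) ℝ, Tendsto
      (fun k => ∫⁻ a, latticeSum (fun y => G (act (g k a).val y)) M ∂η) atTop (𝓝 c)) :
    ∫⁻ x, siegel G x ∂μ = c := by
  have hm : ∀ k, Measurable fun p : LatticeSpace d × A => siegel G (g k p.2 • p.1) := by
    intro k
    simp only [siegel_smul]
    exact measurable_siegel_act hG (hg k)
  have hmean : ∀ (k : ℕ) (ψ : ℝ≥0∞ → ℝ≥0∞), Measurable ψ →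
      ∫⁻ x, ∫⁻ a, ψ (siegel G (g k a • x)) ∂η ∂μ = ∫⁻ x, ψ (siegel G x) ∂μ := by
    intro k ψ hψ
    rw [lintegral_lintegral_swap (f := fun x a => ψ (siegel G (g k a • x)))
      (hψ.comp (hm k)).aemeasurable]
    simp [lintegral_smul_eq (φ := fun x => ψ (siegel G x)) hinv
      (hψ.comp (measurable_siegel hG))]
  have hlim : ∀ x : LatticeSpace d, Tendsto
      (fun k => ∫⁻ a, siegel G (g k a • x) ∂η) atTop (𝓝 c) := by
    intro x
    obtain ⟨M, rfl⟩ := QuotientGroup.mk_surjective x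
    simpa only [siegel_smul, siegel_mk] using hc M
  have hmk : ∀ k, Measurable fun x : LatticeSpace d => ∫⁻ a, siegel G (g k a • x) ∂η :=
    fun k => (hm k).lintegral_prod_right'
  apply le_antisymm
  · have hK : ∀ K : ℕ, ∫⁻ x, min (siegel G x) K ∂μ ≤ c := by
      intro K
      have h1 : Tendsto (fun k => ∫⁻ x, min (∫⁻ a, siegel G (g k a • x) ∂η) K ∂μ) atTop
          (𝓝 (∫⁻ _, min c K ∂μ)) := by
        refine tendsto_lintegral_of_dominated_convergence (fun _ => (K : ℝ≥0∞))
          (fun k => (hmk k).min measurable_const) (fun k => ae_of_all _ fun x => min_le_right _ _)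
          (by simp) (ae_of_all _ fun x => (hlim x).min tendsto_const_nhds)
      refine (ge_of_tendsto' h1 fun k => ?_).trans (by simp)
      rw [← hmean k (fun t => min t K) (measurable_id.min measurable_const)]
      refine lintegral_mono fun x => le_min (lintegral_mono fun a => min_le_left _ _) ?_
      exact (lintegral_mono fun a => min_le_right _ _).trans (by simp)
    have h2 : Tendsto (fun K : ℕ => ∫⁻ x, min (siegel G x) K ∂μ) atTop
        (𝓝 (∫⁻ x, siegel G x ∂μ)) := by
      refine lintegral_tendsto_of_tendsto_of_monotone
        (fun K => ((measurable_siegel hG).min measurable_const).aemeasurable)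
        (ae_of_all _ fun x K K' h => min_le_min_left _ (by exact_mod_cast h))
        (ae_of_all _ fun x => ?_)
      simpa using (tendsto_const_nhds (x := siegel G x)).min ENNReal.tendsto_nat_nhds_top
    exact le_of_tendsto' h2 hK
  · calc c = ∫⁻ _, c ∂μ := by simp
      _ = ∫⁻ x, liminf (fun k => ∫⁻ a, siegel G (g k a • x) ∂η) atTop ∂μ :=
        lintegral_congr fun x => (hlim x).liminf_eq.symm
      _ ≤ liminf (fun k => ∫⁻ x, ∫⁻ a, siegel G (g k a • x) ∂η ∂μ) atTop :=
        lintegral_liminf_le hmk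
      _ = ∫⁻ x, siegel G x ∂μ := by
        simp only [hmean _ (fun t => t) measurable_id]
        simp

/-- The componentwise integer part of a tuple of vectors. -/
noncomputable def floorTuple {d l : ℕ} (x : Fin l → Fin d → ℝ) : Fin l → Fin d → ℤ :=
  fun t i => ⌊x t i⌋

theorem measurable_floorTuple {d l : ℕ} :
    Measurable (floorTuple : (Fin l → Fin d → ℝ) → Fin l → Fin d → ℤ) :=
  measurable_pi_lambda _ fun t => measurable_pi_lambda _ fun i =>
    Int.measurable_floor.comp ((measurable_pi_apply i).comp (measurable_pi_apply t))

theorem lintegral_floorTuple {d l : ℕ} (φ : (Fin l → Fin d → ℤ) → ℝ≥0∞) :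
    ∫⁻ x : Fin l → Fin d → ℝ, φ (floorTuple x) = ∑' n, φ n := by
  rw [← lintegral_map (measurable_of_countable φ) measurable_floorTuple, lintegral_countable']
  refine tsum_congr fun n => ?_
  have h : floorTuple ⁻¹' {n} = Set.pi univ fun t => Set.pi univ fun i =>
      Ico (n t i : ℝ) (n t i + 1) := by
    ext x
    simp [floorTuple, funext_iff, Int.floor_eq_iff]
  rw [Measure.map_apply measurable_floorTuple (measurableSet_singleton n), h, volume_pi_pi]
  simp [volume_pi_pi]

theorem measurable_realTuple_floorTuple {d l : ℕ} :
    Measurable fun x : Fin l → Fin d → ℝ => realTuple (floorTuple x) :=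
  (measurable_of_countable realTuple).comp measurable_floorTuple

theorem norm_sub_realTuple_floorTuple_le {d l : ℕ} (x : Fin l → Fin d → ℝ) :
    ‖x - realTuple (floorTuple x)‖ ≤ 1 := by
  refine (pi_norm_le_iff_of_nonneg zero_le_one).2 fun t =>
    (pi_norm_le_iff_of_nonneg zero_le_one).2 fun i => ?_
  rw [Real.norm_eq_abs, abs_le]
  have h1 := Int.floor_le (x t i)
  have h2 := Int.lt_floor_add_one (x t i)
  simp only [Pi.sub_apply, realTuple, floorTuple]
  constructor <;> linarith

theorem act_smul {d l : ℕ} (g : Matrix (Fin d) (Fin d) ℝ) (s : ℝ) (x : Fin l → Fin d → ℝ) :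
    act g (s • x) = s • act g x := by
  funext t
  simp [act, mulVec_smul]

theorem measurePreserving_act {d l : ℕ} (g : SpecialLinearGroup (Fin d) ℝ) :
    MeasurePreserving (act g.val : (Fin l → Fin d → ℝ) → _) := by
  refine volume_preserving_pi (f := fun _ : Fin l => fun v : Fin d → ℝ => g.val *ᵥ v) fun t => ?_
  refine ⟨(Continuous.matrix_mulVec continuous_const continuous_id).measurable, ?_⟩
  have h := Real.map_matrix_volume_pi_eq_smul_volume_pi (M := g.val) (by simp [g.prop])
  simp only [g.prop, inv_one, abs_one, ENNReal.ofReal_one, one_smul] at h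
  exact h

theorem lintegral_comp_smul_tuple {d l : ℕ} {s : ℝ} (hs : 0 < s)
    {φ : (Fin l → Fin d → ℝ) → ℝ≥0∞} (hφ : Measurable φ) :
    ENNReal.ofReal (s ^ (l * d)) * ∫⁻ x, φ (s • x) = ∫⁻ x, φ x := by
  have h := Measure.map_addHaar_smul (volume : Measure (Fin l → Fin d → ℝ)) hs.ne'
  rw [← lintegral_map hφ (measurable_const_smul s), h, lintegral_smul_measure, smul_eq_mul,
    ← mul_assoc, ← ENNReal.ofReal_mul (by positivity)]
  have h2 : Module.finrank ℝ (Fin l → Fin d → ℝ) = l * d := by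
    simp [Module.finrank_pi_fintype]
  rw [h2, abs_of_pos (by positivity), mul_inv_cancel₀ (by positivity)]
  simp

theorem tendsto_lintegral_comp_family {d l : ℕ} {Θ : (Fin l → Fin d → ℝ) → ℝ → ℝ}
    (hΘ : Continuous fun p : (Fin l → Fin d → ℝ) × ℝ => Θ p.1 p.2) {R : ℝ}
    (hR : ∀ z, ∀ κ ∈ Icc (0 : ℝ) 1, Θ z κ ≠ 0 → ‖z‖ ≤ R)
    {κ : ℕ → ℝ} (hκ : ∀ k, κ k ∈ Icc (0 : ℝ) 1) (hκ0 : Tendsto κ atTop (𝓝 0))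
    {u : ℕ → (Fin l → Fin d → ℝ) → (Fin l → Fin d → ℝ)} (hu : ∀ k, Measurable (u k))
    {v : (Fin l → Fin d → ℝ) → (Fin l → Fin d → ℝ)}
    (huv : ∀ x, Tendsto (fun k => u k x) atTop (𝓝 (v x)))
    {R' : ℝ} (hR' : ∀ k x, ‖u k x‖ ≤ R → ‖x‖ ≤ R') :
    Tendsto (fun k => ∫⁻ x, ENNReal.ofReal (Θ (u k x) (κ k))) atTop
      (𝓝 (∫⁻ x, ENNReal.ofReal (Θ (v x) 0))) := by
  obtain ⟨C, hC⟩ : ∃ C, ∀ p ∈ Metric.closedBall (0 : Fin l → Fin d → ℝ) R ×ˢ Icc (0 : ℝ) 1,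
      ‖Θ p.1 p.2‖ ≤ C :=
    ((isCompact_closedBall _ _).prod isCompact_Icc).exists_bound_of_continuousOn hΘ.continuousOn
  refine tendsto_lintegral_of_dominated_convergence
    ((Metric.closedBall 0 R').indicator fun _ => ENNReal.ofReal C) (fun k => ?_) (fun k => ?_) ?_ ?_
  · exact ENNReal.measurable_ofReal.comp (hΘ.measurable.comp ((hu k).prodMk measurable_const))
  · refine ae_of_all _ fun x => ?_
    by_cases h : Θ (u k x) (κ k) = 0
    · simp [h]
    · have h1 := hR _ _ (hκ k) h
      rw [indicator_of_mem (by simpa using hR' k x h1)]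
      exact ENNReal.ofReal_le_ofReal ((le_abs_self _).trans
        (hC (u k x, κ k) ⟨by simpa using h1, hκ k⟩))
  · rw [lintegral_indicator_const Metric.isClosed_closedBall.measurableSet]
    exact ENNReal.mul_ne_top ENNReal.ofReal_ne_top measure_closedBall_lt_top.ne
  · refine ae_of_all _ fun x => ENNReal.tendsto_ofReal ?_
    exact (hΘ.tendsto (v x, 0)).comp ((huv x).prodMk_nhds hκ0)

theorem tendsto_lintegral_scaled {d l : ℕ} {Θ : (Fin l → Fin d → ℝ) → ℝ → ℝ}
    (hΘ : Continuous fun p : (Fin l → Fin d → ℝ) × ℝ => Θ p.1 p.2) {R : ℝ}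
    (hR : ∀ z, ∀ κ ∈ Icc (0 : ℝ) 1, Θ z κ ≠ 0 → ‖z‖ ≤ R)
    {κ : ℕ → ℝ} (hκ : ∀ k, κ k ∈ Icc (0 : ℝ) 1) (hκ0 : Tendsto κ atTop (𝓝 0))
    {s : ℕ → ℝ} (hs : ∀ k, 0 < s k) :
    Tendsto (fun k => ∫⁻ x, ENNReal.ofReal (s k ^ (l * d) * Θ (s k • x) (κ k))) atTop
      (𝓝 (∫⁻ x, ENNReal.ofReal (Θ x 0))) := by
  refine (tendsto_lintegral_comp_family hΘ hR hκ hκ0 (u := fun _ x => x) (v := fun x => x)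
    (fun _ => measurable_id) (fun x => tendsto_const_nhds) fun _ _ h => h).congr fun k => ?_
  have hm : Measurable fun x => ENNReal.ofReal (Θ x (κ k)) :=
    ENNReal.measurable_ofReal.comp (hΘ.measurable.comp (measurable_id.prodMk measurable_const))
  rw [← lintegral_comp_smul_tuple (hs k) hm, ← lintegral_const_mul
    (f := fun x => ENNReal.ofReal (Θ (s k • x) (κ k))) _ (hm.comp (measurable_const_smul (s k)))]
  simp_rw [ENNReal.ofReal_mul (pow_nonneg (hs k).le _)]

/-- Riemann sums over the lattice `M ℤ^d`, for a family of integrands. -/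
theorem tendsto_tsum_scaled {d l : ℕ} {Θ : (Fin l → Fin d → ℝ) → ℝ → ℝ}
    (hΘ : Continuous fun p : (Fin l → Fin d → ℝ) × ℝ => Θ p.1 p.2) {R : ℝ}
    (hR : ∀ z, ∀ κ ∈ Icc (0 : ℝ) 1, Θ z κ ≠ 0 → ‖z‖ ≤ R)
    {κ : ℕ → ℝ} (hκ : ∀ k, κ k ∈ Icc (0 : ℝ) 1) (hκ0 : Tendsto κ atTop (𝓝 0))
    {s : ℕ → ℝ} (hs : ∀ k, 0 < s k) (hs1 : ∀ k, s k ≤ 1) (hs0 : Tendsto s atTop (𝓝 0))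
    (M : SpecialLinearGroup (Fin d) ℝ) :
    Tendsto (fun k => ∑' n : Fin l → Fin d → ℤ,
      ENNReal.ofReal (s k ^ (l * d) * Θ (s k • act M.val (realTuple n)) (κ k))) atTop
      (𝓝 (∫⁻ x, ENNReal.ofReal (Θ x 0))) := by
  have hfl : ∀ k (x : Fin l → Fin d → ℝ),
      ‖x - s k • realTuple (floorTuple ((s k)⁻¹ • x))‖ ≤ s k := by
    intro k x
    have h := norm_sub_realTuple_floorTuple_le ((s k)⁻¹ • x)
    calc ‖x - s k • realTuple (floorTuple ((s k)⁻¹ • x))‖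
        = ‖s k • ((s k)⁻¹ • x - realTuple (floorTuple ((s k)⁻¹ • x)))‖ := by
          rw [smul_sub, smul_inv_smul₀ (hs k).ne']
      _ ≤ s k := by
          rw [norm_smul, Real.norm_of_nonneg (hs k).le]
          exact mul_le_of_le_one_right (hs k).le h
  have hcont : ∀ g : Matrix (Fin d) (Fin d) ℝ, Continuous (act g : (Fin l → Fin d → ℝ) → _) :=
    fun g => continuous_act.comp (continuous_const.prodMk continuous_id)
  obtain ⟨R₁, hR₁⟩ := ((isCompact_closedBall (0 : Fin l → Fin d → ℝ) R).image
    (hcont (M⁻¹).val)).isBounded.exists_norm_le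
  have hmu : ∀ k, Measurable fun x : Fin l → Fin d → ℝ =>
      s k • realTuple (floorTuple ((s k)⁻¹ • x)) := fun k =>
    (measurable_const_smul (s k)).comp
      (measurable_realTuple_floorTuple.comp (measurable_const_smul (s k)⁻¹))
  have key := tendsto_lintegral_comp_family hΘ hR hκ hκ0
    (u := fun k x => act M.val (s k • realTuple (floorTuple ((s k)⁻¹ • x)))) (v := act M.val)
    (R' := R₁ + 1) (fun k => ?_) (fun x => ?_) (fun k x h => ?_)
  · have hm0 : Measurable fun x => ENNReal.ofReal (Θ x 0) :=
      ENNReal.measurable_ofReal.comp (hΘ.measurable.comp (measurable_id.prodMk measurable_const))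
    rw [(measurePreserving_act M).lintegral_comp hm0] at key
    refine key.congr fun k => ?_
    have hm : Measurable fun x : Fin l → Fin d → ℝ =>
        ENNReal.ofReal (Θ (act M.val (s k • realTuple (floorTuple ((s k)⁻¹ • x)))) (κ k)) := by
      refine ENNReal.measurable_ofReal.comp (hΘ.measurable.comp (Measurable.prodMk ?_
        measurable_const))
      exact (hcont _).measurable.comp (hmu k)
    rw [← lintegral_comp_smul_tuple (hs k) hm]
    simp_rw [inv_smul_smul₀ (hs k).ne', act_smul]
    rw [lintegral_floorTuple fun n => ENNReal.ofReal (Θ (s k • act M.val (realTuple n)) (κ k)),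
      ← ENNReal.tsum_mul_left]
    simp_rw [ENNReal.ofReal_mul (pow_nonneg (hs k).le _)]
  · exact (hcont _).measurable.comp (hmu k)
  · refine ((hcont _).tendsto x).comp ?_
    rw [tendsto_iff_norm_sub_tendsto_zero]
    refine squeeze_zero (fun _ => norm_nonneg _) (fun k => ?_) hs0
    rw [norm_sub_rev]
    exact hfl k x
  · have h1 := hR₁ _ (mem_image_of_mem _ (by simpa using h))
    rw [← act_mul, ← val_mul, inv_mul_cancel, val_one, act_one] at h1
    calc ‖x‖ ≤ ‖s k • realTuple (floorTuple ((s k)⁻¹ • x))‖ +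
          ‖x - s k • realTuple (floorTuple ((s k)⁻¹ • x))‖ := by
            simpa using norm_add_le (s k • realTuple (floorTuple ((s k)⁻¹ • x)))
              (x - s k • realTuple (floorTuple ((s k)⁻¹ • x)))
      _ ≤ R₁ + 1 := add_le_add h1 ((hfl k x).trans (hs1 k))

theorem integral_comp_act {d l : ℕ} {y : Matrix (Fin d) (Fin d) ℝ} (hy : y.det ≠ 0)
    (φ : (Fin l → Fin d → ℝ) → ℝ) :
    ∫ a, φ (act y a) = |(y.det ^ l)⁻¹| * ∫ b, φ b := by
  let L : (Fin l → Fin d → ℝ) →ₗ[ℝ] (Fin l → Fin d → ℝ) :=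
    LinearMap.pi fun t => (Matrix.toLin' y).comp (LinearMap.proj t)
  have hL : ∀ a, L a = act y a := fun a => by
    funext t
    simp [L, act]
  have hdet : LinearMap.det L = y.det ^ l := by
    simp [L, LinearMap.det_pi]
  have hdet0 : LinearMap.det L ≠ 0 := by
    rw [hdet]
    exact pow_ne_zero _ hy
  have hemb : MeasurableEmbedding L :=
    ((LinearMap.equivOfDetNeZero L hdet0).toContinuousLinearEquiv.toHomeomorph).measurableEmbedding
  have h := Measure.map_linearMap_addHaar_eq_smul_addHaar
    (volume : Measure (Fin l → Fin d → ℝ)) hdet0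
  simp_rw [← hL]
  rw [← hemb.integral_map, h, integral_smul_measure, hdet, ENNReal.toReal_ofReal (abs_nonneg _),
    smul_eq_mul]

/-- The first `l` coordinates of each vector of a tuple. -/
def top {l e : ℕ} (x : Fin l → Fin (l + e) → ℝ) : Matrix (Fin l) (Fin l) ℝ :=
  Matrix.of fun t i => x t (Fin.castAdd e i)

/-- The last `e` coordinates of a tuple, as a family of `e` vectors. -/
def bot {l e : ℕ} (x : Fin l → Fin (l + e) → ℝ) : Fin e → Fin l → ℝ :=
  fun j t => x t (Fin.natAdd l j)

/-- The tuple with given first and last coordinates. -/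
def comb {l e : ℕ} (y : Matrix (Fin l) (Fin l) ℝ) (w : Fin e → Fin l → ℝ) :
    Fin l → Fin (l + e) → ℝ :=
  fun t => Fin.append (y t) fun j => w j t

theorem comb_top_bot {l e : ℕ} (x : Fin l → Fin (l + e) → ℝ) : comb (top x) (bot x) = x := by
  funext t i
  refine Fin.addCases (fun i => ?_) (fun j => ?_) i <;> simp [comb, top, bot]

theorem top_comb {l e : ℕ} (y : Matrix (Fin l) (Fin l) ℝ) (w : Fin e → Fin l → ℝ) :
    top (comb y w) = y := by
  ext t i
  simp [comb, top]

theorem bot_comb {l e : ℕ} (y : Matrix (Fin l) (Fin l) ℝ) (w : Fin e → Fin l → ℝ) :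
    bot (comb y w) = w := by
  funext j t
  simp [comb, bot]

theorem continuous_top {l e : ℕ} :
    Continuous (top : (Fin l → Fin (l + e) → ℝ) → Matrix (Fin l) (Fin l) ℝ) :=
  continuous_matrix fun t i =>
    (continuous_apply (Fin.castAdd e i)).comp (continuous_apply t)

theorem continuous_bot {l e : ℕ} :
    Continuous (bot : (Fin l → Fin (l + e) → ℝ) → Fin e → Fin l → ℝ) :=
  continuous_pi fun j => continuous_pi fun t =>
    (continuous_apply (Fin.natAdd l j)).comp (continuous_apply t)

theorem continuous_comb {l e : ℕ} :
    Continuous fun p : Matrix (Fin l) (Fin l) ℝ × (Fin e → Fin l → ℝ) => comb p.1 p.2 := by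
  refine continuous_pi fun t => continuous_pi fun i => ?_
  refine Fin.addCases (fun i => ?_) (fun j => ?_) i
  · simpa [comb] using continuous_fst.matrix_elem t i
  · simpa [comb, Function.comp_def] using
      (continuous_apply t).comp ((continuous_apply j).comp continuous_snd)

theorem top_smul {l e : ℕ} (s : ℝ) (x : Fin l → Fin (l + e) → ℝ) : top (s • x) = s • top x := by
  ext t i
  simp [top]

theorem bot_smul {l e : ℕ} (s : ℝ) (x : Fin l → Fin (l + e) → ℝ) : bot (s • x) = s • bot x := by
  funext j t
  simp [bot]

/-- The block lower triangular matrix with diagonal blocks `s` and `τ` and lower left block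
`τ a`. -/
def shearMatrix {l e : ℕ} (s τ : ℝ) (a : Fin e → Fin l → ℝ) :
    Matrix (Fin (l + e)) (Fin (l + e)) ℝ :=
  Matrix.reindex finSumFinEquiv finSumFinEquiv
    (Matrix.fromBlocks (s • (1 : Matrix (Fin l) (Fin l) ℝ)) 0 (τ • Matrix.of a)
      (τ • (1 : Matrix (Fin e) (Fin e) ℝ)))

theorem det_shearMatrix {l e : ℕ} (s τ : ℝ) (a : Fin e → Fin l → ℝ) :
    (shearMatrix s τ a).det = s ^ l * τ ^ e := by
  simp [shearMatrix]

theorem continuous_shearMatrix {l e : ℕ} (s τ : ℝ) :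
    Continuous (shearMatrix s τ : (Fin e → Fin l → ℝ) → _) := by
  refine Continuous.matrix_reindex ?_ _ _
  refine Continuous.matrix_fromBlocks continuous_const continuous_const ?_ continuous_const
  exact continuous_id.const_smul τ

theorem act_shearMatrix {l e : ℕ} (s τ : ℝ) (a : Fin e → Fin l → ℝ)
    (x : Fin l → Fin (l + e) → ℝ) :
    act (shearMatrix s τ a) x = comb (s • top x) (τ • (bot x + act (top x) a)) := by
  funext t i
  refine Fin.addCases (fun i => ?_) (fun j => ?_) i
  · simp [act, shearMatrix, comb, top, mulVec, dotProduct, Fin.sum_univ_add, Matrix.one_apply]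
  · simp [act, shearMatrix, comb, top, bot, mulVec, dotProduct, Fin.sum_univ_add,
      Matrix.one_apply, mul_add, Finset.mul_sum, mul_comm, mul_left_comm, add_comm]

/-- The integrand of `rescaledAverage`. -/
noncomputable def rescaledIntegrand {l e : ℕ} (ρ : (Fin e → Fin l → ℝ) → ℝ)
    (G : (Fin l → Fin (l + e) → ℝ) → ℝ) (z : Fin l → Fin (l + e) → ℝ) (κ : ℝ)
    (β : Fin e → Fin l → ℝ) : ℝ :=
  |((top z).det ^ e)⁻¹| * (ρ (act (top z)⁻¹ (κ • β - bot z)) * G (comb (top z) β))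

/-- The average of `G` over a shear orbit, rescaled so that it depends only on the ratio `κ` of
the two dilation factors. -/
noncomputable def rescaledAverage {l e : ℕ} (ρ : (Fin e → Fin l → ℝ) → ℝ)
    (G : (Fin l → Fin (l + e) → ℝ) → ℝ) (z : Fin l → Fin (l + e) → ℝ) (κ : ℝ) : ℝ :=
  ∫ β, rescaledIntegrand ρ G z κ β

section
variable {l e : ℕ} {ρ : (Fin e → Fin l → ℝ) → ℝ} {G : (Fin l → Fin (l + e) → ℝ) → ℝ}

theorem continuous_rescaledIntegrand (hρ : Continuous ρ) (hG : Continuous G)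
    (hGU : ∀ x ∈ tsupport G, (top x).det ≠ 0) :
    Continuous fun p : ((Fin l → Fin (l + e) → ℝ) × ℝ) × (Fin e → Fin l → ℝ) =>
      rescaledIntegrand ρ G p.1.1 p.1.2 p.2 := by
  rw [continuous_iff_continuousAt]
  intro p
  have hcomb : Continuous fun p : ((Fin l → Fin (l + e) → ℝ) × ℝ) × (Fin e → Fin l → ℝ) =>
      comb (top p.1.1) p.2 :=
    continuous_comb.comp
      ((continuous_top.comp (continuous_fst.comp continuous_fst)).prodMk continuous_snd)
  have htop : Continuous fun p : ((Fin l → Fin (l + e) → ℝ) × ℝ) × (Fin e → Fin l → ℝ) =>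
      top p.1.1 := continuous_top.comp (continuous_fst.comp continuous_fst)
  by_cases hp : (top p.1.1).det = 0
  · have h : comb (top p.1.1) p.2 ∉ tsupport G := fun h => hGU _ h (by rwa [top_comb])
    have h2 : ∀ᶠ q : ((Fin l → Fin (l + e) → ℝ) × ℝ) × (Fin e → Fin l → ℝ) in 𝓝 p,
        comb (top q.1.1) q.2 ∉ tsupport G :=
      (hcomb.tendsto p) ((isClosed_tsupport G).isOpen_compl.mem_nhds h)
    refine (continuousAt_const (y := (0 : ℝ))).congr ?_
    filter_upwards [h2] with q hq
    simp [rescaledIntegrand, image_eq_zero_of_notMem_tsupport hq]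
  · have hdet : ContinuousAt (fun p : ((Fin l → Fin (l + e) → ℝ) × ℝ) × (Fin e → Fin l → ℝ) =>
        (top p.1.1).det) p := htop.matrix_det.continuousAt
    have hinv : ContinuousAt (fun p : ((Fin l → Fin (l + e) → ℝ) × ℝ) × (Fin e → Fin l → ℝ) =>
        (top p.1.1)⁻¹) p := by
      simp_rw [Matrix.inv_def, Ring.inverse_eq_inv']
      exact (hdet.inv₀ hp).smul htop.matrix_adjugate.continuousAt
    have harg : Continuous fun p : ((Fin l → Fin (l + e) → ℝ) × ℝ) × (Fin e → Fin l → ℝ) =>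
        p.1.2 • p.2 - bot p.1.1 :=
      ((continuous_snd.comp continuous_fst).smul continuous_snd).sub
        (continuous_bot.comp (continuous_fst.comp continuous_fst))
    refine ((hdet.pow e).inv₀ (pow_ne_zero _ hp)).abs.mul
      (ContinuousAt.mul ?_ (hG.comp hcomb).continuousAt)
    exact (hρ.comp continuous_act).continuousAt.comp (hinv.prodMk harg.continuousAt)

theorem exists_norm_le_of_rescaledIntegrand (hGc : HasCompactSupport G) :
    ∃ R, ∀ z κ β, rescaledIntegrand ρ G z κ β ≠ 0 → ‖comb (top z) β‖ ≤ R := by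
  obtain ⟨R, hR⟩ := hGc.isCompact.isBounded.exists_norm_le
  exact ⟨R, fun z κ β h => hR _ (subset_tsupport _ (right_ne_zero_of_mul (right_ne_zero_of_mul h)))⟩

theorem norm_le_norm_comb (y : Matrix (Fin l) (Fin l) ℝ) (β : Fin e → Fin l → ℝ) :
    ‖β‖ ≤ ‖comb y β‖ := by
  refine (pi_norm_le_iff_of_nonneg (norm_nonneg _)).2 fun j =>
    (pi_norm_le_iff_of_nonneg (norm_nonneg _)).2 fun t => ?_
  have h := (norm_le_pi_norm (comb y β t) (Fin.natAdd l j)).trans (norm_le_pi_norm (comb y β) t)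
  simpa [comb] using h

theorem continuous_rescaledAverage (hρ : Continuous ρ) (hG : Continuous G)
    (hGc : HasCompactSupport G) (hGU : ∀ x ∈ tsupport G, (top x).det ≠ 0) :
    Continuous fun p : (Fin l → Fin (l + e) → ℝ) × ℝ => rescaledAverage ρ G p.1 p.2 := by
  obtain ⟨R, hR⟩ := exists_norm_le_of_rescaledIntegrand (ρ := ρ) hGc
  have h := continuous_parametric_integral_of_continuous (μ := volume)
    (f := fun (p : (Fin l → Fin (l + e) → ℝ) × ℝ) β => rescaledIntegrand ρ G p.1 p.2 β)
    (continuous_rescaledIntegrand hρ hG hGU)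
    (isCompact_closedBall (0 : Fin e → Fin l → ℝ) R)
  refine h.congr fun p => setIntegral_eq_integral_of_forall_compl_eq_zero fun β hβ => ?_
  by_contra hne
  exact hβ (by simpa using (norm_le_norm_comb _ _).trans (hR _ _ _ hne))

theorem exists_norm_le_of_rescaledAverage (hρc : HasCompactSupport ρ)
    (hGc : HasCompactSupport G) (hGU : ∀ x ∈ tsupport G, (top x).det ≠ 0) :
    ∃ R, ∀ z, ∀ κ ∈ Icc (0 : ℝ) 1, rescaledAverage ρ G z κ ≠ 0 → ‖z‖ ≤ R := by
  let P : ((Fin l → Fin (l + e) → ℝ) × (Fin e → Fin l → ℝ)) × ℝ → Fin l → Fin (l + e) → ℝ :=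
    fun p => comb (top p.1.1) (p.2 • bot p.1.1 - act (top p.1.1) p.1.2)
  have hP : Continuous P := by
    have h1 : Continuous fun p : ((Fin l → Fin (l + e) → ℝ) × (Fin e → Fin l → ℝ)) × ℝ =>
        top p.1.1 := continuous_top.comp (continuous_fst.comp continuous_fst)
    have h2 : Continuous fun p : ((Fin l → Fin (l + e) → ℝ) × (Fin e → Fin l → ℝ)) × ℝ =>
        bot p.1.1 := continuous_bot.comp (continuous_fst.comp continuous_fst)
    exact continuous_comb.comp (h1.prodMk ((continuous_snd.smul h2).sub
      (continuous_act.comp (h1.prodMk (continuous_snd.comp continuous_fst)))))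
  obtain ⟨R, hR⟩ := (((hGc.isCompact.prod hρc.isCompact).prod
    (isCompact_Icc (a := (0 : ℝ)) (b := 1))).image hP).isBounded.exists_norm_le
  refine ⟨R, fun z κ hκ h => ?_⟩
  obtain ⟨β, hβ⟩ : ∃ β, rescaledIntegrand ρ G z κ β ≠ 0 := by
    by_contra! hcon
    exact h (by simp [rescaledAverage, hcon])
  have h1 := right_ne_zero_of_mul hβ
  have hG1 := subset_tsupport _ (right_ne_zero_of_mul h1)
  have hρ1 := subset_tsupport _ (left_ne_zero_of_mul h1)
  have hdet := hGU _ hG1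
  rw [top_comb] at hdet
  refine hR z ⟨((comb (top z) β, act (top z)⁻¹ (κ • β - bot z)), κ), ⟨⟨hG1, hρ1⟩, hκ⟩, ?_⟩
  simp only [P, top_comb, bot_comb]
  rw [← act_mul, Matrix.mul_nonsing_inv _ (isUnit_iff_ne_zero.2 hdet), act_one, sub_sub_cancel,
    comb_top_bot]

theorem integral_shear_eq (hGU : ∀ x ∈ tsupport G, (top x).det ≠ 0) {s τ : ℝ} (hs : 0 < s)
    (hτ : 0 < τ) (hst : s ^ l * τ ^ e = 1) (x : Fin l → Fin (l + e) → ℝ) :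
    ∫ a, ρ a * G (act (shearMatrix s τ a) x) =
      s ^ (l * (l + e)) * rescaledAverage ρ G (s • x) (s / τ) := by
  by_cases hx : (top x).det = 0
  · have h0 : ∀ w, G (comb (s • top x) w) = 0 := fun w =>
      image_eq_zero_of_notMem_tsupport fun h => hGU _ h (by rw [top_comb, Matrix.det_smul, hx,
        mul_zero])
    simp [act_shearMatrix, rescaledAverage, rescaledIntegrand, top_smul, h0]
  · have hU : IsUnit (top x).det := isUnit_iff_ne_zero.2 hx
    let φ : (Fin e → Fin l → ℝ) → ℝ := fun β =>
      ρ (act (top x)⁻¹ (τ⁻¹ • β - bot x)) * G (comb (s • top x) β)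
    have h1 : ∀ a, ρ a * G (act (shearMatrix s τ a) x) =
        φ (τ • (bot x + act (top x) a)) := by
      intro a
      simp only [φ]
      rw [act_shearMatrix, inv_smul_smul₀ hτ.ne', add_sub_cancel_left, ← act_mul,
        Matrix.nonsing_inv_mul _ hU, act_one]
    have h2 : ∀ β, rescaledIntegrand ρ G (s • x) (s / τ) β =
        |((s ^ l * (top x).det) ^ e)⁻¹| * φ β := by
      intro β
      have h3 : (s • top x)⁻¹ = s⁻¹ • (top x)⁻¹ := by
        exact Matrix.inv_smul' (A := top x) (Units.mk0 s hs.ne') hU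
      have h4 : (s / τ) • β - s • bot x = s • (τ⁻¹ • β - bot x) := by
        rw [smul_sub, smul_smul, div_eq_mul_inv]
      have h5 : ∀ w : Fin e → Fin l → ℝ, act (s⁻¹ • (top x)⁻¹) (s • w) = act (top x)⁻¹ w := by
        intro w
        funext j
        simp [act, Matrix.smul_mulVec, mulVec_smul, hs.ne']
      simp only [rescaledIntegrand, φ, top_smul, bot_smul, Matrix.det_smul, Fintype.card_fin]
      rw [h3, h4, h5]
    simp_rw [h1, rescaledAverage, h2]
    rw [integral_comp_act (φ := fun b => φ (τ • (bot x + b))) hx,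
      integral_add_left_eq_self (fun b => φ (τ • b)) (bot x), Measure.integral_comp_smul,
      integral_const_mul]
    have hfr : Module.finrank ℝ (Fin e → Fin l → ℝ) = e * l := by
      simp [Module.finrank_pi_fintype]
    rw [hfr, smul_eq_mul, ← mul_assoc, ← mul_assoc]
    congr 1
    have hsτ : (s ^ l) ^ l * τ ^ (e * l) = 1 := by
      rw [pow_mul, ← mul_pow, hst, one_pow]
    rw [abs_inv, abs_inv, abs_inv, abs_pow, abs_pow, abs_pow, abs_mul, abs_pow, abs_of_pos hs,
      abs_of_pos hτ]
    have hd : |(top x).det| ≠ 0 := abs_ne_zero.2 hx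
    have hs' := hs.ne'
    have hτ' := hτ.ne'
    field_simp
    rw [mul_add, pow_add, pow_mul, mul_pow, ← pow_mul s l e]
    linear_combination (-(s ^ (l * e) * |(top x).det| ^ e)) * hsτ

end

theorem exists_shear_params (l : ℕ) {e : ℕ} (he : 1 ≤ e) :
    ∃ s τ : ℕ → ℝ, (∀ k, 0 < s k) ∧ (∀ k, 0 < τ k) ∧ (∀ k, s k ≤ 1) ∧
      (∀ k, s k / τ k ∈ Icc (0 : ℝ) 1) ∧ (∀ k, s k ^ l * τ k ^ e = 1) ∧
      Tendsto s atTop (𝓝 0) ∧ Tendsto (fun k => s k / τ k) atTop (𝓝 0) := by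
  have hk : ∀ k : ℕ, (1 : ℝ) ≤ k + 1 := fun k => by simp
  have hpos : ∀ k : ℕ, (0 : ℝ) < k + 1 := fun k => by positivity
  have hs1 : ∀ k : ℕ, (((k : ℝ) + 1) ^ e)⁻¹ ≤ 1 := fun k =>
    inv_le_one_of_one_le₀ (one_le_pow₀ (hk k))
  have hst : ∀ k : ℕ, (((k : ℝ) + 1) ^ e)⁻¹ / ((k : ℝ) + 1) ^ l ≤ (((k : ℝ) + 1) ^ e)⁻¹ :=
    fun k => div_le_self (by positivity) (one_le_pow₀ (hk k))
  have hs0 : Tendsto (fun k : ℕ => (((k : ℝ) + 1) ^ e)⁻¹) atTop (𝓝 0) := by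
    refine tendsto_inv_atTop_zero.comp ((tendsto_pow_atTop (α := ℝ) (by omega : e ≠ 0)).comp ?_)
    exact tendsto_atTop_add_const_right _ _ tendsto_natCast_atTop_atTop
  refine ⟨fun k => (((k : ℝ) + 1) ^ e)⁻¹, fun k => ((k : ℝ) + 1) ^ l, fun k => by positivity,
    fun k => by positivity, hs1, fun k => ⟨by positivity, (hst k).trans (hs1 k)⟩, fun k => ?_, hs0,
    squeeze_zero (fun k => by positivity) hst hs0⟩
  rw [inv_pow, ← pow_mul, ← pow_mul, mul_comm, mul_comm e l]
  have h : (((k : ℝ) + 1) ^ (l * e)) ≠ 0 := by positivity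
  exact mul_inv_cancel₀ h

/-- Siegel's mean value formula for continuous functions supported on tuples whose projection to
the first coordinates is nondegenerate. -/
theorem lintegral_siegel_of_continuous {l e : ℕ} (he : 1 ≤ e) {μ : Measure (LatticeSpace (l + e))}
    [IsProbabilityMeasure μ]
    (hinv : ∀ g : SpecialLinearGroup (Fin (l + e)) ℝ, Measure.map (fun x => g • x) μ = μ)
    {G : (Fin l → Fin (l + e) → ℝ) → ℝ} (hG : Continuous G) (hG0 : ∀ x, 0 ≤ G x)
    (hGc : HasCompactSupport G) (hGU : ∀ x ∈ tsupport G, (top x).det ≠ 0) :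
    ∫⁻ x, siegel (fun y => ENNReal.ofReal (G y)) x ∂μ = ∫⁻ y, ENNReal.ofReal (G y) := by
  obtain ⟨s, τ, hs, hτ, hs1, hκ, hst, hs0, hκ0⟩ := exists_shear_params l he
  let b : ContDiffBump (0 : Fin e → Fin l → ℝ) := ⟨1, 2, one_pos, one_lt_two⟩
  set ρ : (Fin e → Fin l → ℝ) → ℝ := b.normed volume with hρdef
  have hρ : Continuous ρ := b.continuous_normed
  have hρ0 : ∀ a, 0 ≤ ρ a := b.nonneg_normed
  have hρc : HasCompactSupport ρ := b.hasCompactSupport_normed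
  have hρint : Integrable ρ := b.integrable_normed
  have hρ1 : ∫⁻ a, ENNReal.ofReal (ρ a) = 1 := by
    rw [← ofReal_integral_eq_lintegral_ofReal hρint (ae_of_all _ hρ0), hρdef, b.integral_normed,
      ENNReal.ofReal_one]
  have hρm : Measurable fun a => ENNReal.ofReal (ρ a) := ENNReal.measurable_ofReal.comp hρ.measurable
  let η : Measure (Fin e → Fin l → ℝ) := volume.withDensity fun a => ENNReal.ofReal (ρ a)
  have : IsProbabilityMeasure η := ⟨by simp [η, hρ1]⟩
  let g : ℕ → (Fin e → Fin l → ℝ) → SpecialLinearGroup (Fin (l + e)) ℝ := fun k a =>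
    ⟨shearMatrix (s k) (τ k) a, by rw [det_shearMatrix, hst]⟩
  have hGm : Measurable fun y => ENNReal.ofReal (G y) := ENNReal.measurable_ofReal.comp hG.measurable
  obtain ⟨R, hR⟩ := exists_norm_le_of_rescaledAverage hρc hGc hGU
  have hΘ := continuous_rescaledAverage hρ hG hGc hGU
  have hcont : ∀ k, Continuous fun p : (Fin l → Fin (l + e) → ℝ) × (Fin e → Fin l → ℝ) =>
      ρ p.2 * G (act (shearMatrix (s k) (τ k) p.2) p.1) := fun k =>
    (hρ.comp continuous_snd).mul (hG.comp (continuous_act.comp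
      (((continuous_shearMatrix _ _).comp continuous_snd).prodMk continuous_fst)))
  have havg : ∀ k x, ∫⁻ a, ENNReal.ofReal (ρ a * G (act (shearMatrix (s k) (τ k) a) x)) =
      ENNReal.ofReal (s k ^ (l * (l + e)) * rescaledAverage ρ G (s k • x) (s k / τ k)) := by
    intro k x
    rw [← integral_shear_eq hGU (hs k) (hτ k) (hst k), ofReal_integral_eq_lintegral_ofReal]
    · exact ((hcont k).comp (continuous_const.prodMk continuous_id)).integrable_of_hasCompactSupport
        hρc.mul_right
    · exact ae_of_all _ fun a => mul_nonneg (hρ0 a) (hG0 _)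
  have hlim : ∫⁻ x, ENNReal.ofReal (rescaledAverage ρ G x 0) = ∫⁻ y, ENNReal.ofReal (G y) := by
    refine tendsto_nhds_unique (tendsto_lintegral_scaled hΘ hR hκ hκ0 hs) ?_
    refine tendsto_const_nhds.congr fun k => ?_
    simp_rw [← havg k]
    rw [lintegral_lintegral_swap (f := fun x a =>
        ENNReal.ofReal (ρ a * G (act (shearMatrix (s k) (τ k) a) x)))
      (ENNReal.measurable_ofReal.comp (hcont k).measurable).aemeasurable]
    simp_rw [ENNReal.ofReal_mul (hρ0 _)]
    have h1 : ∀ a, ∫⁻ x, ENNReal.ofReal (ρ a) *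
        ENNReal.ofReal (G (act (shearMatrix (s k) (τ k) a) x)) =
        ENNReal.ofReal (ρ a) * ∫⁻ y, ENNReal.ofReal (G y) := by
      intro a
      rw [← (measurePreserving_act (g k a)).lintegral_comp hGm, lintegral_const_mul]
      exact hGm.comp (measurePreserving_act (g k a)).measurable
    simp_rw [h1]
    rw [lintegral_mul_const _ hρm, hρ1, one_mul]
  rw [← hlim]
  refine lintegral_siegel_of_tendsto (η := η) hinv hGm (g := g) (fun k i j => ?_) fun M => ?_
  · exact ((continuous_shearMatrix _ _).matrix_elem i j).measurable
  · refine (tendsto_tsum_scaled hΘ hR hκ hκ0 hs hs1 hs0 M).congr fun k => ?_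
    simp_rw [← havg k]
    have hm : ∀ n : Fin l → Fin (l + e) → ℤ, Measurable fun a =>
        ENNReal.ofReal (G (act (g k a).val (act M.val (realTuple n)))) := fun n =>
      hGm.comp (continuous_act.comp ((continuous_shearMatrix _ _).prodMk
        continuous_const)).measurable
    simp only [η, latticeSum]
    rw [lintegral_withDensity_eq_lintegral_mul _ hρm (Measurable.tsum hm)]
    simp only [Pi.mul_apply, ← ENNReal.tsum_mul_left]
    refine Eq.trans ?_ (lintegral_tsum fun n => (hρm.mul (hm n)).aemeasurable).symm
    simp_rw [ENNReal.ofReal_mul (hρ0 _)]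
    rfl

/-- The mean value over the space of lattices of the counting measure on `l`-tuples of lattice
vectors. -/
noncomputable def meanMeasure {d : ℕ} (l : ℕ) (μ : Measure (LatticeSpace d)) :
    Measure (Fin l → Fin d → ℝ) :=
  μ.bind fun x => Measure.sum fun n => Measure.dirac (act x.out.val (realTuple n))

theorem lintegral_meanMeasure {d l : ℕ} (μ : Measure (LatticeSpace d))
    {G : (Fin l → Fin d → ℝ) → ℝ≥0∞} (hG : Measurable G) :
    ∫⁻ y, G y ∂meanMeasure l μ = ∫⁻ x, siegel G x ∂μ := by
  rw [meanMeasure, Measure.lintegral_bind _ hG.aemeasurable]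
  · simp only [lintegral_sum_measure, lintegral_dirac' _ hG]
    rfl
  · refine (Measure.measurable_of_measurable_coe _ fun s hs => ?_).aemeasurable
    simp only [Measure.sum_apply _ hs, Measure.dirac_apply' _ hs]
    exact measurable_siegel (measurable_one.indicator hs)

theorem measurePreserving_act_meanMeasure {d l : ℕ} {μ : Measure (LatticeSpace d)}
    (hinv : ∀ g : SpecialLinearGroup (Fin d) ℝ, Measure.map (fun x => g • x) μ = μ)
    (g : SpecialLinearGroup (Fin d) ℝ) :
    MeasurePreserving (act g.val) (meanMeasure l μ) (meanMeasure l μ) := by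
  have hm := (measurePreserving_act (l := l) g).measurable
  refine ⟨hm, Measure.ext_of_lintegral _ fun G hG => ?_⟩
  rw [lintegral_map hG hm, lintegral_meanMeasure μ hG,
    lintegral_meanMeasure (G := fun x => G (act g.val x)) μ (hG.comp hm),
    ← lintegral_smul_eq hinv (measurable_siegel hG) g]
  simp only [siegel_smul]

theorem isOpen_det_top (l e : ℕ) :
    IsOpen {x : Fin l → Fin (l + e) → ℝ | (top x).det ≠ 0} :=
  isOpen_ne.preimage continuous_top.matrix_det

theorem restrict_meanMeasure_of_isCompact {l e : ℕ} (he : 1 ≤ e)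
    {μ : Measure (LatticeSpace (l + e))} [IsProbabilityMeasure μ]
    (hinv : ∀ g : SpecialLinearGroup (Fin (l + e)) ℝ, Measure.map (fun x => g • x) μ = μ)
    {K : Set (Fin l → Fin (l + e) → ℝ)} (hK : IsCompact K) (hKU : ∀ x ∈ K, (top x).det ≠ 0) :
    (meanMeasure l μ).restrict K = volume.restrict K := by
  obtain ⟨χ, hχ1, hχc, hχU, hχ⟩ :=
    exists_continuousMap_one_of_isCompact_subset_isOpen hK (isOpen_det_top l e) hKU
  have hm : Measurable fun x => ENNReal.ofReal (χ x) :=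
    ENNReal.measurable_ofReal.comp χ.continuous.measurable
  have key : ∀ f : BoundedContinuousFunction (Fin l → Fin (l + e) → ℝ) NNReal,
      ∫⁻ x, f x ∂(meanMeasure l μ).withDensity (fun x => ENNReal.ofReal (χ x)) =
      ∫⁻ x, f x ∂volume.withDensity fun x => ENNReal.ofReal (χ x) := by
    intro f
    have hf : Measurable fun x => (f x : ℝ≥0∞) :=
      f.continuous.measurable.coe_nnreal_ennreal
    rw [lintegral_withDensity_eq_lintegral_mul _ hm hf,
      lintegral_withDensity_eq_lintegral_mul _ hm hf]
    have h1 : ((fun x => ENNReal.ofReal (χ x)) * fun x => (f x : ℝ≥0∞)) =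
        fun x => ENNReal.ofReal (χ x * f x) := by
      funext x
      rw [Pi.mul_apply, ENNReal.ofReal_mul (hχ x).1, ENNReal.ofReal_coe_nnreal]
    rw [h1, lintegral_meanMeasure _ (by rw [← h1]; exact hm.mul hf)]
    refine lintegral_siegel_of_continuous he hinv ?_ (fun x => mul_nonneg (hχ x).1 (f x).2) ?_ ?_
    · exact χ.continuous.mul (NNReal.continuous_coe.comp f.continuous)
    · exact HasCompactSupport.mul_right (f := χ) hχc
    · exact fun x hx => hχU (tsupport_mul_subset_left hx)
  have hfin : IsFiniteMeasure ((volume : Measure (Fin l → Fin (l + e) → ℝ)).withDensity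
      fun x => ENNReal.ofReal (χ x)) :=
    isFiniteMeasure_withDensity_ofReal
      (χ.continuous.integrable_of_hasCompactSupport hχc).2
  have heq := (ext_of_forall_lintegral_eq_of_IsFiniteMeasure fun f => (key f).symm).symm
  have hres : ∀ ν : Measure (Fin l → Fin (l + e) → ℝ),
      (ν.withDensity fun x => ENNReal.ofReal (χ x)).restrict K = ν.restrict K := by
    intro ν
    rw [restrict_withDensity hK.measurableSet]
    conv_rhs => rw [← withDensity_one (μ := ν.restrict K)]
    refine withDensity_congr_ae ?_
    filter_upwards [ae_restrict_mem hK.measurableSet] with x hx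
    simp [hχ1 hx]
  rw [← hres, heq, hres]

theorem exists_act_det_top_ne_zero {l e : ℕ} (he : 1 ≤ e) {x : Fin l → Fin (l + e) → ℝ}
    (hx : LinearIndependent ℝ x) :
    ∃ h : SpecialLinearGroup (Fin (l + e)) ℝ, (top (act h.val x)).det ≠ 0 := by
  classical
  let b₀ := Module.Basis.sumExtend hx
  have hb₀ : ∀ t, b₀ (Sum.inl t) = x t := fun t => by
    simp only [b₀, Module.Basis.sumExtend, Module.Basis.extend, Module.Basis.reindex_apply,
      Module.Basis.mk_apply]
    rfl
  have hfin : Finite (Module.Basis.sumExtendIndex hx) := by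
    have := Module.Finite.finite_basis b₀
    exact Finite.of_injective (Sum.inr : _ → Fin l ⊕ Module.Basis.sumExtendIndex hx)
      Sum.inr_injective
  have := Fintype.ofFinite (Module.Basis.sumExtendIndex hx)
  have hcard : Fintype.card (Module.Basis.sumExtendIndex hx) = e := by
    have := Module.finrank_eq_card_basis b₀
    rw [Module.finrank_fin_fun, Fintype.card_sum, Fintype.card_fin] at this
    omega
  let b := b₀.reindex ((Equiv.sumCongr (Equiv.refl _) (Fintype.equivFinOfCardEq hcard)).trans
    finSumFinEquiv)
  have hb : ∀ t, b (Fin.castAdd e t) = x t := fun t => by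
    simp [b, hb₀]
  let f := LinearMap.toMatrix' (b.equivFun : (Fin (l + e) → ℝ) →ₗ[ℝ] (Fin (l + e) → ℝ))
  have hf : f.det ≠ 0 := by
    rw [LinearMap.det_toMatrix']
    exact b.equivFun.isUnit_det'.ne_zero
  let j₀ : Fin (l + e) := Fin.natAdd l ⟨0, he⟩
  let D : Matrix (Fin (l + e)) (Fin (l + e)) ℝ :=
    Matrix.diagonal (Function.update 1 j₀ (f.det)⁻¹)
  have hD : D.det = (f.det)⁻¹ := by
    simp [D, Finset.prod_update_of_mem]
  refine ⟨⟨D * f, by rw [det_mul, hD, inv_mul_cancel₀ hf]⟩, ?_⟩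
  have htop : top (act (D * f) x) = 1 := by
    ext t i
    have h1 : f *ᵥ x t = Pi.single (Fin.castAdd e t) 1 := by
      rw [LinearMap.toMatrix'_mulVec, ← hb]
      ext j
      simp [Pi.single_apply, eq_comm]
    have h2 : Fin.castAdd e i ≠ j₀ := by
      simp [j₀, Fin.ext_iff]
      omega
    simp [top, act, ← Matrix.mulVec_mulVec, h1, D, mulVec_diagonal, h2, Matrix.one_apply,
      Pi.single_apply, eq_comm]
  change (top (act (D * f) x)).det ≠ 0
  rw [htop, det_one]
  exact one_ne_zero

theorem restrict_meanMeasure {l e : ℕ} (he : 1 ≤ e)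
    {μ : Measure (LatticeSpace (l + e))} [IsProbabilityMeasure μ]
    (hinv : ∀ g : SpecialLinearGroup (Fin (l + e)) ℝ, Measure.map (fun x => g • x) μ = μ) :
    (meanMeasure l μ).restrict {x | LinearIndependent ℝ x} =
      volume.restrict {x | LinearIndependent ℝ x} := by
  have hloc : ∀ x : {x : Fin l → Fin (l + e) → ℝ // LinearIndependent ℝ x},
      ∃ V : Set (Fin l → Fin (l + e) → ℝ), IsOpen V ∧ x.1 ∈ V ∧
        (meanMeasure l μ).restrict V = volume.restrict V := by
    rintro ⟨x, hx⟩
    obtain ⟨h, hh⟩ := exists_act_det_top_ne_zero he hx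
    obtain ⟨K, hK, hxK, hKU⟩ := exists_compact_subset (isOpen_det_top l e) hh
    have hc : ∀ g : SpecialLinearGroup (Fin (l + e)) ℝ,
        Continuous (act g.val : (Fin l → Fin (l + e) → ℝ) → _) := fun g =>
      continuous_act.comp (continuous_const.prodMk continuous_id)
    refine ⟨act h.val ⁻¹' interior K, isOpen_interior.preimage (hc h), hxK,
      Measure.restrict_congr_mono (preimage_mono interior_subset) ?_⟩
    have hpre : act (h⁻¹).val ⁻¹' (act h.val ⁻¹' K) = K := by
      ext y
      rw [mem_preimage, mem_preimage, ← act_mul, ← val_mul, mul_inv_cancel, val_one, act_one]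
    have hKm : MeasurableSet (act h.val ⁻¹' K) := (hc h).measurable hK.measurableSet
    have h1 := ((measurePreserving_act_meanMeasure hinv (h⁻¹)).restrict_preimage hKm).map_eq
    have h2 := ((measurePreserving_act (l := l) (h⁻¹)).restrict_preimage hKm).map_eq
    rw [hpre] at h1 h2
    rw [← h1, ← h2, restrict_meanMeasure_of_isCompact he hinv hK hKU]
  choose V hVo hxV hV using hloc
  obtain ⟨T, hT, hTV⟩ := TopologicalSpace.isOpen_iUnion_countable V hVo
  refine Measure.restrict_congr_mono (t := ⋃ i ∈ T, V i) (fun x hx => ?_) ?_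
  · rw [hTV]
    exact mem_iUnion.2 ⟨⟨x, hx⟩, hxV _⟩
  · exact (Measure.restrict_biUnion_congr hT).2 fun i _ => hV i

theorem volume_not_linearIndependent {l e : ℕ} :
    volume {x : Fin l → Fin (l + e) → ℝ | ¬ LinearIndependent ℝ x} = 0 := by
  let v : Fin l → Fin (l + e) → ℝ := comb 1 0
  let U : Set (Fin l → Fin (l + e) → ℝ) := {x | (top x).det = 0}
  have hUm : MeasurableSet U := (isClosed_singleton.preimage continuous_top.matrix_det).measurableSet
  have hsub : {x : Fin l → Fin (l + e) → ℝ | ¬ LinearIndependent ℝ x} ⊆ U := by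
    intro x hx
    by_contra hdet
    refine hx ?_
    have h1 : LinearIndependent ℝ (top x).row :=
      Matrix.linearIndependent_rows_of_isUnit ((Matrix.isUnit_iff_isUnit_det _).2
        (isUnit_iff_ne_zero.2 hdet))
    exact LinearIndependent.of_comp (LinearMap.funLeft ℝ ℝ (Fin.castAdd e)) h1
  refine measure_mono_null hsub ?_
  have hvt : ∀ (x : Fin l → Fin (l + e) → ℝ) (c : ℝ), top (x + c • v) = top x + c • 1 := by
    intro x c
    ext t i
    simp [v, top, comb]
  have hfin : ∀ x : Fin l → Fin (l + e) → ℝ, {c : ℝ | x + c • v ∈ U}.Finite := by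
    intro x
    refine (Polynomial.finite_setOfPred_isRoot (Matrix.charpoly_monic (-top x)).ne_zero).subset ?_
    intro c hc
    have hc' : (top (x + c • v)).det = 0 := hc
    rw [hvt] at hc'
    change Polynomial.IsRoot _ c
    rw [Polynomial.IsRoot, Matrix.eval_charpoly, ← hc']
    congr 1
    ext i j
    simp [Matrix.smul_apply, add_comm, Matrix.scalar_apply, Matrix.diagonal_apply, Matrix.one_apply]
  have hm : Measurable fun p : (Fin l → Fin (l + e) → ℝ) × ℝ =>
      U.indicator (fun _ => (1 : ℝ≥0∞)) (p.1 + p.2 • v) :=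
    (measurable_const.indicator hUm).comp
      (continuous_fst.add (continuous_snd.smul continuous_const)).measurable
  have h1 : ∫⁻ c in Icc (0 : ℝ) 1, ∫⁻ x, U.indicator (fun _ => (1 : ℝ≥0∞)) (x + c • v) = volume U := by
    simp_rw [lintegral_add_right_eq_self (fun x => U.indicator (fun _ => (1 : ℝ≥0∞)) x)]
    simp [lintegral_indicator_const hUm]
  have h2 : ∀ x : Fin l → Fin (l + e) → ℝ,
      ∫⁻ c in Icc (0 : ℝ) 1, U.indicator (fun _ => (1 : ℝ≥0∞)) (x + c • v) = 0 := by
    intro x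
    refine (lintegral_congr_ae (g := 0) (ae_restrict_of_ae ?_)).trans (by simp)
    filter_upwards [(hfin x).measure_zero volume |> measure_eq_zero_iff_ae_notMem.1] with c hc
    exact indicator_of_notMem hc _
  rw [← h1, ← lintegral_lintegral_swap (f := fun x c => U.indicator (fun _ => (1 : ℝ≥0∞)) (x + c • v))
    hm.aemeasurable]
  simp [h2]

/-- Siegel's mean value formula for linearly independent tuples. -/
theorem lintegral_siegel_indicator {l d : ℕ} (hld : l < d)
    {μ : Measure (LatticeSpace d)} [IsProbabilityMeasure μ]
    (hinv : ∀ g : SpecialLinearGroup (Fin d) ℝ, Measure.map (fun x => g • x) μ = μ)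
    {G : (Fin l → Fin d → ℝ) → ℝ≥0∞} (hG : Measurable G) :
    ∫⁻ x, siegel ({y | LinearIndependent ℝ y}.indicator G) x ∂μ = ∫⁻ y, G y := by
  obtain ⟨e, rfl⟩ : ∃ e, d = l + (e + 1) := ⟨d - l - 1, by omega⟩
  have hW : MeasurableSet {y : Fin l → Fin (l + (e + 1)) → ℝ | LinearIndependent ℝ y} :=
    isOpen_setOfPred_linearIndependent.measurableSet
  rw [← lintegral_meanMeasure μ (hG.indicator hW), lintegral_indicator hW,
    restrict_meanMeasure (by omega) hinv, ← lintegral_indicator hW]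
  refine lintegral_congr_ae ?_
  have h0 : ∀ᵐ y : Fin l → Fin (l + (e + 1)) → ℝ, LinearIndependent ℝ y :=
    volume_not_linearIndependent
  filter_upwards [h0] with y hy
  exact indicator_of_mem (s := {y | LinearIndependent ℝ y}) hy G

section
variable {E : Type*} [NormedAddCommGroup E] [NormedSpace ℝ E] [FiniteDimensional ℝ E]

/-- The vectors of norm at most `R` in a subgroup. -/
def shortVectors (L : Submodule ℤ E) (R : ℝ) : Set E := {z | z ∈ L ∧ ‖z‖ ≤ R}

theorem finite_shortVectors (L : Submodule ℤ E) [DiscreteTopology L] (R : ℝ) :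
    (shortVectors L R).Finite := by
  have h := Metric.finite_isBounded_inter_isClosed (K := Metric.closedBall (0 : E) R)
    (s := (L.toAddSubgroup : Set E)) DiscreteTopology.isDiscrete Metric.isBounded_closedBall
    (AddSubgroup.isClosed_of_discrete)
  refine h.subset fun z hz => ⟨by simpa using hz.2, hz.1⟩

theorem shortVectors_mono {E : Type*} [NormedAddCommGroup E] (L : Submodule ℤ E) {R R' : ℝ} (h : R ≤ R') :
    shortVectors L R ⊆ shortVectors L R' := fun _ hz => ⟨hz.1, hz.2.trans h⟩

theorem finrank_mono {s t : Set E} (h : s ⊆ t) : s.finrank ℝ ≤ t.finrank ℝ :=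
  Submodule.finrank_mono (Submodule.span_mono h)

/-- Counting vectors modulo `q` reduces the count at radius `R` to the one at radius `2 * R / q`. -/
theorem ncard_shortVectors_le (L : Submodule ℤ E) [DiscreteTopology L] (R : ℝ) (q : ℕ)
    (hq : 0 < q) :
    (shortVectors L R).ncard ≤
      q ^ ((shortVectors L R).finrank ℝ) * (shortVectors L (2 * R / q)).ncard := by
  classical
  set S := shortVectors L R with hS
  have hSL : Submodule.span ℤ S ≤ L := Submodule.span_le.2 fun z hz => hz.1
  have hdisc : DiscreteTopology (Submodule.span ℤ S) :=
    DiscreteTopology.of_subset (s := (L : Set E)) (t := (Submodule.span ℤ S : Set E))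
      inferInstance hSL
  have hk : S.finrank ℝ = Module.finrank ℤ (Submodule.span ℤ S) :=
    Real.finrank_eq_int_finrank_of_discrete hdisc
  set P := Submodule.span ℤ S with hP
  let b := Module.finBasis ℤ P
  have : NeZero q := ⟨hq.ne'⟩
  have hSf : S.Finite := finite_shortVectors L R
  let g : E → (Fin (Module.finrank ℤ P) → ZMod q) := fun z =>
    if h : z ∈ P then fun i => (b.repr ⟨z, h⟩ i : ZMod q) else 0
  have hqR : (0 : ℝ) < q := by exact_mod_cast hq
  have key : hSf.toFinset.card ≤ (shortVectors L (2 * R / q)).ncard *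
      (Finset.univ : Finset (Fin (Module.finrank ℤ P) → ZMod q)).card := by
    refine Finset.card_le_mul_card_image_of_maps_to (f := g) (fun _ _ => Finset.mem_univ _) _ ?_
    intro c _
    by_cases hne : ({a ∈ hSf.toFinset | g a = c}).Nonempty
    · obtain ⟨z₀, hz₀⟩ := hne
      simp only [Finset.mem_filter, Set.Finite.mem_toFinset] at hz₀
      rw [← Set.ncard_coe_finset]
      refine Set.ncard_le_ncard_of_injOn (fun z => (q : ℝ)⁻¹ • (z - z₀)) ?_ ?_
        (finite_shortVectors L _)
      · intro z hz
        simp only [Finset.coe_filter, Set.Finite.mem_toFinset, mem_ofPred_eq] at hz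
        have hzP : z ∈ P := Submodule.subset_span hz.1
        have hzP0 : z₀ ∈ P := Submodule.subset_span hz₀.1
        have hgg : g z = g z₀ := hz.2.trans hz₀.2.symm
        have hdvd : ∀ i, (q : ℤ) ∣ b.repr (⟨z, hzP⟩ - ⟨z₀, hzP0⟩) i := by
          intro i
          have := congrFun hgg i
          simp only [g, hzP, hzP0, dif_pos] at this
          rw [map_sub, Finsupp.sub_apply]
          exact (ZMod.intCast_eq_intCast_iff_dvd_sub _ _ _).1 this.symm
        choose c' hc' using hdvd
        have hz' : z - z₀ = (q : ℝ) • ((∑ i, c' i • b i : P) : E) := by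
          have h1 : (⟨z, hzP⟩ - ⟨z₀, hzP0⟩ : P) = (q : ℤ) • ∑ i, c' i • b i := by
            rw [← b.sum_repr (⟨z, hzP⟩ - ⟨z₀, hzP0⟩ : P), Finset.smul_sum]
            refine Finset.sum_congr rfl fun i _ => ?_
            rw [hc' i, mul_smul]
          have h2 := congrArg (Subtype.val : P → E) h1
          rw [Submodule.coe_smul] at h2
          rw [show z - z₀ = ((⟨z, hzP⟩ - ⟨z₀, hzP0⟩ : P) : E) from rfl, h2]
          rw [← Int.cast_smul_eq_zsmul ℝ]; simp
        refine ⟨?_, ?_⟩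
        · rw [hz', smul_smul, inv_mul_cancel₀ hqR.ne', one_smul]
          exact hSL (Subtype.prop _)
        · rw [norm_smul, norm_inv, Real.norm_of_nonneg hqR.le, div_eq_inv_mul]
          have := norm_sub_le z z₀
          have h1 := hz.1.2
          have h2 := hz₀.1.2
          gcongr
          linarith
      · intro z _ z' _ h
        have := smul_right_injective E (inv_ne_zero hqR.ne') h
        simpa using this
    · rw [Finset.not_nonempty_iff_eq_empty.1 hne]; simp
  rw [Set.ncard_eq_toFinset_card S hSf, hk, mul_comm]
  simpa using key

theorem exists_linearIndepOn_shortVectors (L : Submodule ℤ E) [DiscreteTopology L] (k : ℕ) :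
    ∀ R : ℝ, 0 ≤ R → (shortVectors L R).finrank ℝ = k →
    ∃ Y : Finset E, LinearIndepOn ℝ id (Y : Set E) ∧ (Y : Set E) ⊆ shortVectors L R ∧
      Y.card = k ∧ (shortVectors L R).ncard * ∏ y ∈ Y, ‖y‖ ≤ 3 ^ (k * k) * R ^ k := by
  classical
  induction k using Nat.strong_induction_on with
  | _ k ih =>
  intro R hR hk
  rcases Nat.eq_zero_or_pos k with rfl | hkpos
  · refine ⟨∅, by simp, by simp, rfl, ?_⟩
    have hs : shortVectors L R ⊆ {0} := by
      have h0 : Submodule.span ℝ (shortVectors L R) = ⊥ := Submodule.finrank_eq_zero.1 hk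
      exact Submodule.span_eq_bot.1 h0
    have : (shortVectors L R).ncard ≤ 1 := by
      simpa using Set.ncard_le_ncard hs
    simpa using this
  · set T : Set E := {w | w ∈ shortVectors L R ∧ (shortVectors L ‖w‖).finrank ℝ = k} with hT
    have hmax : ∀ R' : ℝ, 0 ≤ R' → ∃ w ∈ shortVectors L R', shortVectors L ‖w‖ = shortVectors L R' := by
      intro R' hR'
      obtain ⟨w, hw, hw2⟩ := Set.exists_max_image (shortVectors L R') (fun z => ‖z‖)
        (finite_shortVectors L R') ⟨0, L.zero_mem, by simpa using hR'⟩
      exact ⟨w, hw, Subset.antisymm (shortVectors_mono L hw.2) fun z hz => ⟨hz.1, hw2 z hz⟩⟩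
    have hTne : T.Nonempty := by
      obtain ⟨w, hw, hw2⟩ := hmax R hR
      exact ⟨w, hw, by rw [hw2, hk]⟩
    obtain ⟨w, hw, hwmin⟩ := Set.exists_min_image T (fun z => ‖z‖)
      ((finite_shortVectors L R).subset fun z hz => hz.1) hTne
    set lam := ‖w‖ with hlam
    have hlam0 : 0 < lam := by
      rcases (norm_nonneg w).lt_or_eq with h | h
      · exact h
      · exfalso
        have h1 := hw.2
        rw [← h] at h1
        have hs : shortVectors L 0 ⊆ {0} := fun z hz => by simpa using hz.2
        have h2 : (shortVectors L 0).finrank ℝ ≤ 0 := by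
          refine (finrank_mono hs).trans ?_
          simp [Set.finrank]
        omega
    set q : ℕ := ⌊2 * R / lam⌋₊ + 1 with hq
    have hq1 : 2 * R / lam < q := by rw [hq]; push_cast; exact Nat.lt_floor_add_one _
    have hq2 : q * lam ≤ 3 * R := by
      have h1 : (⌊2 * R / lam⌋₊ : ℝ) ≤ 2 * R / lam := Nat.floor_le (by positivity)
      have h2 : lam ≤ R := hw.1.2
      rw [le_div_iff₀ hlam0] at h1
      rw [hq]; push_cast; linarith
    have hqpos : (0 : ℝ) < q := by rw [hq]; positivity
    set R' := 2 * R / q with hR'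
    have hR'_nonneg : 0 ≤ R' := by positivity
    have hR'lam : R' < lam := by
      rw [hR', div_lt_iff₀ hqpos]; rw [div_lt_iff₀ hlam0] at hq1; linarith
    have hsub : shortVectors L R' ⊆ shortVectors L lam := shortVectors_mono L hR'lam.le
    have hlt : (shortVectors L R').finrank ℝ < k := by
      refine lt_of_le_of_ne ?_ ?_
      · rw [← hw.2]; exact finrank_mono hsub
      · intro h
        obtain ⟨v, hv, hv2⟩ := hmax R' hR'_nonneg
        have := hwmin v ⟨shortVectors_mono L (hR'lam.le.trans hw.1.2) hv, by rw [hv2, h]⟩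
        have h2 := hv.2
        linarith
    obtain ⟨Y, hY1, hY2, hY3, hY4⟩ := ih _ hlt R' hR'_nonneg rfl
    set k' := (shortVectors L R').finrank ℝ with hk'
    have hYs : (Y : Set E) ⊆ shortVectors L lam := hY2.trans hsub
    have hZs := hY1.extend_subset hYs
    have hZf : (hY1.extend hYs).Finite := (finite_shortVectors L lam).subset hZs
    set Z := hZf.toFinset with hZ
    have hZc : (Z : Set E) = hY1.extend hYs := by simp [hZ]
    have hZli : LinearIndepOn ℝ id (Z : Set E) := by
      rw [hZc]; exact hY1.linearIndepOn_extend hYs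
    have hYZ : Y ⊆ Z := by
      rw [← Finset.coe_subset, hZc]; exact hY1.subset_extend hYs
    have hZk : Z.card = k := by
      rw [← finrank_span_finset_eq_card hZli, hZc, hY1.span_extend_eq_span hYs]
      exact hw.2
    refine ⟨Z, hZli, ?_, hZk, ?_⟩
    · rw [hZc]; exact hZs.trans (shortVectors_mono L hw.1.2)
    · have hN := ncard_shortVectors_le L R q (by omega)
      rw [hk] at hN
      have hN' : ((shortVectors L R).ncard : ℝ) ≤ q ^ k * (shortVectors L R').ncard := by
        exact_mod_cast hN
      have hprod : ∏ y ∈ Z, ‖y‖ ≤ lam ^ (k - k') * ∏ y ∈ Y, ‖y‖ := by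
        rw [← Finset.prod_sdiff hYZ]
        refine mul_le_mul_of_nonneg_right ?_ (Finset.prod_nonneg fun _ _ => norm_nonneg _)
        refine (Finset.prod_le_prod (g := fun _ => lam) (fun _ _ => norm_nonneg _) ?_).trans ?_
        · intro y hy
          have : y ∈ (Z : Set E) := (Finset.mem_sdiff.1 hy).1
          rw [hZc] at this
          exact (hZs this).2
        · rw [Finset.prod_const, Finset.card_sdiff_of_subset hYZ, hZk, hY3]
      calc ((shortVectors L R).ncard : ℝ) * ∏ y ∈ Z, ‖y‖
          ≤ (q ^ k * (shortVectors L R').ncard) * (lam ^ (k - k') * ∏ y ∈ Y, ‖y‖) := by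
            gcongr
        _ = q ^ k * lam ^ (k - k') * ((shortVectors L R').ncard * ∏ y ∈ Y, ‖y‖) := by ring
        _ ≤ q ^ k * lam ^ (k - k') * (3 ^ (k' * k') * R' ^ k') := by gcongr
        _ ≤ q ^ k * lam ^ (k - k') * (3 ^ (k' * k') * lam ^ k') := by gcongr
        _ = 3 ^ (k' * k') * (q * lam) ^ k := by
            rw [mul_pow, ← Nat.sub_add_cancel hlt.le, pow_add lam (k - k') k']
            simp only [Nat.add_sub_cancel]; ring
        _ ≤ 3 ^ (k' * k') * (3 * R) ^ k := by gcongr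
        _ = 3 ^ (k' * k' + k) * R ^ k := by rw [mul_pow, pow_add]; ring
        _ ≤ 3 ^ (k * k) * R ^ k := by
            gcongr
            · norm_num
            · nlinarith

end

/-- The columns of `M`, as a basis. -/
noncomputable def colBasis {d : ℕ} (M : SpecialLinearGroup (Fin d) ℝ) :
    Module.Basis (Fin d) ℝ (Fin d → ℝ) :=
  (Pi.basisFun ℝ (Fin d)).map (SpecialLinearGroup.toLin' M)

theorem mem_span_colBasis {d : ℕ} (M : SpecialLinearGroup (Fin d) ℝ) (z : Fin d → ℝ) :
    z ∈ Submodule.span ℤ (range (colBasis M)) ↔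
      ∃ n : Fin d → ℤ, M.val *ᵥ (fun i => (n i : ℝ)) = z := by
  rw [(colBasis M).mem_span_iff_repr_mem ℤ]
  have h : ∀ i, (colBasis M).repr z i = (SpecialLinearGroup.toLin' M).symm z i := by
    intro i; simp [colBasis]
  constructor
  · intro H
    choose n hn using H
    refine ⟨n, ?_⟩
    have : (fun i => (n i : ℝ)) = (SpecialLinearGroup.toLin' M).symm z := by
      ext i; rw [← h]; simpa using hn i
    rw [this]
    exact (SpecialLinearGroup.toLin' M).apply_symm_apply z
  · rintro ⟨n, rfl⟩ i
    rw [h]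
    refine ⟨n i, ?_⟩
    have : (SpecialLinearGroup.toLin' M).symm (M.val *ᵥ (fun i => (n i : ℝ))) =
        fun i => (n i : ℝ) := (SpecialLinearGroup.toLin' M).symm_apply_apply _
    rw [this]; simp

/-- The number of vectors of norm at most `R` in the lattice spanned by the columns of `M`. -/
noncomputable def latticeCount {d : ℕ} (M : SpecialLinearGroup (Fin d) ℝ) (R : ℝ) : ℕ :=
  (shortVectors (Submodule.span ℤ (range (colBasis M))) R).ncard

theorem mulVec_intCast_injective {d : ℕ} (M : SpecialLinearGroup (Fin d) ℝ) :
    Function.Injective fun n : Fin d → ℤ => M.val *ᵥ (fun i => (n i : ℝ)) := by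
  intro n n' h
  have := (SpecialLinearGroup.toLin' M).injective h
  ext i
  exact_mod_cast congrFun this i

theorem latticeSum_closedBall_le {d r : ℕ} (M : SpecialLinearGroup (Fin d) ℝ) {R : ℝ} (hR : 0 ≤ R) :
    latticeSum ((Metric.closedBall (0 : Fin r → Fin d → ℝ) R).indicator 1) M ≤
      (latticeCount M R : ℝ≥0∞) ^ r := by
  classical
  set φ := fun n : Fin d → ℤ => M.val *ᵥ (fun i => (n i : ℝ)) with hφ
  set S := shortVectors (Submodule.span ℤ (range (colBasis M))) R with hS
  have hSf : S.Finite := finite_shortVectors _ R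
  have hinj : Function.Injective φ := mulVec_intCast_injective M
  have hAf : (φ ⁻¹' S).Finite := hSf.preimage hinj.injOn
  have hcard : hAf.toFinset.card ≤ latticeCount M R := by
    rw [← Set.ncard_eq_toFinset_card _ hAf]
    exact Set.ncard_le_ncard_of_injOn φ (fun _ h => h) hinj.injOn hSf
  have hmem : ∀ m : Fin r → Fin d → ℤ, act M.val (realTuple m) ∈ Metric.closedBall 0 R →
      m ∈ Fintype.piFinset fun _ => hAf.toFinset := by
    intro m hm
    rw [Fintype.mem_piFinset]
    intro j
    rw [Set.Finite.mem_toFinset]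
    refine ⟨(mem_span_colBasis M _).2 ⟨m j, rfl⟩, ?_⟩
    rw [mem_closedBall_zero_iff, pi_norm_le_iff_of_nonneg hR] at hm
    exact hm j
  rw [latticeSum, tsum_eq_sum (s := Fintype.piFinset fun _ => hAf.toFinset)]
  · calc _ ≤ ∑ m ∈ Fintype.piFinset (fun _ : Fin r => hAf.toFinset), (1 : ℝ≥0∞) := by
          refine Finset.sum_le_sum fun m _ => ?_
          exact Set.indicator_le_self' (by simp) _
      _ = (hAf.toFinset.card : ℝ≥0∞) ^ r := by simp
      _ ≤ _ := by gcongr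
  · intro m hm
    exact Set.indicator_of_notMem (fun h => hm (hmem m h)) _

/-- A weight dominating powers of the lattice point counting function. -/
noncomputable def weight {d : ℕ} (R : ℝ) (r : ℕ) (v : Fin d → ℝ) : ℝ :=
  (Metric.closedBall (0 : Fin d → ℝ) R).indicator (fun v => (R / ‖v‖) ^ r) v

theorem integrable_weight {d r : ℕ} (hrd : r < d) {R : ℝ} (hR : 0 ≤ R) :
    Integrable (weight R r : (Fin d → ℝ) → ℝ) := by
  change Integrable ((Metric.closedBall (0 : Fin d → ℝ) R).indicator fun v => (R / ‖v‖) ^ r)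
  rw [integrable_indicator_iff Metric.isClosed_closedBall.measurableSet]
  refine (integrableOn_ball_of_norm_le_rpow (C := R ^ r) (α := r) (r := R + 1) ?_ ?_ ?_ ?_).mono_set
    (Metric.closedBall_subset_ball (by linarith))
  · simp; omega
  · simpa using hrd
  · refine ae_of_all _ fun v => ?_
    rw [Real.norm_of_nonneg (by positivity), div_pow, Real.rpow_neg (norm_nonneg _),
      Real.rpow_natCast, div_eq_mul_inv]
  · exact Measurable.aestronglyMeasurable (by fun_prop)

theorem lintegral_prod_weight_lt_top {d r k : ℕ} (hrd : r < d) {R : ℝ} (hR : 0 ≤ R) :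
    ∫⁻ x : Fin k → Fin d → ℝ, ENNReal.ofReal (∏ t, weight R r (x t)) < ∞ := by
  have : Integrable (fun x : Fin k → Fin d → ℝ => ∏ t, weight R r (x t)) :=
    Integrable.fintype_prod fun _ => integrable_weight hrd hR
  exact this.lintegral_lt_top

theorem measurable_weight {d r : ℕ} {R : ℝ} : Measurable (weight R r : (Fin d → ℝ) → ℝ) :=
  Measurable.indicator (by fun_prop) Metric.isClosed_closedBall.measurableSet

/-- A maximal linearly independent family of lattice vectors has its norms bounded below. -/
theorem one_le_factorial_mul_prod_norm {d : ℕ} (M : SpecialLinearGroup (Fin d) ℝ)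
    (n : Fin d → Fin d → ℤ) (hn : LinearIndependent ℝ (act M.val (realTuple n))) :
    1 ≤ (d.factorial : ℝ) * ∏ t, ‖act M.val (realTuple n) t‖ := by
  set Y : Matrix (Fin d) (Fin d) ℝ := act M.val (realTuple n) with hY
  have h1 : Y = ((Matrix.of n).map (Int.castRingHom ℝ)) * M.valᵀ := by
    ext t i
    simp only [hY, act, realTuple, mulVec, dotProduct, mul_apply, transpose_apply, map_apply,
      of_apply]
    exact Finset.sum_congr rfl fun _ _ => by simp [mul_comm]
  have hdet : Y.det = ((Matrix.of n).det : ℝ) := by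
    rw [h1, det_mul, det_transpose, M.prop, mul_one, ← RingHom.mapMatrix_apply, ← RingHom.map_det]
    simp
  have hne : Y.det ≠ 0 := by
    rw [← isUnit_iff_ne_zero, ← Matrix.isUnit_iff_isUnit_det,
      ← Matrix.linearIndependent_rows_iff_isUnit]
    exact hn
  have hge : 1 ≤ |Y.det| := by
    rw [hdet] at hne ⊢
    exact_mod_cast Int.one_le_abs (by exact_mod_cast hne)
  refine hge.trans ?_
  rw [det_apply]
  refine (Finset.abs_sum_le_sum_abs _ _).trans ?_
  calc _ ≤ ∑ σ : Equiv.Perm (Fin d), ∏ t, ‖Y t‖ := by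
        refine Finset.sum_le_sum fun σ _ => ?_
        rw [← Equiv.prod_comp σ (fun t => ‖Y t‖)]
        have : |Equiv.Perm.sign σ • ∏ i, Y (σ i) i| = ∏ i, |Y (σ i) i| := by
          rw [← Finset.abs_prod]
          rcases Int.units_eq_one_or (Equiv.Perm.sign σ) with h | h <;> simp [h]
        rw [this]
        exact Finset.prod_le_prod (fun _ _ => abs_nonneg _) fun i _ => norm_le_pi_norm (Y (σ i)) i
    _ = _ := by simp [Fintype.card_perm]

theorem exists_tuple_latticeCount_mul_le {d : ℕ} (M : SpecialLinearGroup (Fin d) ℝ) {R : ℝ}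
    (hR : 0 ≤ R) :
    ∃ k ≤ d, ∃ n : Fin k → Fin d → ℤ, LinearIndependent ℝ (act M.val (realTuple n)) ∧
      (∀ t, ‖act M.val (realTuple n) t‖ ≤ R) ∧
      latticeCount M R * ∏ t, ‖act M.val (realTuple n) t‖ ≤ 3 ^ (k * k) * R ^ k := by
  obtain ⟨Y, hY1, hY2, hY3, hY4⟩ := exists_linearIndepOn_shortVectors
    (Submodule.span ℤ (range (colBasis M))) _ R hR rfl
  set k := (shortVectors (Submodule.span ℤ (range (colBasis M))) R).finrank ℝ
  have hkd : k ≤ d := (Submodule.finrank_le (R := ℝ)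
    (Submodule.span ℝ (shortVectors (Submodule.span ℤ (range (colBasis M))) R))).trans_eq
    (by simp)
  let e : Fin k ≃ Y := (Y.equivFinOfCardEq hY3).symm
  choose n hn using fun t : Fin k => (mem_span_colBasis M (e t)).1 (hY2 (e t).2).1
  have hact : act M.val (realTuple n) = fun t => (e t : Fin d → ℝ) := funext hn
  refine ⟨k, hkd, n, ?_, ?_, ?_⟩
  · rw [hact]
    exact LinearIndependent.comp hY1 e e.injective
  · intro t
    rw [hact]
    exact (hY2 (e t).2).2
  · rw [hact]
    have : ∏ t, ‖(e t : Fin d → ℝ)‖ = ∏ y ∈ Y, ‖y‖ :=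
      (Equiv.prod_comp e (fun y : Y => ‖(y : Fin d → ℝ)‖)).trans (Finset.prod_coe_sort Y (fun y => ‖y‖))
    rw [this]
    exact hY4

theorem latticeCount_pow_le {d : ℕ} (r : ℕ) {R : ℝ} (hR : 0 ≤ R) :
    ∃ C : ℝ, ∀ M : SpecialLinearGroup (Fin d) ℝ,
      (latticeCount M R : ℝ≥0∞) ^ r ≤ ENNReal.ofReal C + ∑ k ∈ Finset.range d,
        ENNReal.ofReal C * latticeSum ({y : Fin k → Fin d → ℝ | LinearIndependent ℝ y}.indicator
          fun y => ENNReal.ofReal (∏ t, weight R r (y t))) M := by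
  refine ⟨max ((d.factorial * (3 ^ (d * d) * R ^ d)) ^ r) ((3 ^ (d * d)) ^ r), fun M => ?_⟩
  set C := max ((d.factorial * (3 ^ (d * d) * R ^ d)) ^ r) ((3 ^ (d * d) : ℝ) ^ r)
  have hC0 : 0 ≤ C := le_max_of_le_right (by positivity)
  obtain ⟨k, hkd, n, hn1, hn2, hn3⟩ := exists_tuple_latticeCount_mul_le M hR
  have hcast : (latticeCount M R : ℝ≥0∞) ^ r = ENNReal.ofReal ((latticeCount M R : ℝ) ^ r) := by
    rw [ENNReal.ofReal_pow (by positivity), ENNReal.ofReal_natCast]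
  rw [hcast]
  rcases hkd.lt_or_eq with hlt | rfl
  · refine le_add_left ((?_ : _ ≤ _).trans (Finset.single_le_sum (fun _ _ => zero_le)
      (Finset.mem_range.2 hlt)))
    refine le_trans ?_ (mul_le_mul_right (ENNReal.le_tsum n) _)
    rw [Set.indicator_of_mem (by exact hn1), ← ENNReal.ofReal_mul hC0]
    refine ENNReal.ofReal_le_ofReal ?_
    have hpos : ∀ t, 0 < ‖act M.val (realTuple n) t‖ := fun t => norm_pos_iff.2 (hn1.ne_zero t)
    have hw : ∏ t, weight R r (act M.val (realTuple n) t) =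
        (R ^ k / ∏ t, ‖act M.val (realTuple n) t‖) ^ r := by
      have h (t) : weight R r (act M.val (realTuple n) t) =
          (R / ‖act M.val (realTuple n) t‖) ^ r :=
        Set.indicator_of_mem (mem_closedBall_zero_iff.2 (hn2 t)) _
      rw [Finset.prod_congr rfl fun t _ => h t, Finset.prod_pow, Finset.prod_div_distrib]
      simp
    rw [hw]
    have h1 : (latticeCount M R : ℝ) ≤
        3 ^ (k * k) * (R ^ k / ∏ t, ‖act M.val (realTuple n) t‖) := by
      rw [← mul_div_assoc, le_div_iff₀ (Finset.prod_pos fun t _ => hpos t)]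
      exact hn3
    calc (latticeCount M R : ℝ) ^ r
        ≤ (3 ^ (k * k) * (R ^ k / ∏ t, ‖act M.val (realTuple n) t‖)) ^ r := by gcongr
      _ = (3 ^ (k * k)) ^ r * (R ^ k / ∏ t, ‖act M.val (realTuple n) t‖) ^ r := mul_pow _ _ _
      _ ≤ (3 ^ (d * d)) ^ r * (R ^ k / ∏ t, ‖act M.val (realTuple n) t‖) ^ r := by
          have : 0 ≤ R ^ k / ∏ t, ‖act M.val (realTuple n) t‖ := by positivity
          gcongr
          norm_num
      _ ≤ _ := by
          gcongr
          exact le_max_right _ _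
  · refine le_add_right (ENNReal.ofReal_le_ofReal (le_trans ?_ (le_max_left _ _)))
    have h1 := one_le_factorial_mul_prod_norm M n hn1
    have h2 : (latticeCount M R : ℝ) ≤ k.factorial * (3 ^ (k * k) * R ^ k) := by
      calc (latticeCount M R : ℝ)
          ≤ latticeCount M R * (k.factorial * ∏ t, ‖act M.val (realTuple n) t‖) :=
            le_mul_of_one_le_right (by positivity) h1
        _ = k.factorial * (latticeCount M R * ∏ t, ‖act M.val (realTuple n) t‖) := by ring
        _ ≤ _ := by gcongr
    gcongr

theorem lintegral_siegel_closedBall_lt_top {d r : ℕ} (hrd : r < d)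
    {μ : Measure (LatticeSpace d)} [IsProbabilityMeasure μ]
    (hinv : ∀ g : SpecialLinearGroup (Fin d) ℝ, Measure.map (fun x => g • x) μ = μ)
    {R : ℝ} (hR : 0 ≤ R) :
    ∫⁻ x, siegel ((Metric.closedBall (0 : Fin r → Fin d → ℝ) R).indicator 1) x ∂μ < ∞ := by
  obtain ⟨C, hC⟩ := latticeCount_pow_le (d := d) r hR
  have hmeas : ∀ k : ℕ, Measurable fun y : Fin k → Fin d → ℝ =>
      ENNReal.ofReal (∏ t, weight R r (y t)) := fun k =>
    ENNReal.measurable_ofReal.comp (Finset.measurable_prod _ fun t _ =>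
      measurable_weight.comp (measurable_pi_apply t))
  have hLI : ∀ k : ℕ, MeasurableSet {y : Fin k → Fin d → ℝ | LinearIndependent ℝ y} := fun k =>
    isOpen_setOfPred_linearIndependent.measurableSet
  calc _ ≤ ∫⁻ x, (ENNReal.ofReal C + ∑ k ∈ Finset.range d, ENNReal.ofReal C *
        siegel ({y : Fin k → Fin d → ℝ | LinearIndependent ℝ y}.indicator
          fun y => ENNReal.ofReal (∏ t, weight R r (y t))) x) ∂μ := by
        refine lintegral_mono fun x => ?_
        exact (latticeSum_closedBall_le _ hR).trans (hC _)
    _ = ENNReal.ofReal C + ∑ k ∈ Finset.range d, ENNReal.ofReal C *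
        ∫⁻ y : Fin k → Fin d → ℝ, ENNReal.ofReal (∏ t, weight R r (y t)) := by
        rw [lintegral_add_left measurable_const, lintegral_finsetSum]
        · simp only [lintegral_const, measure_univ, mul_one]
          congr 1
          refine Finset.sum_congr rfl fun k hk => ?_
          rw [lintegral_const_mul _ (measurable_siegel ((hmeas k).indicator (hLI k))),
            lintegral_siegel_indicator (Finset.mem_range.1 hk) hinv (hmeas k)]
        · intro k _
          exact (measurable_siegel ((hmeas k).indicator (hLI k))).const_mul _
    _ < ∞ := by
        refine ENNReal.add_lt_top.2 ⟨ENNReal.ofReal_lt_top, ENNReal.sum_lt_top.2 fun k _ => ?_⟩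
        exact ENNReal.mul_lt_top ENNReal.ofReal_lt_top (lintegral_prod_weight_lt_top hrd hR)

/-- The span of the columns of an integral tuple. -/
def colSpan {r d : ℕ} (m : Fin r → Fin d → ℤ) : Submodule ℝ (Fin r → ℝ) :=
  Submodule.span ℝ (range fun i : Fin d => fun j => (m j i : ℝ))

theorem mem_span_basisFun {r : ℕ} (v : Fin r → ℝ) :
    v ∈ Submodule.span ℤ (range (Pi.basisFun ℝ (Fin r))) ↔
      ∃ n : Fin r → ℤ, (fun j => (n j : ℝ)) = v := by
  rw [(Pi.basisFun ℝ (Fin r)).mem_span_iff_repr_mem ℤ]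
  constructor
  · intro H
    choose n hn using H
    exact ⟨n, funext fun j => by simpa using hn j⟩
  · rintro ⟨n, rfl⟩ j
    exact ⟨n j, by simp⟩

theorem exists_isZBasisOf_colSpan {r d : ℕ} (m : Fin r → Fin d → ℤ) :
    ∃ (l : ℕ) (B : Fin l → Fin r → ℤ), IsZBasisOf B (colSpan m) := by
  set π := colSpan m with hπ
  set Z := Submodule.span ℤ (range (Pi.basisFun ℝ (Fin r))) with hZ
  set L : Submodule ℤ (Fin r → ℝ) := π.restrictScalars ℤ ⊓ Z with hL
  have hdisc : DiscreteTopology L :=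
    DiscreteTopology.of_subset (s := (Z : Set (Fin r → ℝ))) (t := (L : Set (Fin r → ℝ)))
      (inferInstanceAs (DiscreteTopology (Submodule.span ℤ (range (Pi.basisFun ℝ (Fin r))))))
      (fun _ h => h.2)
  let b := Module.finBasis ℤ L
  choose B hB using fun t => (mem_span_basisFun _).1 (b t).2.2
  have hBb : (fun t => fun j => (B t j : ℝ)) = fun t => (b t : Fin r → ℝ) := funext hB
  have hspan : Submodule.span ℤ (range fun t => (b t : Fin r → ℝ)) = L := by
    have := congrArg (Submodule.map L.subtype) b.span_eq
    rw [Submodule.map_span, Submodule.map_top, Submodule.range_subtype, ← range_comp] at this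
    exact this
  refine ⟨_, B, fun t => ?_, ?_, ?_, ?_⟩
  · rw [hB]; exact (b t).2.1
  · rw [hBb, linearIndependent_iff_card_eq_finrank_span,
      Real.finrank_eq_int_finrank_of_discrete (by rw [hspan]; exact hdisc), Set.finrank, hspan]
    simp
  · rw [hBb]
    refine le_antisymm (Submodule.span_le.2 ?_) ?_
    · rintro _ ⟨t, rfl⟩
      exact (b t).2.1
    · refine Submodule.span_le.2 ?_
      rintro _ ⟨i, rfl⟩
      have h1 : (fun j => (m j i : ℝ)) ∈ L :=
        ⟨Submodule.subset_span ⟨i, rfl⟩, (mem_span_basisFun _).2 ⟨fun j => m j i, rfl⟩⟩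
      rw [← hspan] at h1
      exact Submodule.span_le_restrictScalars ℤ ℝ _ h1
  · intro v hv
    have h1 : (fun j => (v j : ℝ)) ∈ L := ⟨hv, (mem_span_basisFun _).2 ⟨v, rfl⟩⟩
    refine ⟨fun t => b.repr ⟨_, h1⟩ t, fun j => ?_⟩
    have h2 := congrArg (fun z : L => (z : Fin r → ℝ) j) (b.sum_repr ⟨_, h1⟩)
    have h3 : ∑ t, (b.repr ⟨_, h1⟩ t : ℝ) * (B t j : ℝ) = v j := by
      refine Eq.trans ?_ h2
      simp only [Submodule.coe_sum, Submodule.coe_smul, Finset.sum_apply, Pi.mul_apply,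
        Pi.intCast_apply, zsmul_eq_mul, ← hB]
    exact_mod_cast h3.symm

/-- The integral tuple with coordinates `n` in the basis `B`. -/
def combine {r l d : ℕ} (B : Fin l → Fin r → ℤ) (n : Fin l → Fin d → ℤ) : Fin r → Fin d → ℤ :=
  fun j i => ∑ t, B t j * n t i

/-- The tuple with coordinates `x` in the basis `B`. -/
def combineReal {r l d : ℕ} (B : Fin l → Fin r → ℤ) (x : Fin l → Fin d → ℝ) : Fin r → Fin d → ℝ :=
  fun j i => ∑ t, (B t j : ℝ) * x t i

theorem continuous_combineReal {r l d : ℕ} (B : Fin l → Fin r → ℤ) :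
    Continuous (combineReal B : (Fin l → Fin d → ℝ) → Fin r → Fin d → ℝ) := by
  unfold combineReal; fun_prop

theorem act_combine {r l d : ℕ} (B : Fin l → Fin r → ℤ) (n : Fin l → Fin d → ℤ)
    (g : Matrix (Fin d) (Fin d) ℝ) :
    act g (realTuple (combine B n)) = combineReal B (act g (realTuple n)) := by
  ext j i
  simp only [act, realTuple, combine, combineReal, mulVec, dotProduct]
  push_cast
  simp only [Finset.mul_sum]
  rw [Finset.sum_comm]
  exact Finset.sum_congr rfl fun _ _ => Finset.sum_congr rfl fun _ _ => by ring

theorem colSpan_combine_eq_iff {r l d : ℕ} {B : Fin l → Fin r → ℤ}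
    {π : Submodule ℝ (Fin r → ℝ)} (hB : IsZBasisOf B π) (n : Fin l → Fin d → ℤ) :
    colSpan (combine B n) = π ↔ LinearIndependent ℝ (realTuple n) := by
  obtain ⟨-, hli, hsp, -⟩ := hB
  set T := Fintype.linearCombination ℝ (fun t => fun j => (B t j : ℝ)) with hT
  have hTinj : Function.Injective T := hli.fintypeLinearCombination_injective
  have h1 : colSpan (combine B n) = (colSpan n).map T := by
    rw [colSpan, colSpan, Submodule.map_span, ← range_comp]
    congr 2
    ext i j
    simp [hT, combine, Fintype.linearCombination_apply, mul_comm]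
  have h2 : π = Submodule.map T ⊤ := by
    rw [Submodule.map_top, hT, Fintype.range_linearCombination, hsp]
  rw [h1, h2, (Submodule.map_injective_of_injective hTinj).eq_iff]
  have h3 : Module.finrank ℝ (colSpan n) = (Matrix.of (realTuple n)).rank := by
    rw [Matrix.rank_eq_finrank_span_cols]; rfl
  constructor
  · intro h
    rw [h, finrank_top, Module.finrank_pi, Matrix.rank_eq_finrank_span_row] at h3
    rw [linearIndependent_iff_card_eq_finrank_span]
    exact h3
  · intro h
    apply Submodule.eq_top_of_finrank_eq
    rw [h3, LinearIndependent.rank_matrix (M := Matrix.of (realTuple n)) h]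
    simp

theorem combine_injective {r l d : ℕ} {B : Fin l → Fin r → ℤ}
    {π : Submodule ℝ (Fin r → ℝ)} (hB : IsZBasisOf B π) :
    Function.Injective (combine B : (Fin l → Fin d → ℤ) → Fin r → Fin d → ℤ) := by
  intro n n' h
  have hTinj : Function.Injective (Fintype.linearCombination ℝ (fun t => fun j => (B t j : ℝ))) :=
    hB.2.1.fintypeLinearCombination_injective
  ext t i
  have : (fun t => (n t i : ℝ)) = fun t => (n' t i : ℝ) := by
    apply hTinj
    ext j
    have h1 := congrFun (congrFun h j) i
    simp only [combine] at h1
    simp only [Fintype.linearCombination_apply, Finset.sum_apply, Pi.smul_apply, smul_eq_mul,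
      mul_comm _ (B _ j : ℝ)]
    exact_mod_cast h1
  exact_mod_cast congrFun this t

theorem mem_range_combine {r l d : ℕ} {B : Fin l → Fin r → ℤ}
    {m : Fin r → Fin d → ℤ} (hB : IsZBasisOf B (colSpan m)) : m ∈ range (combine B (d := d)) := by
  choose c hc using fun i => hB.2.2.2 (fun j => m j i) (Submodule.subset_span ⟨i, rfl⟩)
  refine ⟨fun t i => c i t, ?_⟩
  ext j i
  simp only [combine]
  rw [hc i j]
  exact Finset.sum_congr rfl fun _ _ => mul_comm _ _

/-- The rational subspaces, namely those having a basis of their integer points. -/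
def ratSubspace (r : ℕ) : Set (Submodule ℝ (Fin r → ℝ)) :=
  {π | ∃ (l : ℕ) (B : Fin l → Fin r → ℤ), IsZBasisOf B π}

instance (r : ℕ) : Countable (ratSubspace r) := by
  refine Set.Countable.to_subtype (Set.Countable.mono (s₂ := range
    fun p : Σ l, Fin l → Fin r → ℤ =>
      Submodule.span ℝ (range fun t => fun j => (p.2 t j : ℝ))) ?_ (countable_range _))
  rintro π ⟨l, B, hB⟩
  exact ⟨⟨l, B⟩, hB.2.2.1⟩

/-- The sum over the tuples whose columns span a given rational subspace. -/
theorem tsum_colSpan_eq {r l d : ℕ} {B : Fin l → Fin r → ℤ} {π : Submodule ℝ (Fin r → ℝ)}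
    (hB : IsZBasisOf B π) (G : (Fin r → Fin d → ℝ) → ℝ≥0∞)
    (M : SpecialLinearGroup (Fin d) ℝ) :
    ∑' m : Fin r → Fin d → ℤ,
      ({m | colSpan m = π}.indicator (fun m => G (act M.val (realTuple m)))) m =
    latticeSum ({y : Fin l → Fin d → ℝ | LinearIndependent ℝ y}.indicator
      fun y => G (combineReal B y)) M := by
  classical
  rw [← (combine_injective hB).tsum_eq]
  · refine tsum_congr fun n => ?_
    have hiff : (combine B n ∈ {m | colSpan m = π}) ↔
        act M.val (realTuple n) ∈ {y : Fin l → Fin d → ℝ | LinearIndependent ℝ y} :=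
      (colSpan_combine_eq_iff hB n).trans (linearIndependent_act M).symm
    rw [Set.indicator_apply, Set.indicator_apply]
    simp only [hiff, act_combine]
  · intro m hm
    have hm' : colSpan m = π := Set.mem_of_indicator_ne_zero (s := {m | colSpan m = π}) hm
    subst hm'
    exact mem_range_combine hB

theorem latticeSum_eq_tsum_ratSubspace {r d : ℕ} (G : (Fin r → Fin d → ℝ) → ℝ≥0∞)
    (M : SpecialLinearGroup (Fin d) ℝ) :
    latticeSum G M = ∑' π : ratSubspace r, ∑' m : Fin r → Fin d → ℤ,
      ({m | colSpan m = π.1}.indicator (fun m => G (act M.val (realTuple m)))) m := by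
  classical
  rw [ENNReal.tsum_comm]
  refine tsum_congr fun m => ?_
  rw [tsum_eq_single (⟨colSpan m, exists_isZBasisOf_colSpan m⟩ : ratSubspace r)]
  · rw [Set.indicator_of_mem (by exact rfl)]
  · intro π hπ
    exact Set.indicator_of_notMem (s := {m | colSpan m = π.1})
      (fun h => hπ (Subtype.ext (Eq.symm h))) _

theorem le_of_isZBasisOf {r l : ℕ} {B : Fin l → Fin r → ℤ} {π : Submodule ℝ (Fin r → ℝ)}
    (hB : IsZBasisOf B π) : l ≤ r := by
  simpa using hB.2.1.fintype_card_le_finrank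

/-- Rogers' formula for nonnegative functions. -/
theorem lintegral_siegel_eq_tsum {d r : ℕ} (hrd : r < d)
    {μ : Measure (LatticeSpace d)} [IsProbabilityMeasure μ]
    (hinv : ∀ g : SpecialLinearGroup (Fin d) ℝ, Measure.map (fun x => g • x) μ = μ)
    {G : (Fin r → Fin d → ℝ) → ℝ≥0∞} (hG : Measurable G)
    {l : ratSubspace r → ℕ} {B : ∀ π, Fin (l π) → Fin r → ℤ} (hB : ∀ π, IsZBasisOf (B π) π.1) :
    ∫⁻ x, siegel G x ∂μ =
      ∑' π : ratSubspace r, ∫⁻ y : Fin (l π) → Fin d → ℝ, G (combineReal (B π) y) := by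
  have hm : ∀ π, Measurable fun y : Fin (l π) → Fin d → ℝ => G (combineReal (B π) y) := fun π =>
    hG.comp (continuous_combineReal _).measurable
  have h : ∀ x, siegel G x = ∑' π : ratSubspace r,
      siegel ({y : Fin (l π) → Fin d → ℝ | LinearIndependent ℝ y}.indicator
        fun y => G (combineReal (B π) y)) x := by
    intro x
    refine (latticeSum_eq_tsum_ratSubspace G _).trans (tsum_congr fun π => ?_)
    exact tsum_colSpan_eq (hB π) G _
  simp only [h]
  rw [lintegral_tsum]
  · refine tsum_congr fun π => ?_
    exact lintegral_siegel_indicator ((le_of_isZBasisOf (hB π)).trans_lt hrd) hinv (hm π)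
  · intro π
    exact (measurable_siegel ((hm π).indicator
      isOpen_setOfPred_linearIndependent.measurableSet)).aemeasurable

theorem lintegral_siegel_lt_top {d r : ℕ} (hrd : r < d)
    {μ : Measure (LatticeSpace d)} [IsProbabilityMeasure μ]
    (hinv : ∀ g : SpecialLinearGroup (Fin d) ℝ, Measure.map (fun x => g • x) μ = μ)
    {F : (Fin r → Fin d → ℝ) → ℝ} (hFb : ∃ C : ℝ, ∀ x, |F x| ≤ C) (hFc : HasCompactSupport F) :
    ∫⁻ x, siegel (fun y => ‖F y‖ₑ) x ∂μ < ∞ := by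
  obtain ⟨C, hC⟩ := hFb
  obtain ⟨R, hR⟩ := hFc.isBounded.subset_closedBall (0 : Fin r → Fin d → ℝ)
  have hle : ∀ y, ‖F y‖ₑ ≤ ENNReal.ofReal C *
      (Metric.closedBall (0 : Fin r → Fin d → ℝ) (max R 0)).indicator 1 y := by
    intro y
    by_cases hy : F y = 0
    · simp [hy]
    · have : y ∈ Metric.closedBall (0 : Fin r → Fin d → ℝ) (max R 0) :=
        Metric.closedBall_subset_closedBall (le_max_left _ _)
          (hR (subset_tsupport F (by exact hy)))
      rw [Set.indicator_of_mem this, Pi.one_apply, mul_one, ← ofReal_norm]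
      exact ENNReal.ofReal_le_ofReal (hC y)
  calc ∫⁻ x, siegel (fun y => ‖F y‖ₑ) x ∂μ
      ≤ ∫⁻ x, ENNReal.ofReal C *
        siegel ((Metric.closedBall (0 : Fin r → Fin d → ℝ) (max R 0)).indicator 1) x ∂μ := by
        refine lintegral_mono fun x => ?_
        refine le_trans (ENNReal.tsum_le_tsum fun n => hle _) ?_
        rw [ENNReal.tsum_mul_left]
        rfl
    _ = ENNReal.ofReal C * ∫⁻ x,
        siegel ((Metric.closedBall (0 : Fin r → Fin d → ℝ) (max R 0)).indicator 1) x ∂μ :=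
        lintegral_const_mul _ (measurable_siegel (measurable_one.indicator
          Metric.isClosed_closedBall.measurableSet))
    _ < ∞ := ENNReal.mul_lt_top ENNReal.ofReal_lt_top
        (lintegral_siegel_closedBall_lt_top hrd hinv (le_max_right _ _))

/-- A sum of reals is the difference of the sums of its positive and negative parts. -/
theorem tsum_eq_toReal_sub_toReal {ι : Type*} {a : ι → ℝ} (h : ∑' i, ‖a i‖ₑ ≠ ∞) :
    ∑' i, a i = (∑' i, ENNReal.ofReal (a i)).toReal - (∑' i, ENNReal.ofReal (-a i)).toReal := by
  have h1 : ∑' i, ENNReal.ofReal (a i) ≠ ∞ := ne_top_of_le_ne_top h (ENNReal.tsum_le_tsum fun i => by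
    rw [← ofReal_norm]; exact ENNReal.ofReal_le_ofReal (le_abs_self _))
  have h2 : ∑' i, ENNReal.ofReal (-a i) ≠ ∞ := ne_top_of_le_ne_top h (ENNReal.tsum_le_tsum fun i => by
    rw [← ofReal_norm]; exact ENNReal.ofReal_le_ofReal (neg_le_abs _))
  rw [ENNReal.tsum_toReal_eq fun i => ENNReal.ofReal_ne_top,
    ENNReal.tsum_toReal_eq fun i => ENNReal.ofReal_ne_top,
    ← (ENNReal.summable_toReal h1).tsum_sub (ENNReal.summable_toReal h2)]
  refine tsum_congr fun i => ?_
  rw [ENNReal.toReal_ofReal', ENNReal.toReal_ofReal']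
  exact (max_zero_sub_max_neg_zero_eq_self (a i)).symm

end Rogers

open Rogers

/-- Rogers-type full moment formula: for `d > r ≥ 1` and `F : (ℝ^d)^r → ℝ` bounded, Borel
and compactly supported, the integral over `SL(d,ℝ)/SL(d,ℤ)` (with invariant probability
measure `μ`) of `f(M) = ∑_{m¹,…,m^r ∈ ℤ^d} F(M m¹, …, M m^r)` equals
`∑_{l=0}^{r} ∑_{π ∈ Gr(r,l)(ℚ)} covol(π_ℤ)^{-d} ∫_{π'} F dx`. Here the contribution of a
rational subspace `π` is expressed, via the change of variables given by any `ℤ`-basis `B`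
of `π ∩ ℤ^r` (whose Jacobian is `covol(π_ℤ)`), as
`∫_{(ℝ^d)^l} F(∑_t B_t¹ x^t, …, ∑_t B_t^r x^t) dx`, non-rational subspaces contributing `0`;
for `l = 0` the integral is the Dirac mass at the origin. -/
theorem stmt_14 (d r : ℕ) (hr : 1 ≤ r) (hrd : r < d)
    (F : (Fin r → Fin d → ℝ) → ℝ) (hFm : Measurable F)
    (hFb : ∃ C : ℝ, ∀ x, |F x| ≤ C) (hFc : HasCompactSupport F)
    (μ : Measure (Matrix.SpecialLinearGroup (Fin d) ℝ ⧸ SLZ d)) [IsProbabilityMeasure μ]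
    (hinv : ∀ g : Matrix.SpecialLinearGroup (Fin d) ℝ,
      Measure.map (fun x => g • x) μ = μ)
    (f : (Matrix.SpecialLinearGroup (Fin d) ℝ ⧸ SLZ d) → ℝ)
    (hf : ∀ M : Matrix.SpecialLinearGroup (Fin d) ℝ,
      f (QuotientGroup.mk M) =
        ∑' m : Fin r → Fin d → ℤ,
          F fun j i => (M.val.mulVec fun i' => ((m j i' : ℝ))) i)
    (val : Submodule ℝ (Fin r → ℝ) → ℝ)
    (hval : ∀ (l : ℕ) (π : Submodule ℝ (Fin r → ℝ)) (B : Fin l → Fin r → ℤ),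
      IsZBasisOf B π →
        val π = ∫ x : Fin l → Fin d → ℝ,
          F fun j i => ∑ t : Fin l, (B t j : ℝ) * x t i)
    (hval0 : ∀ π : Submodule ℝ (Fin r → ℝ),
      (¬ ∃ (l : ℕ) (B : Fin l → Fin r → ℤ), IsZBasisOf B π) → val π = 0) :
    ∫ x, f x ∂μ = ∑' π : Submodule ℝ (Fin r → ℝ), val π := by
  have hex : ∀ π : ratSubspace r, ∃ (l : ℕ) (B : Fin l → Fin r → ℤ), IsZBasisOf B π.1 :=
    fun π => π.2
  choose l B hB using hex
  set Fp : (Fin r → Fin d → ℝ) → ENNReal := fun y => ENNReal.ofReal (F y) with hFp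
  set Fn : (Fin r → Fin d → ℝ) → ENNReal := fun y => ENNReal.ofReal (-F y) with hFn
  have hFpm : Measurable Fp := hFm.ennreal_ofReal
  have hFnm : Measurable Fn := hFm.neg.ennreal_ofReal
  have hFem : Measurable fun y => ‖F y‖ₑ := hFm.enorm
  have hfin := lintegral_siegel_lt_top hrd hinv hFb hFc
  have hpe : ∀ y, Fp y ≤ ‖F y‖ₑ := fun y => by
    rw [← ofReal_norm]; exact ENNReal.ofReal_le_ofReal (le_abs_self _)
  have hne : ∀ y, Fn y ≤ ‖F y‖ₑ := fun y => by
    rw [← ofReal_norm]; exact ENNReal.ofReal_le_ofReal (neg_le_abs _)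
  have hpfin : ∫⁻ x, siegel Fp x ∂μ ≠ ⊤ := ne_top_of_le_ne_top hfin.ne
    (lintegral_mono fun x => ENNReal.tsum_le_tsum fun n => hpe _)
  have hnfin : ∫⁻ x, siegel Fn x ∂μ ≠ ⊤ := ne_top_of_le_ne_top hfin.ne
    (lintegral_mono fun x => ENNReal.tsum_le_tsum fun n => hne _)
  have hfae : ∀ᵐ x ∂μ, f x = (siegel Fp x).toReal - (siegel Fn x).toReal := by
    filter_upwards [ae_lt_top (measurable_siegel hFem) hfin.ne] with x hx
    conv_lhs => rw [← Quotient.out_eq x]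
    exact (hf _).trans (tsum_eq_toReal_sub_toReal hx.ne)
  have hlhs : ∫ x, f x ∂μ =
      (∫⁻ x, siegel Fp x ∂μ).toReal - (∫⁻ x, siegel Fn x ∂μ).toReal := by
    have hpm := (measurable_siegel hFpm).aemeasurable (μ := μ)
    have hnm := (measurable_siegel hFnm).aemeasurable (μ := μ)
    rw [integral_congr_ae hfae, integral_sub (integrable_toReal_of_lintegral_ne_top hpm hpfin)
      (integrable_toReal_of_lintegral_ne_top hnm hnfin),
      integral_toReal hpm (ae_lt_top (measurable_siegel hFpm) hpfin),
      integral_toReal hnm (ae_lt_top (measurable_siegel hFnm) hnfin)]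
  rw [lintegral_siegel_eq_tsum hrd hinv hFem hB] at hfin
  rw [lintegral_siegel_eq_tsum hrd hinv hFpm hB] at hpfin hlhs
  rw [lintegral_siegel_eq_tsum hrd hinv hFnm hB] at hnfin hlhs
  rw [hlhs, ENNReal.tsum_toReal_eq (ENNReal.ne_top_of_tsum_ne_top hpfin),
    ENNReal.tsum_toReal_eq (ENNReal.ne_top_of_tsum_ne_top hnfin),
    ← (ENNReal.summable_toReal hpfin).tsum_sub (ENNReal.summable_toReal hnfin),
    ← tsum_subtype_eq_of_support_subset (s := ratSubspace r) (f := val)]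
  · refine tsum_congr fun π => ?_
    rw [hval _ _ _ (hB π)]
    refine (integral_eq_lintegral_pos_part_sub_lintegral_neg_part
      (f := fun y : Fin (l π) → Fin d → ℝ => F (combineReal (B π) y)) ⟨?_, ?_⟩).symm
    · exact (hFm.comp (continuous_combineReal _).measurable).aestronglyMeasurable
    · exact (ENNReal.ne_top_of_tsum_ne_top hfin.ne π).lt_top
  · intro π hπ
    by_contra h
    exact hπ (hval0 π h)
end
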